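/- arXiv:1711.00948 — 3 statements merged into one kernel-verified Lean document; each statement's English description precedes it below -/
import Mathlib

section
/- For every K ≥ 1 there exists a constant C > 0, depending only on K, with the following property. If f : ℝ³ × ℝ × ℝ³ → ℝ is of class C² with f ≥ 1/K everywhere and with |f| and all partial derivatives of f up to order 2 bounded by K, and if u : ℝ³ → ℝ is C^∞ on B₁₀, satisfies σ₂(D²u(x)) = f(x, u(x), Du(x)) and Δu(x) > 0 for all x ∈ B₁₀, and |u(x)| + |Du(x)| ≤ K for all x ∈ B₁₀, then sup_{x ∈ B_{1/2}} |D²u(x)| ≤ C, where |D²u(x)| denotes the Frobenius norm of the Hessian matrix. -/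
open Metric MeasureTheory Real

noncomputable section

abbrev E3 : Type := EuclideanSpace ℝ (Fin 3)

/-- The `i`-th partial derivative of `u`. -/
def pd (i : Fin 3) (u : E3 → ℝ) : E3 → ℝ :=
  fun x => fderiv ℝ u x (EuclideanSpace.single i 1)

/-- The gradient `Du` of `u` as a vector in `ℝ³`. -/
def grad (u : E3 → ℝ) (x : E3) : E3 :=
  (WithLp.equiv 2 (Fin 3 → ℝ)).symm (fun i => pd i u x)

/-- The Hessian matrix `D²u`. -/
def hess (u : E3 → ℝ) (x : E3) : Matrix (Fin 3) (Fin 3) ℝ :=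
  Matrix.of fun i j => pd i (pd j u) x

/-- The Laplacian `Δu`. -/
def lap (u : E3 → ℝ) (x : E3) : ℝ := ∑ i, hess u x i i

def sigma1 (A : Matrix (Fin 3) (Fin 3) ℝ) : ℝ := A.trace

def sigma2 (A : Matrix (Fin 3) (Fin 3) ℝ) : ℝ := (A.trace ^ 2 - (A * A).trace) / 2

def sigma3 (A : Matrix (Fin 3) (Fin 3) ℝ) : ℝ := A.det

/-- The matrix `σ₂^{ij}(x) = Δu(x) δ_{ij} - ∂_i∂_j u(x)`. -/
def sg (u : E3 → ℝ) (x : E3) : Matrix (Fin 3) (Fin 3) ℝ :=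
  lap u x • (1 : Matrix (Fin 3) (Fin 3) ℝ) - hess u x

/-- `f_{u_p}`: the partial derivative of `f` in its `p`-th gradient variable,
evaluated at `(x, u(x), Du(x))`. -/
def fp (f : E3 × ℝ × E3 → ℝ) (u : E3 → ℝ) (p : Fin 3) (x : E3) : ℝ :=
  fderiv ℝ f (x, u x, grad u x) (0, 0, EuclideanSpace.single p 1)

/-- The standing hypotheses: `f` is `C²`, bounded below by `1/K`, with `|f|` and all
derivatives up to order 2 bounded by `K`; `u` is smooth on `B₁₀`, solves
`σ₂(D²u) = f(x,u,Du)` with `Δu > 0` on `B₁₀`, and `|u| + |Du| ≤ K` on `B₁₀`. -/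
def Hyp (K : ℝ) (f : E3 × ℝ × E3 → ℝ) (u : E3 → ℝ) : Prop :=
  ContDiff ℝ 2 f ∧
  (∀ z, 1 / K ≤ f z) ∧
  (∀ z, ∀ k : ℕ, k ≤ 2 → ‖iteratedFDeriv ℝ k f z‖ ≤ K) ∧
  ContDiffOn ℝ (⊤ : ℕ∞) u (ball (0 : E3) 10) ∧
  (∀ x ∈ ball (0 : E3) 10, sigma2 (hess u x) = f (x, u x, grad u x)) ∧
  (∀ x ∈ ball (0 : E3) 10, 0 < lap u x) ∧
  (∀ x ∈ ball (0 : E3) 10, |u x| + ‖grad u x‖ ≤ K)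

open scoped ContDiff

lemma pd_smooth {g : E3 → ℝ} (hg : ContDiff ℝ ∞ g) (i : Fin 3) : ContDiff ℝ ∞ (pd i g) := by
  unfold pd
  exact (hg.fderiv_right (m := ∞) (by simp)).clm_apply contDiff_const

lemma smooth_diff {g : E3 → ℝ} (hg : ContDiff ℝ ∞ g) : Differentiable ℝ g :=
  hg.differentiable (by simp)

lemma pd_add {f g : E3 → ℝ} (hf : ContDiff ℝ ∞ f) (hg : ContDiff ℝ ∞ g) (i : Fin 3) :
    pd i (fun x => f x + g x) = fun x => pd i f x + pd i g x := by
  funext x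
  simp only [pd]
  rw [fderiv_fun_add (smooth_diff hf x) (smooth_diff hg x)]
  simp

lemma pd_sub {f g : E3 → ℝ} (hf : ContDiff ℝ ∞ f) (hg : ContDiff ℝ ∞ g) (i : Fin 3) :
    pd i (fun x => f x - g x) = fun x => pd i f x - pd i g x := by
  funext x
  simp only [pd]
  rw [fderiv_fun_sub (smooth_diff hf x) (smooth_diff hg x)]
  simp

lemma pd_mul {f g : E3 → ℝ} (hf : ContDiff ℝ ∞ f) (hg : ContDiff ℝ ∞ g) (i : Fin 3) :
    pd i (fun x => f x * g x) = fun x => f x * pd i g x + g x * pd i f x := by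
  funext x
  simp only [pd]
  rw [fderiv_fun_mul (smooth_diff hf x) (smooth_diff hg x)]
  simp

lemma pd_const (c : ℝ) (i : Fin 3) : pd i (fun _ => c) = fun _ => 0 := by
  funext x
  simp [pd]

lemma pd_cmul {g : E3 → ℝ} (hg : ContDiff ℝ ∞ g) (c : ℝ) (i : Fin 3) :
    pd i (fun x => c * g x) = fun x => c * pd i g x := by
  rw [pd_mul contDiff_const hg, pd_const]
  simp

lemma pd_sum {ι : Type*} (s : Finset ι) {g : ι → E3 → ℝ} (hg : ∀ k, ContDiff ℝ ∞ (g k))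
    (i : Fin 3) :
    pd i (fun x => ∑ k ∈ s, g k x) = fun x => ∑ k ∈ s, pd i (g k) x := by
  funext x
  simp only [pd]
  rw [fderiv_fun_sum (fun k _ => smooth_diff (hg k) x)]
  simp

lemma pd_coord (i k : Fin 3) : pd i (fun x : E3 => x k) = fun _ => if k = i then 1 else 0 := by
  funext x
  have : HasFDerivAt (fun x : E3 => x k) (EuclideanSpace.proj k : E3 →L[ℝ] ℝ) x :=
    (EuclideanSpace.proj k : E3 →L[ℝ] ℝ).hasFDerivAt
  simp only [pd]
  rw [this.fderiv]
  simp [EuclideanSpace.proj]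

lemma coord_smooth (k : Fin 3) : ContDiff ℝ ∞ (fun x : E3 => x k) :=
  (EuclideanSpace.proj k : E3 →L[ℝ] ℝ).contDiff

lemma pd_comm {g : E3 → ℝ} (hg : ContDiff ℝ ∞ g) (i j : Fin 3) :
    pd i (pd j g) = pd j (pd i g) := by
  funext x
  have h1 : ContDiff ℝ ∞ (fderiv ℝ g) := hg.fderiv_right (m := ∞) (by simp)
  have h2 : DifferentiableAt ℝ (fderiv ℝ g) x := (h1.differentiable (by simp)) x
  have key : ∀ a b : Fin 3, pd a (pd b g) x =
      fderiv ℝ (fderiv ℝ g) x (EuclideanSpace.single a 1) (EuclideanSpace.single b 1) := by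
    intro a b
    change fderiv ℝ (fun y => fderiv ℝ g y (EuclideanSpace.single b 1)) x _ = _
    rw [fderiv_clm_apply h2 (differentiableAt_const _)]
    simp
  rw [key, key]
  have := (hg.contDiffAt (x := x)).isSymmSndFDerivAt (n := ∞) (by
    simp only [minSmoothness_of_isRCLikeNormedField]
    exact WithTop.coe_le_coe.2 (le_top : (2 : ℕ∞) ≤ ⊤))
  exact this _ _

lemma pd_congr {f g : E3 → ℝ} {s : Set E3} (hs : IsOpen s) (h : ∀ x ∈ s, f x = g x) (i : Fin 3) :
    ∀ x ∈ s, pd i f x = pd i g x := by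
  intro x hx
  have : f =ᶠ[nhds x] g := Filter.eventuallyEq_of_mem (hs.mem_nhds hx) h
  simp only [pd]
  rw [this.fderiv_eq]

lemma pd_hcs {g : E3 → ℝ} (hg : HasCompactSupport g) (i : Fin 3) : HasCompactSupport (pd i g) :=
  hg.fderiv_apply (𝕜 := ℝ) (EuclideanSpace.single i 1)

lemma ibp {f g : E3 → ℝ} (hf : ContDiff ℝ ∞ f) (hg : ContDiff ℝ ∞ g)
    (hc : HasCompactSupport f ∨ HasCompactSupport g) (i : Fin 3) :
    ∫ x, f x * pd i g x = - ∫ x, pd i f x * g x := by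
  have c1 := (pd_smooth hf i).continuous
  have c2 := (pd_smooth hg i).continuous
  have hh : HasCompactSupport (fun x => pd i f x * g x) ∧ HasCompactSupport (fun x => f x * pd i g x)
      ∧ HasCompactSupport (fun x => f x * g x) := by
    rcases hc with h | h
    · exact ⟨(pd_hcs h i).mul_right, h.mul_right, h.mul_right⟩
    · exact ⟨h.mul_left, (pd_hcs h i).mul_left, h.mul_left⟩
  exact integral_mul_fderiv_eq_neg_fderiv_mul_of_integrable
    ((c1.mul hg.continuous).integrable_of_hasCompactSupport hh.1)
    ((hf.continuous.mul c2).integrable_of_hasCompactSupport hh.2.1)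
    ((hf.continuous.mul hg.continuous).integrable_of_hasCompactSupport hh.2.2)
    (fun x _ => smooth_diff hf x) (fun x _ => smooth_diff hg x)

/-- Hessian entries as functions. -/
def hh (v : E3 → ℝ) (i j : Fin 3) (x : E3) : ℝ := pd i (pd j v) x

/-- Laplacian. -/
def S (v : E3 → ℝ) (x : E3) : ℝ := ∑ i, hh v i i x

/-- Linearized coefficients. -/
def Fm (v : E3 → ℝ) (i j : Fin 3) (x : E3) : ℝ := (if i = j then S v x else 0) - hh v i j x

def Lop (v φ : E3 → ℝ) (x : E3) : ℝ := ∑ i, ∑ j, Fm v i j x * pd i (pd j φ) x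

def Fq (v φ ψ : E3 → ℝ) (x : E3) : ℝ := ∑ i, ∑ j, Fm v i j x * (pd i φ x * pd j ψ x)

lemma hh_smooth {v : E3 → ℝ} (hv : ContDiff ℝ ∞ v) (i j : Fin 3) : ContDiff ℝ ∞ (hh v i j) :=
  pd_smooth (pd_smooth hv j) i

lemma S_smooth {v : E3 → ℝ} (hv : ContDiff ℝ ∞ v) : ContDiff ℝ ∞ (S v) :=
  ContDiff.sum fun i _ => hh_smooth hv i i

lemma Fm_smooth {v : E3 → ℝ} (hv : ContDiff ℝ ∞ v) (i j : Fin 3) : ContDiff ℝ ∞ (Fm v i j) := by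
  unfold Fm
  by_cases h : i = j
  · simp only [h, if_true]
    exact (S_smooth hv).sub (hh_smooth hv j j)
  · simp only [h, if_false]
    exact contDiff_const.sub (hh_smooth hv i j)

lemma hh_symm {v : E3 → ℝ} (hv : ContDiff ℝ ∞ v) (i j : Fin 3) : hh v i j = hh v j i :=
  pd_comm hv i j

lemma pd_S {v : E3 → ℝ} (hv : ContDiff ℝ ∞ v) (k : Fin 3) :
    pd k (S v) = fun x => ∑ i, pd k (hh v i i) x := by
  unfold S
  rw [pd_sum _ (fun i => hh_smooth hv i i)]

lemma pd_Fm {v : E3 → ℝ} (hv : ContDiff ℝ ∞ v) (k i j : Fin 3) :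
    pd k (Fm v i j) = fun x => (if i = j then pd k (S v) x else 0) - pd k (hh v i j) x := by
  unfold Fm
  by_cases h : i = j
  · simp only [h, if_true]
    exact pd_sub (S_smooth hv) (hh_smooth hv j j) k
  · simp only [h, if_false]
    rw [pd_sub contDiff_const (hh_smooth hv i j), pd_const]

lemma pd_hh_symm {v : E3 → ℝ} (hv : ContDiff ℝ ∞ v) (i j k : Fin 3) :
    pd k (hh v i j) = pd i (hh v k j) := by
  unfold hh
  exact pd_comm (pd_smooth hv j) k i

lemma Fm_div {v : E3 → ℝ} (hv : ContDiff ℝ ∞ v) (j : Fin 3) (x : E3) :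
    ∑ i, pd i (Fm v i j) x = 0 := by
  have : ∀ i, pd i (Fm v i j) x = (if i = j then pd i (S v) x else 0) - pd j (hh v i i) x := by
    intro i
    rw [pd_Fm hv, hh_symm hv i j, pd_hh_symm hv j i i]
  simp only [this, Finset.sum_sub_distrib, pd_S hv]
  simp

lemma Lop_cont {v φ : E3 → ℝ} (hv : ContDiff ℝ ∞ v) (hφ : ContDiff ℝ ∞ φ) :
    Continuous (Lop v φ) := by
  unfold Lop
  exact continuous_finsetSum _ fun i _ => continuous_finsetSum _ fun j _ =>
    (Fm_smooth hv i j).continuous.mul (pd_smooth (pd_smooth hφ j) i).continuous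

lemma Fq_cont {v φ ψ : E3 → ℝ} (hv : ContDiff ℝ ∞ v) (hφ : ContDiff ℝ ∞ φ)
    (hψ : ContDiff ℝ ∞ ψ) : Continuous (Fq v φ ψ) := by
  unfold Fq
  exact continuous_finsetSum _ fun i _ => continuous_finsetSum _ fun j _ =>
    (Fm_smooth hv i j).continuous.mul ((pd_smooth hφ i).continuous.mul (pd_smooth hψ j).continuous)

lemma Lop_ibp {v φ ψ : E3 → ℝ} (hv : ContDiff ℝ ∞ v) (hφ : ContDiff ℝ ∞ φ)
    (hψ : ContDiff ℝ ∞ ψ) (hc : HasCompactSupport φ ∨ HasCompactSupport ψ) :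
    ∫ x, φ x * Lop v ψ x = - ∫ x, Fq v φ ψ x := by
  have hs : ∀ i j, ContDiff ℝ ∞ (fun x => φ x * Fm v i j x) := fun i j =>
    hφ.mul (Fm_smooth hv i j)
  have hcc : ∀ i j, HasCompactSupport (fun x => φ x * Fm v i j x) ∨ HasCompactSupport (pd j ψ) := by
    intro i j
    rcases hc with h | h
    · exact Or.inl h.mul_right
    · exact Or.inr (pd_hcs h j)
  have e1 : ∀ i j, ∫ x, (φ x * Fm v i j x) * pd i (pd j ψ) x =
      - ∫ x, pd i (fun x => φ x * Fm v i j x) x * pd j ψ x := fun i j =>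
    ibp (hs i j) (pd_smooth hψ j) (hcc i j) i
  have i1 : ∀ i j, Integrable (fun x => (φ x * Fm v i j x) * pd i (pd j ψ) x) := by
    intro i j
    apply Continuous.integrable_of_hasCompactSupport
    · exact (hs i j).continuous.mul (pd_smooth (pd_smooth hψ j) i).continuous
    · rcases hcc i j with h | h
      · exact h.mul_right
      · exact (pd_hcs h i).mul_left
  have i2 : ∀ i j, Integrable (fun x => pd i (fun x => φ x * Fm v i j x) x * pd j ψ x) := by
    intro i j
    apply Continuous.integrable_of_hasCompactSupport
    · exact (pd_smooth (hs i j) i).continuous.mul (pd_smooth hψ j).continuous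
    · rcases hcc i j with h | h
      · exact (pd_hcs h i).mul_right
      · exact h.mul_left
  have l1 : ∫ x, φ x * Lop v ψ x = ∑ i, ∑ j, ∫ x, (φ x * Fm v i j x) * pd i (pd j ψ) x := by
    have : ∀ i, ∑ j, ∫ x, (φ x * Fm v i j x) * pd i (pd j ψ) x
        = ∫ x, ∑ j, (φ x * Fm v i j x) * pd i (pd j ψ) x := fun i =>
      (integral_finsetSum _ (fun j _ => i1 i j)).symm
    simp only [this]
    rw [← integral_finsetSum _ (fun i _ => integrable_finsetSum _ (fun j _ => i1 i j))]
    congr 1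
    funext x
    simp only [Lop, Finset.mul_sum, mul_assoc]
  have l2 : ∫ x, Fq v φ ψ x
      = ∑ i, ∑ j, ∫ x, pd i (fun x => φ x * Fm v i j x) x * pd j ψ x := by
    have : ∀ i, ∑ j, ∫ x, pd i (fun x => φ x * Fm v i j x) x * pd j ψ x
        = ∫ x, ∑ j, pd i (fun x => φ x * Fm v i j x) x * pd j ψ x := fun i =>
      (integral_finsetSum _ (fun j _ => i2 i j)).symm
    simp only [this]
    rw [← integral_finsetSum _ (fun i _ => integrable_finsetSum _ (fun j _ => i2 i j))]
    congr 1
    funext x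
    have e2 : ∀ i j, pd i (fun x => φ x * Fm v i j x) x * pd j ψ x
        = φ x * pd j ψ x * pd i (Fm v i j) x + Fm v i j x * (pd i φ x * pd j ψ x) := by
      intro i j
      rw [pd_mul hφ (Fm_smooth hv i j)]
      ring
    have e3 : ∑ i, ∑ j, φ x * pd j ψ x * pd i (Fm v i j) x = 0 := by
      rw [Finset.sum_comm]
      simp only [← Finset.mul_sum, Fm_div hv]
      simp
    simp only [e2, Finset.sum_add_distrib, Fq, e3]
    simp
  rw [l1, l2]
  simp only [e1, Finset.sum_neg_distrib]

def aS (H : Fin 3 → Fin 3 → ℝ) : ℝ := ∑ k, H k k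

def aG (H : Fin 3 → Fin 3 → ℝ) : ℝ := ((∑ k, H k k) ^ 2 - ∑ i, ∑ j, H i j * H j i) / 2

def aF (H : Fin 3 → Fin 3 → ℝ) (ξ η : Fin 3 → ℝ) : ℝ :=
  ∑ i, ∑ j, ((if i = j then aS H else 0) - H i j) * (ξ i * η j)

/-- `σ₁σ₂ - σ₃`. -/
def aV (H : Fin 3 → Fin 3 → ℝ) : ℝ := aS H * aG H - Matrix.det (Matrix.of H)

def nsq (ξ : Fin 3 → ℝ) : ℝ := ∑ i, ξ i ^ 2

lemma nsq_nonneg (ξ : Fin 3 → ℝ) : 0 ≤ nsq ξ := Finset.sum_nonneg fun _ _ => sq_nonneg _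

lemma aF_symm {H : Fin 3 → Fin 3 → ℝ} (hs : ∀ i j, H i j = H j i) (ξ η : Fin 3 → ℝ) :
    aF H ξ η = aF H η ξ := by
  simp only [aF, aS, Fin.sum_univ_three]
  simp only [hs 1 0, hs 2 0, hs 2 1]
  simp
  ring

lemma frob_eq {H : Fin 3 → Fin 3 → ℝ} (hs : ∀ i j, H i j = H j i) :
    ∑ i, ∑ j, H i j ^ 2 = aS H ^ 2 - 2 * aG H := by
  simp only [aG, aS, Fin.sum_univ_three]
  simp only [hs 1 0, hs 2 0, hs 2 1]
  ring

lemma entry_sq_le {H : Fin 3 → Fin 3 → ℝ} (hs : ∀ i j, H i j = H j i) (hg : 0 < aG H)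
    (i j : Fin 3) : H i j ^ 2 ≤ aS H ^ 2 := by
  have h1 := frob_eq hs
  have h2 : ∑ j, H i j ^ 2 ≤ ∑ i, ∑ j, H i j ^ 2 :=
    Finset.single_le_sum (f := fun i => ∑ j, H i j ^ 2)
      (fun i _ => Finset.sum_nonneg fun j _ => sq_nonneg _) (Finset.mem_univ i)
  have h3 : H i j ^ 2 ≤ ∑ j, H i j ^ 2 :=
    Finset.single_le_sum (f := fun j => H i j ^ 2) (fun j _ => sq_nonneg _) (Finset.mem_univ j)
  linarith

lemma aF_quad {H : Fin 3 → Fin 3 → ℝ} (hs : ∀ i j, H i j = H j i) (ξ : Fin 3 → ℝ) :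
    2 * aG H * nsq ξ ^ 2 ≤ 2 * nsq ξ * aS H * aF H ξ ξ - 3 / 2 * aF H ξ ξ ^ 2 := by
  set n := nsq ξ with hn
  set a := aF H ξ ξ with ha
  -- sum of squares of the residual
  have key : ∑ i, ∑ j, (n * n * H i j - (n * aS H - a) * (ξ i * ξ j)
      - a / 2 * ((if i = j then n else 0) - ξ i * ξ j)) ^ 2
      = n ^ 2 * (2 * n * aS H * a - 3 / 2 * a ^ 2 - 2 * aG H * n ^ 2) := by
    have e1 : ∑ i, ∑ j, (n * n * H i j - (n * aS H - a) * (ξ i * ξ j)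
      - a / 2 * ((if i = j then n else 0) - ξ i * ξ j)) ^ 2
      = n ^ 4 * (∑ i, ∑ j, H i j ^ 2) - 2 * n ^ 2 * (n * aS H - a) * (∑ i, ∑ j, H i j * (ξ i * ξ j))
        - n ^ 2 * a * (n * aS H - ∑ i, ∑ j, H i j * (ξ i * ξ j))
        + (n * aS H - a) ^ 2 * (∑ i, ξ i ^ 2) ^ 2
        + (n * aS H - a) * a * ((n - ∑ i, ξ i ^ 2) * ∑ i, ξ i ^ 2)
        + a ^ 2 / 4 * (3 * n ^ 2 - 2 * n * (∑ i, ξ i ^ 2) + (∑ i, ξ i ^ 2) ^ 2) := by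
      simp only [aS, Fin.sum_univ_three]
      simp
      ring
    have e2 : ∑ i, ∑ j, H i j * (ξ i * ξ j) = n * aS H - a := by
      rw [ha, hn]
      simp only [aF, nsq, aS, Fin.sum_univ_three]
      simp
      ring
    have e3 : ∑ i, ξ i ^ 2 = n := rfl
    rw [e1, e2, e3, frob_eq hs]
    ring
  have pos : 0 ≤ n ^ 2 * (2 * n * aS H * a - 3 / 2 * a ^ 2 - 2 * aG H * n ^ 2) := by
    rw [← key]
    exact Finset.sum_nonneg fun i _ => Finset.sum_nonneg fun j _ => sq_nonneg _
  rcases (nsq_nonneg ξ).eq_or_lt with h0 | h0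
  · have hz : ∀ i, ξ i = 0 := by
      intro i
      have := (Finset.sum_eq_zero_iff_of_nonneg (fun i _ => sq_nonneg (ξ i))).1 h0.symm i
        (Finset.mem_univ i)
      exact pow_eq_zero_iff (two_ne_zero) |>.1 this
    have ha0 : a = 0 := by
      rw [ha]; simp [aF, hz]
    have hn0 : n = 0 := by rw [hn]; exact h0.symm
    rw [ha0, hn0]; simp
  · have hn2 : 0 < n ^ 2 := by positivity
    have := nonneg_of_mul_nonneg_right pos hn2
    linarith

lemma aF_lower {H : Fin 3 → Fin 3 → ℝ} (hs : ∀ i j, H i j = H j i) (hσ : 0 < aS H) (hg : 0 < aG H)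
    (ξ : Fin 3 → ℝ) : aG H * nsq ξ ≤ aS H * aF H ξ ξ := by
  have h := aF_quad hs ξ
  have hn := nsq_nonneg ξ
  rcases hn.eq_or_lt with h0 | h0
  · rw [← h0] at h ⊢
    have : aF H ξ ξ = 0 := by nlinarith [sq_nonneg (aF H ξ ξ)]
    rw [this]; simp
  · have h1 : aG H * nsq ξ ^ 2 ≤ nsq ξ * (aS H * aF H ξ ξ) := by nlinarith [sq_nonneg (aF H ξ ξ)]
    have h2 : nsq ξ * (aG H * nsq ξ) ≤ nsq ξ * (aS H * aF H ξ ξ) := by nlinarith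
    exact le_of_mul_le_mul_left h2 h0

lemma aF_nonneg {H : Fin 3 → Fin 3 → ℝ} (hs : ∀ i j, H i j = H j i) (hσ : 0 < aS H)
    (hg : 0 < aG H) (ξ : Fin 3 → ℝ) : 0 ≤ aF H ξ ξ := by
  have h := aF_lower hs hσ hg ξ
  have h2 : 0 ≤ aS H * aF H ξ ξ := le_trans (mul_nonneg hg.le (nsq_nonneg ξ)) h
  exact nonneg_of_mul_nonneg_right h2 hσ

lemma aF_upper {H : Fin 3 → Fin 3 → ℝ} (hs : ∀ i j, H i j = H j i) (hσ : 0 < aS H)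
    (hg : 0 < aG H) (ξ : Fin 3 → ℝ) : aF H ξ ξ ≤ 2 * aS H * nsq ξ := by
  have h := aF_quad hs ξ
  have hn := nsq_nonneg ξ
  have ha := aF_nonneg hs hσ hg ξ
  rcases ha.eq_or_lt with h0 | h0
  · rw [← h0]; positivity
  · by_contra hcon
    push Not at hcon
    have : 0 ≤ 2 * aG H * nsq ξ ^ 2 := by positivity
    nlinarith [mul_pos h0 (sub_pos.2 hcon)]

lemma aF_lin {H : Fin 3 → Fin 3 → ℝ} (hs : ∀ i j, H i j = H j i) (s t : ℝ) (ξ η : Fin 3 → ℝ) :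
    aF H (fun i => s * ξ i + t * η i) (fun i => s * ξ i + t * η i)
      = s ^ 2 * aF H ξ ξ + 2 * (s * t) * aF H ξ η + t ^ 2 * aF H η η := by
  simp only [aF, aS, Fin.sum_univ_three]
  simp only [hs 1 0, hs 2 0, hs 2 1]
  simp
  ring

/-- Weighted Cauchy inequality. -/
lemma aF_cauchy {H : Fin 3 → Fin 3 → ℝ} (hs : ∀ i j, H i j = H j i) (hσ : 0 < aS H)
    (hg : 0 < aG H) (ξ η : Fin 3 → ℝ) {t : ℝ} (ht : 0 < t) :
    2 * |aF H ξ η| ≤ t * aF H ξ ξ + t⁻¹ * aF H η η := by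
  have h1 := aF_nonneg hs hσ hg (fun i => t * ξ i + 1 * η i)
  have h2 := aF_nonneg hs hσ hg (fun i => t * ξ i + (-1) * η i)
  rw [aF_lin hs] at h1 h2
  have h3 : 2 * t * |aF H ξ η| ≤ t ^ 2 * aF H ξ ξ + aF H η η := by
    rcases abs_cases (aF H ξ η) with ⟨h, _⟩ | ⟨h, _⟩ <;> rw [h] <;> nlinarith
  have h4 : t * (2 * |aF H ξ η|) ≤ t * (t * aF H ξ ξ + t⁻¹ * aF H η η) := by
    rw [mul_add, ← mul_assoc t t⁻¹, mul_inv_cancel₀ ht.ne']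
    nlinarith
  exact le_of_mul_le_mul_left h4 ht

lemma aV_identity {H : Fin 3 → Fin 3 → ℝ} (hs : ∀ i j, H i j = H j i) :
    3 * aV H = 2 * aG H * aS H + ∑ k, aF H (H k) (H k) := by
  simp only [aV, aG, aF, aS, Fin.sum_univ_three, Matrix.det_fin_three, Matrix.of_apply]
  simp only [hs 1 0, hs 2 0, hs 2 1]
  simp
  ring

lemma aV_lower {H : Fin 3 → Fin 3 → ℝ} (hs : ∀ i j, H i j = H j i) (hσ : 0 < aS H)
    (hg : 0 < aG H) : 2 * aG H * aS H ≤ 3 * aV H := by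
  rw [aV_identity hs]
  have : 0 ≤ ∑ k, aF H (H k) (H k) := Finset.sum_nonneg fun k _ => aF_nonneg hs hσ hg _
  linarith

lemma aV_split {H : Fin 3 → Fin 3 → ℝ} (hs : ∀ i j, H i j = H j i) (y p : Fin 3 → ℝ) :
    aV H * (aG H * nsq y + nsq p) =
      aF H (fun i => aG H * y i + ∑ k, H i k * p k) (fun i => aG H * y i + ∑ k, H i k * p k)
      + aG H * aF H (fun i => ∑ k, H i k * y k - p i) (fun i => ∑ k, H i k * y k - p i) := by
  simp only [aV, aG, aF, aS, nsq, Fin.sum_univ_three, Matrix.det_fin_three, Matrix.of_apply]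
  simp only [hs 1 0, hs 2 0, hs 2 1]
  simp
  ring

lemma aV_det {H : Fin 3 → Fin 3 → ℝ} (hs : ∀ i j, H i j = H j i) :
    Matrix.det (Matrix.of fun i j => (if i = j then aG H else 0) + ∑ k, H i k * H k j)
      = aV H ^ 2 := by
  simp only [aV, aG, aS, Fin.sum_univ_three, Matrix.det_fin_three, Matrix.of_apply]
  simp only [hs 1 0, hs 2 0, hs 2 1]
  simp
  ring

set_option maxHeartbeats 1000000 in
lemma jac_num_one {a p q x y z c : ℝ} (ha : 0 < a) (ha' : a ≤ 4 / 3) (h1 : a + p + q = 2)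
    (h2 : a ^ 2 + p ^ 2 + q ^ 2 ≤ 2) (hc : a * x + p * y + q * z = c) :
    (1 + 13 / 12 * a) * (x + y + z) ^ 2 ≤ x ^ 2 + 3 * y ^ 2 + 3 * z ^ 2 + 110 * (c ^ 2 / a) := by
  set D := 1 + a ^ 2 with hD
  set P := x ^ 2 + 3 * y ^ 2 + 3 * z ^ 2 with hP
  set s := x + y + z with hs
  set m := 1 + a ^ 2 - 4 / 3 * a with hm
  have hDpos : 1 ≤ D := by nlinarith
  have hPpos : 0 ≤ P := by positivity
  have b1 : (D * s - (1 + a) * c) ^ 2 ≤ D * m * P := by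
    have e : D * s - (1 + a) * c
        = (D - (1 + a) * a) * x + (D - (1 + a) * p) * y + (D - (1 + a) * q) * z := by
      rw [← hc]; ring
    have cs : ((D - (1 + a) * a) * x + (D - (1 + a) * p) * y + (D - (1 + a) * q) * z) ^ 2
        ≤ ((D - (1 + a) * a) ^ 2 + ((D - (1 + a) * p) ^ 2 + (D - (1 + a) * q) ^ 2) / 3) * P := by
      have : ∀ A B C : ℝ, (A * x + B * y + C * z) ^ 2 ≤ (A ^ 2 + (B ^ 2 + C ^ 2) / 3) * P := by
        intro A B C
        rw [hP]
        nlinarith [sq_nonneg (3 * A * y - B * x), sq_nonneg (3 * A * z - C * x),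
          sq_nonneg (B * z - C * y)]
      exact this _ _ _
    have br : (D - (1 + a) * a) ^ 2 + ((D - (1 + a) * p) ^ 2 + (D - (1 + a) * q) ^ 2) / 3
        ≤ D * m := by
      have e2 : (D - (1 + a) * a) ^ 2 + ((D - (1 + a) * p) ^ 2 + (D - (1 + a) * q) ^ 2) / 3
          = 5 / 3 * D ^ 2 - 2 * D * (1 + a) * (a + (p + q) / 3)
            + (1 + a) ^ 2 * (a ^ 2 + (p ^ 2 + q ^ 2) / 3) := by ring
      have e3 : p + q = 2 - a := by linarith
      have e4 : (1 + a) ^ 2 * (a ^ 2 + (p ^ 2 + q ^ 2) / 3) ≤ (1 + a) ^ 2 * (2 / 3 * (1 + a ^ 2)) := by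
        apply mul_le_mul_of_nonneg_left _ (sq_nonneg _)
        linarith
      rw [e2, e3]
      have e5 : 5 / 3 * D ^ 2 - 2 * D * (1 + a) * (a + (2 - a) / 3)
            + (1 + a) ^ 2 * (2 / 3 * (1 + a ^ 2)) = D * m := by
        rw [hD, hm]; ring
      linarith
    rw [e]
    exact cs.trans (mul_le_mul_of_nonneg_right br hPpos)
  have b2 : (1 + 13 / 12 * a) * (1 + a / 20) * m ≤ D := by
    rw [hm, hD]
    have hq : a * (4 / 3 - a) ≥ 0 := mul_nonneg ha.le (by linarith)
    nlinarith [mul_nonneg ha.le hq, mul_nonneg (mul_nonneg ha.le ha.le) hq]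
  have b3 : (D * s) ^ 2 ≤ (1 + a / 20) * (D * s - (1 + a) * c) ^ 2
      + (1 + 20 / a) * ((1 + a) * c) ^ 2 := by
    have : ∀ X Y : ℝ, (X + Y) ^ 2 ≤ (1 + a / 20) * X ^ 2 + (1 + 20 / a) * Y ^ 2 := by
      intro X Y
      have e : (1 + a / 20) * X ^ 2 + (1 + 20 / a) * Y ^ 2 - (X + Y) ^ 2
          = (a * X - 20 * Y) ^ 2 / (20 * a) := by
        field_simp
        ring
      have : 0 ≤ (a * X - 20 * Y) ^ 2 / (20 * a) := by positivity
      linarith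
    have h := this (D * s - (1 + a) * c) ((1 + a) * c)
    simpa using h
  have hk : 0 < 1 + 13 / 12 * a := by positivity
  have b4 : (1 + 13 / 12 * a) * ((1 + 20 / a) * ((1 + a) * c) ^ 2) ≤ 110 * D * (c ^ 2 / a) := by
    have e : (1 + 13 / 12 * a) * ((1 + 20 / a) * ((1 + a) * c) ^ 2)
        = ((1 + 13 / 12 * a) * (a + 20) * (1 + a) ^ 2) * (c ^ 2 / a) := by
      field_simp
    rw [e]
    apply mul_le_mul_of_nonneg_right _ (by positivity)
    have k1 : (1 + 13 / 12 * a) * (a + 20) ≤ 22 / 9 * (64 / 3) :=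
      mul_le_mul (by linarith) (by linarith) (by linarith) (by norm_num)
    have k2 : (1 + a) ^ 2 ≤ 2 * D := by
      have e : 2 * D - (1 + a) ^ 2 = (a - 1) ^ 2 := by rw [hD]; ring
      have := sq_nonneg (a - 1)
      linarith
    have k3 : 0 ≤ (1 + a) ^ 2 := sq_nonneg _
    calc (1 + 13 / 12 * a) * (a + 20) * (1 + a) ^ 2 ≤ 22 / 9 * (64 / 3) * (2 * D) :=
          mul_le_mul k1 k2 k3 (by norm_num)
      _ ≤ 110 * D := by linarith
  have b5 : D * ((1 + 13 / 12 * a) * s ^ 2 * D) ≤ D * (D * P + 110 * (c ^ 2 / a)) := by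
    have q1 : (1 + 13 / 12 * a) * (D * s) ^ 2 ≤ (1 + 13 / 12 * a) * ((1 + a / 20) * (D * m * P))
        + (1 + 13 / 12 * a) * ((1 + 20 / a) * ((1 + a) * c) ^ 2) := by
      rw [← mul_add]
      apply mul_le_mul_of_nonneg_left _ hk.le
      have : (1 + a / 20) * (D * s - (1 + a) * c) ^ 2 ≤ (1 + a / 20) * (D * m * P) :=
        mul_le_mul_of_nonneg_left b1 (by positivity)
      linarith
    have q2 : (1 + 13 / 12 * a) * ((1 + a / 20) * (D * m * P)) ≤ D * (D * P) := by
      have : (D * P) * ((1 + 13 / 12 * a) * (1 + a / 20) * m) ≤ (D * P) * D :=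
        mul_le_mul_of_nonneg_left b2 (by positivity)
      linarith
    linarith
  have b6 : (1 + 13 / 12 * a) * s ^ 2 * D ≤ D * P + 110 * (c ^ 2 / a) :=
    le_of_mul_le_mul_left b5 (by linarith)
  have b7 : D * ((1 + 13 / 12 * a) * s ^ 2) ≤ D * (P + 110 * (c ^ 2 / a)) := by
    have : 0 ≤ c ^ 2 / a := by positivity
    nlinarith
  exact le_of_mul_le_mul_left b7 (by linarith)

lemma jac_num {σ a p q x y z c : ℝ} (hσ : 0 < σ) (ha : 0 < a) (ha' : a ≤ 4 / 3 * σ)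
    (h1 : a + p + q = 2 * σ)
    (h2 : a ^ 2 + p ^ 2 + q ^ 2 ≤ 2 * σ ^ 2) (hc : a * x + p * y + q * z = c) :
    (1 + 13 / 12 * (a / σ)) * (x + y + z) ^ 2
      ≤ x ^ 2 + 3 * y ^ 2 + 3 * z ^ 2 + 110 * (c ^ 2 / (a * σ)) := by
  have := jac_num_one (a := a / σ) (p := p / σ) (q := q / σ) (x := x) (y := y) (z := z)
    (c := c / σ) (by positivity) (by rw [div_le_iff₀ hσ]; exact ha')
    (by rw [← add_div, ← add_div, h1]; field_simp)
    (by
      have : (a / σ) ^ 2 + (p / σ) ^ 2 + (q / σ) ^ 2 = (a ^ 2 + p ^ 2 + q ^ 2) / σ ^ 2 := by ring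
      rw [this, div_le_iff₀ (by positivity)]; exact h2)
    (by rw [← hc]; ring)
  have e : (c / σ) ^ 2 / (a / σ) = c ^ 2 / (a * σ) := by field_simp
  rw [e] at this
  exact this

lemma jac_diag {σ g : ℝ} (hσ : 0 < σ) (hg : 0 < g) (a : Fin 3 → ℝ)
    (h1 : a 0 + a 1 + a 2 = 2 * σ) (h2 : a 0 ^ 2 + a 1 ^ 2 + a 2 ^ 2 ≤ 2 * σ ^ 2)
    (h3 : ∀ k, g ≤ a k * σ) (T : Fin 3 → Fin 3 → Fin 3 → ℝ)
    (s1 : ∀ i j k, T i j k = T j i k) (s2 : ∀ i j k, T i j k = T i k j) :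
    ∑ k, (1 + 13 / 12 * (a k / σ)) * (∑ i, T i i k) ^ 2
      ≤ (∑ i, ∑ j, ∑ k, T i j k ^ 2) + 110 / g * ∑ k, (∑ i, a i * T i i k) ^ 2 := by
  have hpos : ∀ k, 0 < a k := fun k => by
    have := h3 k
    exact pos_of_mul_pos_left (lt_of_lt_of_le hg this) hσ.le
  have hup : ∀ k, a k ≤ 4 / 3 * σ := by
    have aux : ∀ x y z : ℝ, 0 < x → x + y + z = 2 * σ → x ^ 2 + y ^ 2 + z ^ 2 ≤ 2 * σ ^ 2 →
        x ≤ 4 / 3 * σ := by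
      intro x y z hx hs hq
      by_contra hcon
      push Not at hcon
      have hz : z = 2 * σ - x - y := by linarith
      subst hz
      nlinarith [sq_nonneg (y - (2 * σ - x - y)), mul_pos hx (sub_pos.2 hcon)]
    intro k
    fin_cases k
    · exact aux _ _ _ (hpos 0) h1 h2
    · exact aux (a 1) (a 0) (a 2) (hpos 1) (by linarith) (by linarith)
    · exact aux (a 2) (a 0) (a 1) (hpos 2) (by linarith) (by linarith)
  have err : ∀ k (c : ℝ), 110 * (c ^ 2 / (a k * σ)) ≤ 110 / g * c ^ 2 := by
    intro k c
    rw [div_mul_eq_mul_div, mul_div_assoc]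
    have : c ^ 2 / (a k * σ) ≤ c ^ 2 / g := div_le_div_of_nonneg_left (sq_nonneg c) hg (h3 k)
    linarith
  have k0 := jac_num hσ (hpos 0) (hup 0) h1 h2 (x := T 0 0 0) (y := T 1 1 0) (z := T 2 2 0) rfl
  have k1 := jac_num hσ (hpos 1) (hup 1) (p := a 0) (q := a 2) (by linarith) (by linarith)
    (x := T 1 1 1) (y := T 0 0 1) (z := T 2 2 1) rfl
  have k2 := jac_num hσ (hpos 2) (hup 2) (p := a 0) (q := a 1) (by linarith) (by linarith)
    (x := T 2 2 2) (y := T 0 0 2) (z := T 1 1 2) rfl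
  have e0 := err 0 (a 0 * T 0 0 0 + a 1 * T 1 1 0 + a 2 * T 2 2 0)
  have e1 := err 1 (a 1 * T 1 1 1 + a 0 * T 0 0 1 + a 2 * T 2 2 1)
  have e2 := err 2 (a 2 * T 2 2 2 + a 0 * T 0 0 2 + a 1 * T 1 1 2)
  have f1 : T 0 1 0 = T 0 0 1 := s2 _ _ _
  have f2 : T 1 0 0 = T 0 0 1 := by rw [s1, s2]
  have f3 : T 0 2 0 = T 0 0 2 := s2 _ _ _
  have f4 : T 2 0 0 = T 0 0 2 := by rw [s1, s2]
  have f5 : T 1 0 1 = T 1 1 0 := s2 _ _ _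
  have f6 : T 0 1 1 = T 1 1 0 := by rw [s1, s2]
  have f7 : T 1 2 1 = T 1 1 2 := s2 _ _ _
  have f8 : T 2 1 1 = T 1 1 2 := by rw [s1, s2]
  have f9 : T 2 0 2 = T 2 2 0 := s2 _ _ _
  have f10 : T 0 2 2 = T 2 2 0 := by rw [s1, s2]
  have f11 : T 2 1 2 = T 2 2 1 := s2 _ _ _
  have f12 : T 1 2 2 = T 2 2 1 := by rw [s1, s2]
  have r0 := sq_nonneg (T 0 1 2)
  have r1 := sq_nonneg (T 0 2 1)
  have r2 := sq_nonneg (T 1 0 2)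
  have r3 := sq_nonneg (T 1 2 0)
  have r4 := sq_nonneg (T 2 0 1)
  have r5 := sq_nonneg (T 2 1 0)
  simp only [Fin.sum_univ_three, f1, f2, f3, f4, f5, f6, f7, f8, f9, f10, f11, f12]
  have p1 : T 1 1 1 + T 0 0 1 + T 2 2 1 = T 0 0 1 + T 1 1 1 + T 2 2 1 := by ring
  have p2 : T 2 2 2 + T 0 0 2 + T 1 1 2 = T 0 0 2 + T 1 1 2 + T 2 2 2 := by ring
  have p3 : a 1 * T 1 1 1 + a 0 * T 0 0 1 + a 2 * T 2 2 1
    = a 0 * T 0 0 1 + a 1 * T 1 1 1 + a 2 * T 2 2 1 := by ring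
  have p4 : a 2 * T 2 2 2 + a 0 * T 0 0 2 + a 1 * T 1 1 2
    = a 0 * T 0 0 2 + a 1 * T 1 1 2 + a 2 * T 2 2 2 := by ring
  rw [p1] at k1
  rw [p2] at k2
  rw [p3] at e1 k1
  rw [p4] at e2 k2
  rw [mul_add (110 / g), mul_add (110 / g)]
  linarith

lemma rot_sq (O : Fin 3 → Fin 3 → ℝ) (hO : ∀ i j, ∑ a, O i a * O j a = if i = j then 1 else 0)
    (w : Fin 3 → ℝ) : ∑ a, (∑ i, O i a * w i) ^ 2 = ∑ i, w i ^ 2 := by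
  have h00 := hO 0 0
  have h11 := hO 1 1
  have h22 := hO 2 2
  have h01 := hO 0 1
  have h02 := hO 0 2
  have h12 := hO 1 2
  simp [Fin.sum_univ_three] at h00 h11 h22 h01 h02 h12
  simp only [Fin.sum_univ_three]
  linear_combination (w 0) ^ 2 * h00 + (w 1) ^ 2 * h11 + (w 2) ^ 2 * h22
    + 2 * w 0 * w 1 * h01 + 2 * w 0 * w 2 * h02 + 2 * w 1 * w 2 * h12

def rotT (O : Fin 3 → Fin 3 → ℝ) (T : Fin 3 → Fin 3 → Fin 3 → ℝ) (a b c : Fin 3) : ℝ :=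
  ∑ i, O i a * ∑ j, O j b * ∑ k, O k c * T i j k

lemma rotT_sq (O : Fin 3 → Fin 3 → ℝ) (hO : ∀ i j, ∑ a, O i a * O j a = if i = j then 1 else 0)
    (T : Fin 3 → Fin 3 → Fin 3 → ℝ) :
    ∑ a, ∑ b, ∑ c, rotT O T a b c ^ 2 = ∑ i, ∑ j, ∑ k, T i j k ^ 2 := by
  have e1 : ∑ a, ∑ b, ∑ c, rotT O T a b c ^ 2 = ∑ b, ∑ c, ∑ a, rotT O T a b c ^ 2 := by
    rw [Finset.sum_comm]
    exact Finset.sum_congr rfl fun b _ => Finset.sum_comm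
  rw [e1]
  simp only [rotT, rot_sq O hO]
  have e2 : ∀ X : Fin 3 → Fin 3 → Fin 3 → ℝ, ∑ b, ∑ c, ∑ i, X b c i = ∑ i, ∑ c, ∑ b, X b c i := by
    intro X
    simp only [Fin.sum_univ_three]; ring
  rw [e2]
  simp only [rot_sq O hO]
  have e3 : ∀ X : Fin 3 → Fin 3 → Fin 3 → ℝ, ∑ i, ∑ c, ∑ j, X i c j = ∑ i, ∑ j, ∑ c, X i c j := by
    intro X
    exact Finset.sum_congr rfl fun b _ => Finset.sum_comm
  rw [e3]
  simp only [rot_sq O hO]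

lemma rotT_tr (O : Fin 3 → Fin 3 → ℝ) (T : Fin 3 → Fin 3 → Fin 3 → ℝ) (w : Fin 3 → ℝ) (c : Fin 3) :
    ∑ a, w a * rotT O T a a c
      = ∑ k, O k c * ∑ i, ∑ j, (∑ a, w a * (O i a * O j a)) * T i j k := by
  simp only [rotT, Fin.sum_univ_three]
  ring

lemma rotT_s1 (O : Fin 3 → Fin 3 → ℝ) (T : Fin 3 → Fin 3 → Fin 3 → ℝ)
    (s1 : ∀ i j k, T i j k = T j i k) (a b c : Fin 3) : rotT O T a b c = rotT O T b a c := by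
  simp only [rotT, Finset.mul_sum]
  rw [Finset.sum_comm]
  refine Finset.sum_congr rfl fun i _ => Finset.sum_congr rfl fun j _ =>
    Finset.sum_congr rfl fun k _ => ?_
  rw [s1 j i k]; ring

lemma rotT_s2 (O : Fin 3 → Fin 3 → ℝ) (T : Fin 3 → Fin 3 → Fin 3 → ℝ)
    (s2 : ∀ i j k, T i j k = T i k j) (a b c : Fin 3) : rotT O T a b c = rotT O T a c b := by
  simp only [rotT, Finset.mul_sum]
  refine Finset.sum_congr rfl fun i _ => ?_
  rw [Finset.sum_comm]
  refine Finset.sum_congr rfl fun j _ =>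
    Finset.sum_congr rfl fun k _ => ?_
  rw [s2 i k j]; ring

lemma exists_diag {H : Fin 3 → Fin 3 → ℝ} (hs : ∀ i j, H i j = H j i) :
    ∃ (O : Fin 3 → Fin 3 → ℝ) (l : Fin 3 → ℝ),
      (∀ i j, ∑ a, O i a * O j a = if i = j then 1 else 0) ∧
      (∀ a b, ∑ i, O i a * O i b = if a = b then 1 else 0) ∧
      (∀ i j, H i j = ∑ a, l a * (O i a * O j a)) := by
  have hA : (Matrix.of H).IsHermitian := by
    ext i j
    simp [Matrix.conjTranspose_apply, hs i j]
  refine ⟨fun i a => (hA.eigenvectorUnitary : Matrix (Fin 3) (Fin 3) ℝ) i a, hA.eigenvalues, ?_, ?_, ?_⟩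
  · intro i j
    have h := Unitary.coe_mul_star_self hA.eigenvectorUnitary
    have := congrFun (congrFun h i) j
    simpa [Matrix.mul_apply, Matrix.star_apply, Matrix.one_apply] using this
  · intro i j
    have h := Unitary.coe_star_mul_self hA.eigenvectorUnitary
    have := congrFun (congrFun h i) j
    simpa [Matrix.mul_apply, Matrix.star_apply, Matrix.one_apply] using this
  · intro i j
    have h := hA.spectral_theorem
    rw [Unitary.conjStarAlgAut_apply] at h
    have := congrFun (congrFun h i) j
    rw [Matrix.of_apply] at this
    rw [this]
    rw [Matrix.mul_apply]
    refine Finset.sum_congr rfl fun a _ => ?_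
    rw [Matrix.mul_diagonal]
    simp [Matrix.star_apply]
    ring

lemma jacobi_alg {H : Fin 3 → Fin 3 → ℝ} (hs : ∀ i j, H i j = H j i) (hσ : 0 < aS H)
    (hg : 0 < aG H) (T : Fin 3 → Fin 3 → Fin 3 → ℝ)
    (s1 : ∀ i j k, T i j k = T j i k) (s2 : ∀ i j k, T i j k = T i k j) :
    nsq (fun k => ∑ i, T i i k)
      + 13 / 12 * (aF H (fun k => ∑ i, T i i k) (fun k => ∑ i, T i i k) / aS H)
    ≤ (∑ i, ∑ j, ∑ k, T i j k ^ 2)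
      + 110 / aG H * nsq (fun k => ∑ i, ∑ j, ((if i = j then aS H else 0) - H i j) * T i j k) := by
  obtain ⟨O, l, hO, hO', hH⟩ := exists_diag hs
  set a : Fin 3 → ℝ := fun k => aS H - l k with ha
  have hF : ∀ i j, ((if i = j then aS H else 0) - H i j) = ∑ c, a c * (O i c * O j c) := by
    intro i j
    simp only [ha, sub_mul, Finset.sum_sub_distrib, ← hH i j, ← Finset.mul_sum, hO i j]
    simp
  have hS : aS H = l 0 + l 1 + l 2 := by
    have e : aS H = ∑ a, l a * ∑ i, O i a * O i a := by
      simp only [aS, hH, Fin.sum_univ_three]; ring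
    rw [e]
    simp [hO', Fin.sum_univ_three]
  have hfr : ∑ i, ∑ j, H i j ^ 2 = l 0 ^ 2 + l 1 ^ 2 + l 2 ^ 2 := by
    have e : ∀ i, ∑ j, H i j ^ 2 = ∑ a, (l a * O i a) ^ 2 := by
      intro i
      have e1 : ∀ j, H i j = ∑ a, O j a * (l a * O i a) := by
        intro j; rw [hH]; exact Finset.sum_congr rfl fun a _ => by ring
      simp only [e1]
      exact rot_sq (fun a j => O j a) (fun a b => hO' a b) (fun a => l a * O i a)
    have e2 : ∑ i, ∑ a, (l a * O i a) ^ 2 = ∑ a, l a ^ 2 * ∑ i, O i a * O i a := by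
      rw [Finset.sum_comm]
      refine Finset.sum_congr rfl fun a _ => ?_
      rw [Finset.mul_sum]
      exact Finset.sum_congr rfl fun i _ => by ring
    simp only [e, e2]
    simp [hO', Fin.sum_univ_three]
  have hG := frob_eq hs
  rw [hfr] at hG
  have aFd : ∀ w : Fin 3 → ℝ, aF H w w = ∑ c, a c * (∑ k, O k c * w k) ^ 2 := by
    intro w
    simp only [aF, hF, Fin.sum_univ_three]
    ring
  have h3 : ∀ k, aG H ≤ a k * aS H := by
    intro k
    have h := aF_lower hs hσ hg (fun i => O i k)
    rw [aFd] at h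
    have n1 : nsq (fun i => O i k) = 1 := by
      have := hO' k k
      simp only [if_true] at this
      rw [← this]
      exact Finset.sum_congr rfl fun i _ => by ring
    simp only [hO', n1] at h
    simp at h
    linarith
  have key := jac_diag hσ hg a (by simp only [ha]; linarith)
    (by simp only [ha]; nlinarith) h3 (rotT O T) (rotT_s1 O T s1) (rotT_s2 O T s2)
  rw [rotT_sq O hO] at key
  have t1 : ∀ c, ∑ i, rotT O T i i c = ∑ k, O k c * ∑ i, T i i k := by
    intro c
    have := rotT_tr O T (fun _ => 1) c
    simp only [one_mul, hO] at this
    rw [this]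
    simp
  have t2 : ∀ c, ∑ i, a i * rotT O T i i c
      = ∑ k, O k c * ∑ i, ∑ j, ((if i = j then aS H else 0) - H i j) * T i j k := by
    intro c
    rw [rotT_tr]
    simp only [hF]
  simp only [t1, t2] at key
  rw [rot_sq O hO] at key
  have l1 : ∑ k, (1 + 13 / 12 * (a k / aS H)) * (∑ x, O x k * ∑ i, T i i x) ^ 2
      = nsq (fun k => ∑ i, T i i k)
      + 13 / 12 * (aF H (fun k => ∑ i, T i i k) (fun k => ∑ i, T i i k) / aS H) := by
    rw [aFd, nsq, ← rot_sq O hO, Finset.sum_div, Finset.mul_sum, ← Finset.sum_add_distrib]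
    exact Finset.sum_congr rfl fun c _ => by ring
  rw [l1] at key
  exact key

/-- The Hessian at a point, as a plain array. -/
def Hx (v : E3 → ℝ) (x : E3) : Fin 3 → Fin 3 → ℝ := fun i j => hh v i j x

/-- `σ₂` of the Hessian as a function. -/
def G (v : E3 → ℝ) (x : E3) : ℝ := aG (Hx v x)

def V (v : E3 → ℝ) (x : E3) : ℝ := aV (Hx v x)

/-- Gradient as a plain array. -/
def dg (φ : E3 → ℝ) (x : E3) : Fin 3 → ℝ := fun i => pd i φ x

lemma Fq_eq (v φ ψ : E3 → ℝ) (x : E3) : Fq v φ ψ x = aF (Hx v x) (dg φ x) (dg ψ x) := rfl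

lemma S_eq (v : E3 → ℝ) (x : E3) : S v x = aS (Hx v x) := rfl

lemma Hx_symm {v : E3 → ℝ} (hv : ContDiff ℝ ∞ v) (x : E3) (i j : Fin 3) :
    Hx v x i j = Hx v x j i := by
  simp only [Hx]
  rw [hh_symm hv]

/-- Globalized hypotheses. -/
structure GH (K : ℝ) (f : E3 × ℝ × E3 → ℝ) (v : E3 → ℝ) : Prop where
  hK : 1 ≤ K
  fC : ContDiff ℝ 2 f
  flow : ∀ z, 1 / K ≤ f z
  fb : ∀ z, ∀ k : ℕ, k ≤ 2 → ‖iteratedFDeriv ℝ k f z‖ ≤ K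
  sm : ContDiff ℝ ∞ v
  eq : ∀ x ∈ ball (0 : E3) 9, G v x = f (x, v x, grad v x)
  pos : ∀ x ∈ ball (0 : E3) 9, 0 < S v x
  bd : ∀ x ∈ ball (0 : E3) 9, |v x| + ‖grad v x‖ ≤ K

lemma G_smooth {v : E3 → ℝ} (hv : ContDiff ℝ ∞ v) : ContDiff ℝ ∞ (G v) := by
  unfold G aG Hx
  have h := fun i j => hh_smooth hv i j
  exact (((ContDiff.sum fun i _ => h i i).pow 2).sub
    (ContDiff.sum fun i _ => ContDiff.sum fun j _ => (h i j).mul (h j i))).div_const 2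

lemma V_smooth {v : E3 → ℝ} (hv : ContDiff ℝ ∞ v) : ContDiff ℝ ∞ (V v) := by
  have h := fun i j => hh_smooth hv i j
  have e : V v = fun x => S v x * G v x - (hh v 0 0 x * hh v 1 1 x * hh v 2 2 x
      - hh v 0 0 x * hh v 1 2 x * hh v 2 1 x - hh v 0 1 x * hh v 1 0 x * hh v 2 2 x
      + hh v 0 1 x * hh v 1 2 x * hh v 2 0 x + hh v 0 2 x * hh v 1 0 x * hh v 2 1 x
      - hh v 0 2 x * hh v 1 1 x * hh v 2 0 x) := by
    funext x
    simp only [V, aV, Matrix.det_fin_three, Matrix.of_apply]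
    rfl
  rw [e]
  refine ((S_smooth hv).mul (G_smooth hv)).sub ?_
  exact ((((((h 0 0).mul (h 1 1)).mul (h 2 2)).sub (((h 0 0).mul (h 1 2)).mul (h 2 1))).sub
    (((h 0 1).mul (h 1 0)).mul (h 2 2))).add (((h 0 1).mul (h 1 2)).mul (h 2 0))).add
    (((h 0 2).mul (h 1 0)).mul (h 2 1)) |>.sub (((h 0 2).mul (h 1 1)).mul (h 2 0))

lemma pd_G {v : E3 → ℝ} (hv : ContDiff ℝ ∞ v) (k : Fin 3) :
    pd k (G v) = fun x => ∑ i, ∑ j, Fm v i j x * pd k (hh v i j) x := by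
  have h := fun i j => hh_smooth hv i j
  have e : G v = fun x => (1 / 2) * (S v x * S v x - ∑ i, ∑ j, hh v i j x * hh v i j x) := by
    funext x
    simp only [G, aG, Hx, S]
    have : ∀ i j, hh v i j x * hh v j i x = hh v i j x * hh v i j x := by
      intro i j; rw [hh_symm hv j i]
    simp only [this]
    ring
  rw [e]
  have s1 : ∀ i j, ContDiff ℝ ∞ (fun x => hh v i j x * hh v i j x) := fun i j => (h i j).mul (h i j)
  have s2 : ∀ i, ContDiff ℝ ∞ (fun x => ∑ j, hh v i j x * hh v i j x) := fun i =>
    ContDiff.sum fun j _ => s1 i j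
  have s3 : ContDiff ℝ ∞ (fun x => ∑ i, ∑ j, hh v i j x * hh v i j x) :=
    ContDiff.sum fun i _ => s2 i
  have s4 : ContDiff ℝ ∞ (fun x => S v x * S v x) := (S_smooth hv).mul (S_smooth hv)
  rw [pd_cmul (s4.sub s3), pd_sub s4 s3, pd_mul (S_smooth hv) (S_smooth hv), pd_sum _ s2]
  funext x
  have e2 : ∀ i, pd k (fun x => ∑ j, hh v i j x * hh v i j x) x
      = ∑ j, 2 * (hh v i j x * pd k (hh v i j) x) := by
    intro i
    rw [pd_sum _ (s1 i)]
    refine Finset.sum_congr rfl fun j _ => ?_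
    rw [pd_mul (h i j) (h i j)]
    ring
  simp only [e2, Fm, sub_mul, Finset.sum_sub_distrib, ite_mul, zero_mul]
  simp only [← Finset.mul_sum]
  simp only [Finset.sum_ite_eq, Finset.mem_univ, if_true]
  rw [← Finset.mul_sum, pd_S hv]
  ring

/-- Third derivatives array. -/
def T3 (v : E3 → ℝ) (x : E3) (i j k : Fin 3) : ℝ := pd k (hh v i j) x

lemma T3_s1 {v : E3 → ℝ} (hv : ContDiff ℝ ∞ v) (x : E3) (i j k : Fin 3) :
    T3 v x i j k = T3 v x j i k := by
  simp only [T3]; rw [hh_symm hv]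

lemma T3_s2 {v : E3 → ℝ} (hv : ContDiff ℝ ∞ v) (x : E3) (i j k : Fin 3) :
    T3 v x i j k = T3 v x i k j := by
  simp only [T3]; rw [hh_symm hv i j, pd_hh_symm hv j i k, hh_symm hv k i]

lemma lap_G {v : E3 → ℝ} (hv : ContDiff ℝ ∞ v) (x : E3) :
    ∑ k, pd k (pd k (G v)) x = Lop v (S v) x + nsq (dg (S v) x)
      - ∑ i, ∑ j, ∑ k, T3 v x i j k ^ 2 := by
  have h := fun i j => hh_smooth hv i j
  have e1 : ∀ k, pd k (pd k (G v)) x = ∑ i, ∑ j, (Fm v i j x * pd k (pd k (hh v i j)) x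
      + pd k (hh v i j) x * ((if i = j then pd k (S v) x else 0) - pd k (hh v i j) x)) := by
    intro k
    rw [pd_G hv]
    have s1 : ∀ i j, ContDiff ℝ ∞ (fun x => Fm v i j x * pd k (hh v i j) x) := fun i j =>
      (Fm_smooth hv i j).mul (pd_smooth (h i j) k)
    rw [pd_sum _ (fun i => ContDiff.sum fun j _ => s1 i j)]
    refine Finset.sum_congr rfl fun i _ => ?_
    rw [pd_sum _ (s1 i)]
    refine Finset.sum_congr rfl fun j _ => ?_
    rw [pd_mul (Fm_smooth hv i j) (pd_smooth (h i j) k), pd_Fm hv]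
  have e2 : Lop v (S v) x = ∑ k, ∑ i, ∑ j, Fm v i j x * pd k (pd k (hh v i j)) x := by
    have c : ∀ i j k, pd i (pd j (hh v k k)) = pd k (pd k (hh v i j)) := by
      intro i j k
      unfold hh
      rw [pd_comm (pd_smooth (pd_smooth hv k) k) i j, pd_comm (pd_smooth (pd_smooth hv k) k) j i,
        pd_comm (pd_smooth hv k) j k, pd_comm hv j k,
        pd_comm (pd_smooth (pd_smooth hv j) k) i k, pd_comm (pd_smooth hv j) i k]
    have d : ∀ i j, pd i (pd j (S v)) x = ∑ k, pd k (pd k (hh v i j)) x := by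
      intro i j
      rw [pd_S hv, pd_sum _ (fun k => pd_smooth (h k k) j)]
      exact Finset.sum_congr rfl fun k _ => by rw [c]
    simp only [Lop, d, Finset.mul_sum]
    simp only [Fin.sum_univ_three]
    ring
  simp only [e1, Finset.sum_add_distrib, e2, mul_sub, Finset.sum_sub_distrib, mul_ite, mul_zero]
  have e3 : ∀ k, ∑ i, ∑ j, (if i = j then pd k (hh v i j) x * pd k (S v) x else 0)
      = pd k (S v) x ^ 2 := by
    intro k
    simp only [Finset.sum_ite_eq, Finset.mem_univ, if_true]
    rw [← Finset.sum_mul]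
    have : ∑ i, pd k (hh v i i) x = pd k (S v) x := by rw [pd_S hv]
    rw [this]; ring
  simp only [e3]
  have e4 : ∑ k, ∑ i, ∑ j, pd k (hh v i j) x * pd k (hh v i j) x
      = ∑ i, ∑ j, ∑ k, T3 v x i j k ^ 2 := by
    simp only [T3, Fin.sum_univ_three]; ring
  rw [e4]
  simp only [nsq, dg]
  ring

lemma fderiv_triple {q : E3 → E3} {r : E3 → ℝ} {w : Fin 3 → E3 → ℝ} {q' : E3} {x : E3} (k : Fin 3)
    (hq : DifferentiableAt ℝ q x) (hq' : fderiv ℝ q x (EuclideanSpace.single k 1) = q')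
    (hr : ContDiff ℝ ∞ r) (hw : ∀ i, ContDiff ℝ ∞ (w i)) :
    DifferentiableAt ℝ (fun y => ((q y, r y, WithLp.toLp 2 (fun i => w i y)) : E3 × ℝ × E3)) x ∧
    fderiv ℝ (fun y => ((q y, r y, WithLp.toLp 2 (fun i => w i y)) : E3 × ℝ × E3)) x
      (EuclideanSpace.single k 1) = (q', pd k r x, WithLp.toLp 2 (fun i => pd k (w i) x)) := by
  have hwd : DifferentiableAt ℝ (fun y => (WithLp.toLp 2 (fun i => w i y) : E3)) x := by
    rw [differentiableAt_euclidean]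
    intro i
    exact smooth_diff (hw i) x
  have hrd := smooth_diff hr x
  refine ⟨hq.prodMk (hrd.prodMk hwd), ?_⟩
  have hw' : fderiv ℝ (fun y => (WithLp.toLp 2 (fun i => w i y) : E3)) x (EuclideanSpace.single k 1)
      = WithLp.toLp 2 (fun i => pd k (w i) x) := by
    ext i
    have h1 := ((EuclideanSpace.proj i : E3 →L[ℝ] ℝ).hasFDerivAt.comp x hwd.hasFDerivAt).fderiv
    have h2 : ((EuclideanSpace.proj i : E3 →L[ℝ] ℝ) ∘ fun y => (WithLp.toLp 2 (fun i => w i y) : E3))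
      = w i := by
      funext y; simp
    rw [h2] at h1
    simp only [pd]
    rw [h1]
    simp
  rw [DifferentiableAt.fderiv_prodMk hq (hrd.prodMk hwd), DifferentiableAt.fderiv_prodMk hrd hwd]
  simp only [ContinuousLinearMap.prod_apply, hq', hw']
  rfl

section

variable {K : ℝ} {f : E3 × ℝ × E3 → ℝ} {v : E3 → ℝ}

lemma GH.G_lower (h : GH K f v) {x : E3} (hx : x ∈ ball (0 : E3) 9) : 1 / K ≤ G v x := by
  rw [h.eq x hx]; exact h.flow _

lemma GH.G_pos (h : GH K f v) {x : E3} (hx : x ∈ ball (0 : E3) 9) : 0 < G v x :=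
  lt_of_lt_of_le (by have := h.hK; positivity) (h.G_lower hx)

lemma GH.f_le (h : GH K f v) (z : E3 × ℝ × E3) : f z ≤ K := by
  have := h.fb z 0 (by norm_num)
  rw [norm_iteratedFDeriv_zero] at this
  exact (le_abs_self _).trans this

lemma GH.G_upper (h : GH K f v) {x : E3} (hx : x ∈ ball (0 : E3) 9) : G v x ≤ K := by
  rw [h.eq x hx]; exact h.f_le _

lemma GH.f1 (h : GH K f v) (z : E3 × ℝ × E3) : ‖fderiv ℝ f z‖ ≤ K := by
  have := h.fb z 1 (by norm_num)
  rwa [norm_iteratedFDeriv_one] at this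

lemma GH.f2 (h : GH K f v) (z : E3 × ℝ × E3) : ‖fderiv ℝ (fderiv ℝ f) z‖ ≤ K := by
  have := h.fb z 2 (by norm_num)
  rwa [← norm_iteratedFDeriv_fderiv, norm_iteratedFDeriv_one] at this

lemma GH.S_lower (h : GH K f v) {x : E3} (hx : x ∈ ball (0 : E3) 9) : 1 ≤ K * S v x := by
  have hK := h.hK
  have h1 := frob_eq (Hx_symm h.sm x)
  have h2 : 0 ≤ ∑ i, ∑ j, Hx v x i j ^ 2 :=
    Finset.sum_nonneg fun i _ => Finset.sum_nonneg fun j _ => sq_nonneg _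
  have h3 := h.G_lower hx
  have hp := h.pos x hx
  rw [← S_eq] at h1
  have h4 : 2 * (1 / K) ≤ S v x ^ 2 := by
    have : aG (Hx v x) = G v x := rfl
    linarith
  have h5 : 2 * K ≤ (K * S v x) ^ 2 := by
    have : K ^ 2 * (2 * (1 / K)) ≤ K ^ 2 * S v x ^ 2 := mul_le_mul_of_nonneg_left h4 (sq_nonneg K)
    have e : K ^ 2 * (2 * (1 / K)) = 2 * K := by field_simp
    nlinarith
  have h6 : 0 < K * S v x := by positivity
  nlinarith

lemma GH.V_lower (h : GH K f v) {x : E3} (hx : x ∈ ball (0 : E3) 9) : S v x ≤ 2 * K * V v x := by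
  have hK := h.hK
  have h1 := aV_lower (Hx_symm h.sm x) (h.pos x hx) (h.G_pos hx)
  have h3 := h.G_lower hx
  have hp := h.pos x hx
  have h4 : 2 * (1 / K) * S v x ≤ 3 * V v x := by
    refine le_trans ?_ h1
    exact mul_le_mul_of_nonneg_right (mul_le_mul_of_nonneg_left h3 (by norm_num)) hp.le
  have h5 : K * (2 * (1 / K) * S v x) ≤ K * (3 * V v x) := mul_le_mul_of_nonneg_left h4 (by linarith)
  have e : K * (2 * (1 / K) * S v x) = 2 * S v x := by field_simp
  rw [e] at h5
  nlinarith

lemma GH.V_pos (h : GH K f v) {x : E3} (hx : x ∈ ball (0 : E3) 9) : 0 < V v x := by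
  have := h.V_lower hx
  have hp := h.pos x hx
  have hK := h.hK
  by_contra hc
  push Not at hc
  nlinarith

lemma grad_apply (v : E3 → ℝ) (x : E3) (i : Fin 3) : grad v x i = pd i v x := rfl

lemma norm_sq_grad (v : E3 → ℝ) (x : E3) : ‖grad v x‖ ^ 2 = nsq (dg v x) := by
  rw [EuclideanSpace.norm_sq_eq]
  simp [nsq, dg, grad_apply]

lemma abs_coord_le (w : E3) (i : Fin 3) : |w i| ≤ ‖w‖ := by
  have := EuclideanSpace.norm_sq_eq w
  have h2 : ‖w i‖ ^ 2 ≤ ∑ i, ‖w i‖ ^ 2 :=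
    Finset.single_le_sum (f := fun i => ‖w i‖ ^ 2) (fun i _ => sq_nonneg _) (Finset.mem_univ i)
  rw [← this] at h2
  exact abs_le_of_sq_le_sq (by simpa using h2) (norm_nonneg _)

lemma GH.pdv (h : GH K f v) {x : E3} (hx : x ∈ ball (0 : E3) 9) (i : Fin 3) : |pd i v x| ≤ K := by
  have h1 := abs_coord_le (grad v x) i
  rw [grad_apply] at h1
  have h2 := h.bd x hx
  have := abs_nonneg (v x)
  linarith

lemma GH.entry (h : GH K f v) {x : E3} (hx : x ∈ ball (0 : E3) 9) (i j : Fin 3) :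
    |hh v i j x| ≤ S v x :=
  abs_le_of_sq_le_sq (entry_sq_le (Hx_symm h.sm x) (h.G_pos hx) i j) (h.pos x hx).le

/-- first derivative of the graph map -/
def gam1 (v : E3 → ℝ) (k : Fin 3) (x : E3) : E3 × ℝ × E3 :=
  (EuclideanSpace.single k 1, pd k v x, WithLp.toLp 2 (fun i => hh v k i x))

lemma GH.gam1_norm (h : GH K f v) {x : E3} (hx : x ∈ ball (0 : E3) 9) (k : Fin 3) :
    ‖gam1 v k x‖ ≤ K ^ 2 * S v x := by
  have hK := h.hK
  have hs := h.S_lower hx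
  have hp := h.pos x hx
  have c1 : 1 ≤ K ^ 2 * S v x := by nlinarith
  have c2 : K ≤ K ^ 2 * S v x := by nlinarith
  have c3 : S v x ≤ K ^ 2 * S v x := by nlinarith [mul_nonneg (sub_nonneg.2 hK) hp.le, mul_pos (lt_of_lt_of_le one_pos hK) hp]
  refine max_le ?_ (max_le ?_ ?_)
  · simpa [gam1] using c1
  · exact (h.pdv hx k).trans c2
  · refine le_trans ?_ c3
    have e : ‖(gam1 v k x).2.2‖ ^ 2 ≤ S v x ^ 2 := by
      rw [EuclideanSpace.norm_sq_eq]
      have h1 := frob_eq (Hx_symm h.sm x)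
      have h2 : ∑ j, Hx v x k j ^ 2 ≤ ∑ i, ∑ j, Hx v x i j ^ 2 :=
        Finset.single_le_sum (f := fun i => ∑ j, Hx v x i j ^ 2)
        (fun i _ => Finset.sum_nonneg fun j _ => sq_nonneg _) (Finset.mem_univ k)
      have h3 : 0 < aG (Hx v x) := h.G_pos hx
      have h4 : ∑ i, ‖(gam1 v k x).2.2 i‖ ^ 2 = ∑ j, Hx v x k j ^ 2 := by
        refine Finset.sum_congr rfl fun j _ => ?_
        simp [gam1, Hx]
      rw [h4, S_eq]
      linarith
    exact (le_abs_self _).trans (abs_le_of_sq_le_sq e hp.le)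

lemma pd_comp_graph (hf : ContDiff ℝ 2 f) (hv : ContDiff ℝ ∞ v) (k : Fin 3) :
    pd k (fun x => f (x, v x, grad v x)) = fun x => fderiv ℝ f (x, v x, grad v x) (gam1 v k x) := by
  funext x
  obtain ⟨d1, d2⟩ := fderiv_triple (q := fun y => y) (q' := EuclideanSpace.single k 1) (r := v) (w := fun i => pd i v) (x := x) k
    differentiableAt_id (by simp) hv (fun i => pd_smooth hv i)
  have hfd : DifferentiableAt ℝ f (x, v x, grad v x) := (hf.differentiable (by simp)) _
  have := (hfd.hasFDerivAt.comp x d1.hasFDerivAt).fderiv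
  change fderiv ℝ (f ∘ fun y => ((y, v y, WithLp.toLp 2 (fun i => pd i v y)) : E3 × ℝ × E3)) x _ = _
  rw [this, ContinuousLinearMap.comp_apply, d2]
  rfl

def gam2 (v : E3 → ℝ) (k : Fin 3) (x : E3) : E3 × ℝ × E3 :=
  (0, hh v k k x, WithLp.toLp 2 (fun i => pd k (hh v k i) x))

lemma pd_comp_graph2 (hf : ContDiff ℝ 2 f) (hv : ContDiff ℝ ∞ v) (k : Fin 3) (x : E3) :
    pd k (pd k (fun x => f (x, v x, grad v x))) x =
      fderiv ℝ (fderiv ℝ f) (x, v x, grad v x) (gam1 v k x) (gam1 v k x)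
      + fderiv ℝ f (x, v x, grad v x) (gam2 v k x) := by
  rw [pd_comp_graph hf hv]
  obtain ⟨d1, d2⟩ := fderiv_triple (q := fun y => y) (q' := EuclideanSpace.single k 1) (r := v) (w := fun i => pd i v) (x := x) k
    differentiableAt_id (by simp) hv (fun i => pd_smooth hv i)
  obtain ⟨d3, d4⟩ := fderiv_triple (q := fun y => EuclideanSpace.single k 1) (q' := 0)
    (r := pd k v) (w := fun i => hh v k i) (x := x) k
    (differentiableAt_const _) (by simp) (pd_smooth hv k) (fun i => hh_smooth hv k i)
  have hfd : DifferentiableAt ℝ (fderiv ℝ f) (x, v x, grad v x) :=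
    ((hf.fderiv_right (m := 1) (by norm_num)).differentiable (by simp)) _
  have hc := hfd.hasFDerivAt.comp x d1.hasFDerivAt
  change fderiv ℝ (fun y => ((fderiv ℝ f) ∘ fun y => ((y, v y, WithLp.toLp 2 (fun i => pd i v y)) : E3 × ℝ × E3)) y ((EuclideanSpace.single k 1, pd k v y, WithLp.toLp 2 (fun i => hh v k i y)) : E3 × ℝ × E3)) x _ = _
  rw [fderiv_clm_apply hc.differentiableAt d3]
  rw [hc.fderiv]
  simp only [_root_.add_apply, ContinuousLinearMap.flip_apply,
    ContinuousLinearMap.comp_apply]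
  change fderiv ℝ f _ (fderiv ℝ (fun y => ((EuclideanSpace.single k 1, pd k v y, WithLp.toLp 2 (fun i => hh v k i y)) : E3 × ℝ × E3)) x _) + _ = _
  rw [d4, d2, add_comm]
  rfl

lemma GH.pdG (h : GH K f v) {x : E3} (hx : x ∈ ball (0 : E3) 9) (k : Fin 3) :
    |pd k (G v) x| ≤ K ^ 3 * S v x := by
  rw [pd_congr isOpen_ball h.eq k x hx, pd_comp_graph h.fC h.sm]
  have h1 := (fderiv ℝ f (x, v x, grad v x)).le_opNorm (gam1 v k x)
  have h2 := h.f1 (x, v x, grad v x)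
  have h3 := h.gam1_norm hx k
  rw [Real.norm_eq_abs] at h1
  refine h1.trans ?_
  calc _ ≤ K * (K ^ 2 * S v x) := mul_le_mul h2 h3 (norm_nonneg _) (by linarith [h.hK])
    _ = _ := by ring

lemma GH.lapG (h : GH K f v) {x : E3} (hx : x ∈ ball (0 : E3) 9) :
    |∑ k, pd k (pd k (G v)) x| ≤ 4 * K ^ 5 * S v x ^ 2 * K + K * √(nsq (dg (S v) x)) := by
  have hK := h.hK
  have hs := h.S_lower hx
  have hp := h.pos x hx
  have e : ∀ k, pd k (pd k (G v)) x = fderiv ℝ (fderiv ℝ f) (x, v x, grad v x) (gam1 v k x) (gam1 v k x)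
      + fderiv ℝ f (x, v x, grad v x) (gam2 v k x) := by
    intro k
    rw [← pd_comp_graph2 h.fC h.sm]
    exact pd_congr isOpen_ball (pd_congr isOpen_ball h.eq k) k x hx
  simp only [e, Finset.sum_add_distrib]
  have a1 : |∑ k, fderiv ℝ (fderiv ℝ f) (x, v x, grad v x) (gam1 v k x) (gam1 v k x)|
      ≤ 3 * (K * (K ^ 2 * S v x) ^ 2) := by
    refine (Finset.abs_sum_le_sum_abs _ _).trans ?_
    have : ∀ k ∈ (Finset.univ : Finset (Fin 3)),
        |fderiv ℝ (fderiv ℝ f) (x, v x, grad v x) (gam1 v k x) (gam1 v k x)|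
        ≤ K * (K ^ 2 * S v x) ^ 2 := by
      intro k _
      have h1 := (fderiv ℝ (fderiv ℝ f) (x, v x, grad v x)).le_opNorm₂ (gam1 v k x) (gam1 v k x)
      rw [Real.norm_eq_abs] at h1
      refine h1.trans ?_
      have h3 := h.gam1_norm hx k
      have h2 := h.f2 (x, v x, grad v x)
      have h4 : 0 ≤ K ^ 2 * S v x := by positivity
      calc _ ≤ K * (K ^ 2 * S v x) * (K ^ 2 * S v x) :=
            mul_le_mul (mul_le_mul h2 h3 (norm_nonneg _) (by linarith)) h3 (norm_nonneg _)
              (by positivity)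
        _ = _ := by ring
    refine (Finset.sum_le_sum this).trans ?_
    simp
  have a2 : |∑ k, fderiv ℝ f (x, v x, grad v x) (gam2 v k x)|
      ≤ K * (S v x + √(nsq (dg (S v) x))) := by
    rw [← map_sum]
    have h1 := (fderiv ℝ f (x, v x, grad v x)).le_opNorm (∑ k, gam2 v k x)
    rw [Real.norm_eq_abs] at h1
    refine h1.trans ?_
    have h2 := h.f1 (x, v x, grad v x)
    refine mul_le_mul h2 ?_ (norm_nonneg _) (by linarith)
    have e2 : ∑ k, gam2 v k x = (0, S v x, WithLp.toLp 2 (dg (S v) x)) := by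
      refine Prod.ext ?_ (Prod.ext ?_ ?_)
      · simp [gam2, Prod.fst_sum]
      · simp [gam2, S, Prod.snd_sum, Prod.fst_sum]
      · simp only [gam2, Prod.snd_sum]
        ext i
        simp only [dg, WithLp.ofLp_sum, Finset.sum_apply]
        rw [pd_S h.sm]
        refine Finset.sum_congr rfl fun k _ => ?_
        rw [pd_hh_symm h.sm k k i, hh_symm h.sm i k]
    rw [e2]
    have p0 := Real.sqrt_nonneg (nsq (dg (S v) x))
    refine max_le (by simp; positivity) (max_le ?_ ?_)
    · change |S v x| ≤ _
      rw [abs_of_pos hp]; linarith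
    · change ‖(WithLp.toLp 2 (dg (S v) x) : E3)‖ ≤ _
      rw [EuclideanSpace.norm_eq]
      simp only [Real.norm_eq_abs, sq_abs]
      change √(nsq (dg (S v) x)) ≤ _
      linarith
  refine (abs_add_le _ _).trans ?_
  have c1 : K * S v x ≤ K ^ 6 * S v x ^ 2 := by
    have k1 : 1 ≤ K ^ 4 := one_le_pow₀ hK
    have k2 : K * S v x ≤ (K * S v x) ^ 2 := by nlinarith
    nlinarith [mul_nonneg (sub_nonneg.2 k1) (sq_nonneg (K * S v x))]
  have c2 : K * (K ^ 2 * S v x) ^ 2 ≤ K ^ 6 * S v x ^ 2 := by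
    have : K ^ 6 * S v x ^ 2 = K * (K * (K ^ 2 * S v x) ^ 2) := by ring
    rw [this]
    have : 0 ≤ K * (K ^ 2 * S v x) ^ 2 := by positivity
    nlinarith
  nlinarith

end

lemma pd_chain {s : E3 → ℝ} (hs : ContDiff ℝ ∞ s) {Ψ : ℝ → ℝ} {d : ℝ} {x : E3} (i : Fin 3)
    (hΨ : HasDerivAt Ψ d (s x)) : pd i (fun y => Ψ (s y)) x = d * pd i s x := by
  have h := hΨ.comp_hasFDerivAt x (smooth_diff hs x).hasFDerivAt
  simp only [pd]
  have h2 : fderiv ℝ (fun y => Ψ (s y)) x = d • fderiv ℝ s x := h.fderiv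
  rw [h2]
  simp

lemma GH.sqrt_grad {K : ℝ} {f : E3 × ℝ × E3 → ℝ} {v : E3 → ℝ} (h : GH K f v) {x : E3}
    (hx : x ∈ ball (0 : E3) 9) (ξ : Fin 3 → ℝ) {t : ℝ} (ht : 0 < t) :
    √(nsq ξ) ≤ t * aF (Hx v x) ξ ξ + K * S v x / (4 * t) := by
  have hK := h.hK
  have hp := h.pos x hx
  have h1 := aF_lower (Hx_symm h.sm x) (h.pos x hx) (h.G_pos hx) ξ
  have h2 := h.G_lower hx
  have hn := nsq_nonneg ξ
  have hF := aF_nonneg (Hx_symm h.sm x) (h.pos x hx) (h.G_pos hx) ξ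
  have h3 : nsq ξ ≤ K * S v x * aF (Hx v x) ξ ξ := by
    have a : 1 / K * nsq ξ ≤ S v x * aF (Hx v x) ξ ξ :=
      (mul_le_mul_of_nonneg_right h2 hn).trans h1
    have b := mul_le_mul_of_nonneg_left a (by linarith : 0 ≤ K)
    have e : K * (1 / K * nsq ξ) = nsq ξ := by field_simp
    rw [e] at b
    linarith
  have h4 : 0 ≤ t * aF (Hx v x) ξ ξ + K * S v x / (4 * t) := by positivity
  rw [Real.sqrt_le_left h4]
  have e : K * S v x * aF (Hx v x) ξ ξ = 4 * (t * aF (Hx v x) ξ ξ) * (K * S v x / (4 * t)) := by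
    field_simp
  nlinarith [sq_nonneg (t * aF (Hx v x) ξ ξ - K * S v x / (4 * t))]

/-- Hypotheses with the (globalized) function `b = log (K Δu)`. -/
structure BH (K : ℝ) (f : E3 × ℝ × E3 → ℝ) (v b : E3 → ℝ) : Prop where
  gh : GH K f v
  bs : ContDiff ℝ ∞ b
  be : ∀ x ∈ ball (0 : E3) 8, b x = Real.log (K * S v x)

lemma mem89 {x : E3} (hx : x ∈ ball (0 : E3) 8) : x ∈ ball (0 : E3) 9 :=
  ball_subset_ball (by norm_num) hx

section

variable {K : ℝ} {f : E3 × ℝ × E3 → ℝ} {v b : E3 → ℝ}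

lemma BH.b_nonneg (h : BH K f v b) {x : E3} (hx : x ∈ ball (0 : E3) 8) : 0 ≤ b x := by
  rw [h.be x hx]
  exact Real.log_nonneg (h.gh.S_lower (mem89 hx))

lemma BH.b_le (h : BH K f v b) {x : E3} (hx : x ∈ ball (0 : E3) 8) : b x ≤ K * S v x := by
  rw [h.be x hx]
  have := h.gh.S_lower (mem89 hx)
  have := Real.log_le_sub_one_of_pos (by linarith : 0 < K * S v x)
  linarith

lemma BH.S_exp (h : BH K f v b) {x : E3} (hx : x ∈ ball (0 : E3) 8) :
    S v x = K⁻¹ * Real.exp (b x) := by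
  rw [h.be x hx]
  have := h.gh.S_lower (mem89 hx)
  have hK := h.gh.hK
  rw [Real.exp_log (by linarith)]
  field_simp

lemma BH.dS (h : BH K f v b) (i : Fin 3) : ∀ x ∈ ball (0 : E3) 8,
    pd i (S v) x = S v x * pd i b x := by
  intro x hx
  rw [pd_congr isOpen_ball (fun y hy => h.S_exp hy) i x hx,
    pd_chain (Ψ := fun t => K⁻¹ * Real.exp t) h.bs i ((Real.hasDerivAt_exp _).const_mul _), ← h.S_exp hx]

lemma BH.ddS (h : BH K f v b) (i j : Fin 3) : ∀ x ∈ ball (0 : E3) 8,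
    pd i (pd j (S v)) x = S v x * (pd i (pd j b) x + pd i b x * pd j b x) := by
  intro x hx
  rw [pd_congr isOpen_ball (fun y hy => h.dS j y hy) i x hx,
    pd_mul (S_smooth h.gh.sm) (pd_smooth h.bs j)]
  simp only
  rw [h.dS i x hx]
  ring

lemma BH.LS (h : BH K f v b) {x : E3} (hx : x ∈ ball (0 : E3) 8) :
    Lop v (S v) x = S v x * (Lop v b x + Fq v b b x) := by
  simp only [Lop, Fq, ← Finset.sum_add_distrib, Finset.mul_sum]
  refine Finset.sum_congr rfl fun i _ => Finset.sum_congr rfl fun j _ => ?_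
  rw [h.ddS i j x hx]
  ring

lemma BH.FS (h : BH K f v b) {x : E3} (hx : x ∈ ball (0 : E3) 8) :
    Fq v (S v) (S v) x = S v x ^ 2 * Fq v b b x := by
  simp only [Fq, Finset.mul_sum]
  refine Finset.sum_congr rfl fun i _ => Finset.sum_congr rfl fun j _ => ?_
  rw [h.dS i x hx, h.dS j x hx]
  ring

lemma BH.nS (h : BH K f v b) {x : E3} (hx : x ∈ ball (0 : E3) 8) :
    √(nsq (dg (S v) x)) = S v x * √(nsq (dg b x)) := by
  have e : nsq (dg (S v) x) = S v x ^ 2 * nsq (dg b x) := by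
    simp only [nsq, dg, Finset.mul_sum]
    refine Finset.sum_congr rfl fun i _ => ?_
    rw [h.dS i x hx]
    ring
  rw [e, Real.sqrt_mul (sq_nonneg _), Real.sqrt_sq (h.gh.pos x (mem89 hx)).le]

lemma BH.jacobi (h : BH K f v b) {x : E3} (hx : x ∈ ball (0 : E3) 8) :
    1 / 24 * Fq v b b x - 340 * K ^ 7 * S v x ≤ Lop v b x := by
  have hx9 := mem89 hx
  have hK := h.gh.hK
  have hp := h.gh.pos x hx9
  have hsm := h.gh.sm
  have j := jacobi_alg (Hx_symm hsm x) hp (h.gh.G_pos hx9) (T := T3 v x) (T3_s1 hsm x) (T3_s2 hsm x)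
  have e1 : (fun k => ∑ i, T3 v x i i k) = dg (S v) x := by
    funext k; simp only [dg, T3]; rw [pd_S hsm]
  have e2 : (fun k => ∑ i, ∑ j, ((if i = j then aS (Hx v x) else 0) - Hx v x i j) * T3 v x i j k)
      = dg (G v) x := by
    funext k; simp only [dg, T3]; rw [pd_G hsm]; rfl
  rw [e1, e2, ← Fq_eq, ← S_eq] at j
  have l := lap_G hsm x
  have a := h.gh.lapG hx9
  rw [h.nS hx] at a
  rw [h.LS hx] at l
  rw [h.FS hx] at j
  have e3 : S v x ^ 2 * Fq v b b x / S v x = S v x * Fq v b b x := by field_simp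
  rw [e3] at j
  have sg := h.gh.sqrt_grad hx9 (dg b x) (t := 1 / (24 * K)) (by positivity)
  rw [← Fq_eq] at sg
  have e4 : K * S v x / (4 * (1 / (24 * K))) = 6 * K ^ 2 * S v x := by field_simp; norm_num
  rw [e4] at sg
  have sg2 := mul_le_mul_of_nonneg_left sg (by positivity : 0 ≤ K)
  have e5 : K * (1 / (24 * K) * Fq v b b x + 6 * K ^ 2 * S v x)
    = 1 / 24 * Fq v b b x + 6 * K ^ 3 * S v x := by field_simp
  rw [e5] at sg2
  have n1 : nsq (dg (G v) x) ≤ 3 * (K ^ 3 * S v x) ^ 2 := by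
    have : ∀ k ∈ (Finset.univ : Finset (Fin 3)), dg (G v) x k ^ 2 ≤ (K ^ 3 * S v x) ^ 2 := by
      intro k _
      rw [sq_le_sq, abs_of_nonneg (by positivity : 0 ≤ K ^ 3 * S v x)]
      exact h.gh.pdG hx9 k
    refine (Finset.sum_le_sum this).trans ?_
    simp
  have n2 : 110 / aG (Hx v x) * nsq (dg (G v) x) ≤ 110 * K * (3 * (K ^ 3 * S v x) ^ 2) := by
    refine mul_le_mul ?_ n1 (nsq_nonneg _) (by positivity)
    have gl := h.gh.G_lower hx9
    have gp := h.gh.G_pos hx9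
    change 110 / G v x ≤ _
    rw [div_le_iff₀ gp]
    have : K * (1 / K) ≤ K * G v x := mul_le_mul_of_nonneg_left gl (by positivity)
    have e : K * (1 / K) = 1 := by field_simp
    nlinarith
  have a' := (abs_le.1 a).1
  have key : S v x * (1 / 24 * Fq v b b x - 340 * K ^ 7 * S v x) ≤ S v x * Lop v b x := by
    have k1 : K ^ 6 * S v x ^ 2 ≤ K ^ 7 * S v x ^ 2 :=
      mul_le_mul_of_nonneg_right (pow_le_pow_right₀ hK (by norm_num)) (sq_nonneg _)
    have k2 : K ^ 3 * S v x ^ 2 ≤ K ^ 7 * S v x ^ 2 :=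
      mul_le_mul_of_nonneg_right (pow_le_pow_right₀ hK (by norm_num)) (sq_nonneg _)
    have sg3 := mul_le_mul_of_nonneg_left sg2 hp.le
    nlinarith
  exact le_of_mul_le_mul_left key hp

end

lemma cont_intOn {g : E3 → ℝ} (hg : Continuous g) (r : ℝ) : IntegrableOn g (ball (0 : E3) r) :=
  (hg.continuousOn.integrableOn_compact (isCompact_closedBall (0 : E3) r)).mono_set
    ball_subset_closedBall

/-- Master comparison lemma for integral estimates. -/
lemma master {p q w : E3 → ℝ} (hp : Continuous p) (hq : Continuous q) (hw : Continuous w)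
    {r R : ℝ} (hrR : r ≤ R) (h0 : ∀ x, x ∉ ball (0 : E3) R → p x = 0)
    (h1 : ∀ x ∈ ball (0 : E3) R, 0 ≤ p x + w x)
    (h2 : ∀ x ∈ ball (0 : E3) r, q x ≤ p x + w x) (h3 : ∫ x, p x = 0) :
    ∫ x in ball (0 : E3) r, q x ≤ ∫ x in ball (0 : E3) R, w x := by
  have e1 : ∫ x in ball (0 : E3) R, p x = 0 := by
    rw [setIntegral_eq_integral_of_forall_compl_eq_zero h0, h3]
  have e2 : ∫ x in ball (0 : E3) R, (p x + w x) = ∫ x in ball (0 : E3) R, w x := by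
    rw [integral_add (cont_intOn hp R) (cont_intOn hw R), e1, zero_add]
  rw [← e2]
  refine (setIntegral_mono_on (cont_intOn hq r) (cont_intOn (hp.add hw) r) measurableSet_ball h2).trans ?_
  refine setIntegral_mono_set (cont_intOn (hp.add hw) R) ?_ ?_
  · exact (ae_restrict_iff' measurableSet_ball).2 (Filter.Eventually.of_forall h1)
  · exact (ball_subset_ball hrR).eventuallyLE

structure Cut (r : ℝ) (φ : E3 → ℝ) (M : ℝ) : Prop where
  sm : ContDiff ℝ ∞ φ
  cs : HasCompactSupport φ
  nn : ∀ x, 0 ≤ φ x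
  le1 : ∀ x, φ x ≤ 1
  one : ∀ x ∈ ball (0 : E3) r, φ x = 1
  z0 : ∀ x, x ∉ ball (0 : E3) (r + 1) → φ x = 0
  z1 : ∀ x, x ∉ ball (0 : E3) (r + 1) → ∀ i, pd i φ x = 0
  z2 : ∀ x, x ∉ ball (0 : E3) (r + 1) → ∀ i j, pd i (pd j φ) x = 0
  Mp : 0 ≤ M
  b1 : ∀ x i, |pd i φ x| ≤ M
  b2 : ∀ x i j, |pd i (pd j φ) x| ≤ M

lemma pd_tsupport (g : E3 → ℝ) (i : Fin 3) : tsupport (pd i g) ⊆ tsupport g :=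
  tsupport_fderiv_apply_subset ℝ (EuclideanSpace.single i 1)

lemma exists_cut {r : ℝ} (hr : 0 < r) : ∃ φ M, Cut r φ M := by
  let ψ : ContDiffBump (0 : E3) := ⟨r, r + 1 / 2, hr, by linarith⟩
  have sm : ContDiff ℝ ∞ ψ := ψ.contDiff
  have cs : HasCompactSupport ψ := ψ.hasCompactSupport
  have bd : ∀ g : E3 → ℝ, ContDiff ℝ ∞ g → HasCompactSupport g → ∃ M, 0 ≤ M ∧ ∀ x, |g x| ≤ M := by
    intro g hg hc
    obtain ⟨C, hC⟩ := hc.exists_bound_of_continuous hg.continuous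
    exact ⟨|C|, abs_nonneg _, fun x => (hC x).trans (le_abs_self _)⟩
  have s1 := fun i => pd_smooth sm i
  have c1 := fun i => pd_hcs cs i
  have s2 := fun i j => pd_smooth (s1 j) i
  have c2 := fun i j => pd_hcs (c1 j) i
  choose M1 m1 h1 using fun i => bd _ (s1 i) (c1 i)
  choose M2 m2 h2 using fun i j => bd _ (s2 i j) (c2 i j)
  have tz : ∀ x, x ∉ ball (0 : E3) (r + 1) → x ∉ tsupport ψ := by
    intro x hx hc
    rw [ψ.tsupport_eq] at hc
    exact hx (closedBall_subset_ball (by change r + 1 / 2 < r + 1; linarith) hc)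
  refine ⟨ψ, ∑ i, M1 i + ∑ i, ∑ j, M2 i j, sm, cs, fun x => ψ.nonneg, fun x => ψ.le_one, ?_,
    fun x hx => image_eq_zero_of_notMem_tsupport (tz x hx), ?_, ?_, ?_, ?_, ?_⟩
  · intro x hx
    exact ψ.one_of_mem_closedBall (ball_subset_closedBall hx)
  · intro x hx i
    exact image_eq_zero_of_notMem_tsupport fun hc => tz x hx (pd_tsupport _ _ hc)
  · intro x hx i j
    exact image_eq_zero_of_notMem_tsupport fun hc => tz x hx (pd_tsupport _ _ (pd_tsupport _ _ hc))
  · exact add_nonneg (Finset.sum_nonneg fun i _ => m1 i)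
      (Finset.sum_nonneg fun i _ => Finset.sum_nonneg fun j _ => m2 i j)
  · intro x i
    have a := Finset.single_le_sum (f := M1) (fun i _ => m1 i) (Finset.mem_univ i)
    have c : 0 ≤ ∑ i, ∑ j, M2 i j := Finset.sum_nonneg fun i _ => Finset.sum_nonneg fun j _ => m2 i j
    linarith [h1 i x]
  · intro x i j
    have a := Finset.single_le_sum (f := fun i => ∑ j, M2 i j) (fun i _ => Finset.sum_nonneg fun j _ => m2 i j) (Finset.mem_univ i)
    have a' := Finset.single_le_sum (f := M2 i) (fun j _ => m2 i j) (Finset.mem_univ j)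
    have c : 0 ≤ ∑ i, M1 i := Finset.sum_nonneg fun i _ => m1 i
    linarith [h2 i j x]

lemma cs_integrable {g : E3 → ℝ} (hg : Continuous g) (hc : HasCompactSupport g) : Integrable g :=
  hg.integrable_of_hasCompactSupport hc

lemma int_div {φ : E3 → ℝ} (hφ : ContDiff ℝ ∞ φ) (hc : HasCompactSupport φ) {Y : Fin 3 → E3 → ℝ}
    (hY : ∀ i, ContDiff ℝ ∞ (Y i)) :
    ∫ x, ∑ i, (φ x * pd i (Y i) x + pd i φ x * Y i x) = 0 := by
  have i1 : ∀ i, Integrable (fun x => φ x * pd i (Y i) x) := fun i =>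
    cs_integrable (hφ.continuous.mul (pd_smooth (hY i) i).continuous) hc.mul_right
  have i2 : ∀ i, Integrable (fun x => pd i φ x * Y i x) := fun i =>
    cs_integrable ((pd_smooth hφ i).continuous.mul (hY i).continuous) (pd_hcs hc i).mul_right
  have i3 : ∀ i, Integrable (fun x => φ x * pd i (Y i) x + pd i φ x * Y i x) := fun i =>
    (i1 i).add (i2 i)
  rw [integral_finsetSum _ (fun i _ => i3 i)]
  refine Finset.sum_eq_zero fun i _ => ?_
  rw [integral_add (i1 i) (i2 i), ibp hφ (hY i) (Or.inl hc)]
  ring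

lemma Fq_symm {v : E3 → ℝ} (hv : ContDiff ℝ ∞ v) (φ ψ : E3 → ℝ) : Fq v φ ψ = Fq v ψ φ := by
  funext x
  rw [Fq_eq, Fq_eq, aF_symm (Hx_symm hv x)]

lemma Fq_hcs {v φ ψ : E3 → ℝ} (hc : HasCompactSupport φ) : HasCompactSupport (Fq v φ ψ) := by
  refine HasCompactSupport.of_support_subset_isCompact hc ?_
  intro x hx
  by_contra hn
  apply hx
  have : ∀ i, pd i φ x = 0 := fun i =>
    image_eq_zero_of_notMem_tsupport fun h => hn (pd_tsupport _ _ h)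
  simp [Fq, this]

lemma Lop_hcs {v φ : E3 → ℝ} (hc : HasCompactSupport φ) : HasCompactSupport (Lop v φ) := by
  refine HasCompactSupport.of_support_subset_isCompact hc ?_
  intro x hx
  by_contra hn
  apply hx
  have : ∀ i j, pd i (pd j φ) x = 0 := fun i j =>
    image_eq_zero_of_notMem_tsupport fun h => hn (pd_tsupport _ _ (pd_tsupport _ _ h))
  simp [Lop, this]

lemma int_Lop {v φ ψ : E3 → ℝ} (hv : ContDiff ℝ ∞ v) (hφ : ContDiff ℝ ∞ φ)
    (hψ : ContDiff ℝ ∞ ψ) (hc : HasCompactSupport φ) :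
    ∫ x, (φ x * Lop v ψ x + Fq v φ ψ x) = 0 := by
  have i1 : Integrable (fun x => φ x * Lop v ψ x) :=
    cs_integrable (hφ.continuous.mul (Lop_cont hv hψ)) hc.mul_right
  rw [integral_add i1 (cs_integrable (Fq_cont hv hφ hψ) (Fq_hcs hc)), Lop_ibp hv hφ hψ (Or.inl hc)]
  ring

lemma int_selfadj {v φ ψ : E3 → ℝ} (hv : ContDiff ℝ ∞ v) (hφ : ContDiff ℝ ∞ φ)
    (hψ : ContDiff ℝ ∞ ψ) (hc : HasCompactSupport φ) :
    ∫ x, (φ x * Lop v ψ x - ψ x * Lop v φ x) = 0 := by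
  have i1 : Integrable (fun x => φ x * Lop v ψ x) :=
    cs_integrable (hφ.continuous.mul (Lop_cont hv hψ)) hc.mul_right
  have i2 : Integrable (fun x => ψ x * Lop v φ x) :=
    cs_integrable (hψ.continuous.mul (Lop_cont hv hφ)) (Lop_hcs hc).mul_left
  rw [integral_sub i1 i2,
    Lop_ibp hv hφ hψ (Or.inl hc), Lop_ibp hv hψ hφ (Or.inr hc), Fq_symm hv φ ψ]
  ring

section

variable {K : ℝ} {f : E3 × ℝ × E3 → ℝ} {v b : E3 → ℝ}

lemma GH.Fm_abs (h : GH K f v) {x : E3} (hx : x ∈ ball (0 : E3) 9) (i j : Fin 3) :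
    |Fm v i j x| ≤ 2 * S v x := by
  have h1 := h.entry hx i j
  have hp := h.pos x hx
  unfold Fm
  refine (abs_sub _ _).trans ?_
  split_ifs
  · rw [abs_of_pos hp]; linarith
  · rw [abs_zero]; linarith

lemma GH.Lop_abs (h : GH K f v) {x : E3} (hx : x ∈ ball (0 : E3) 9) {φ : E3 → ℝ} {M : ℝ}
    (hM : ∀ i j, |pd i (pd j φ) x| ≤ M) : |Lop v φ x| ≤ 18 * M * S v x := by
  have hp := h.pos x hx
  unfold Lop
  refine (Finset.abs_sum_le_sum_abs _ _).trans ?_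
  have : ∀ i ∈ (Finset.univ : Finset (Fin 3)),
      |∑ j, Fm v i j x * pd i (pd j φ) x| ≤ 6 * M * S v x := by
    intro i _
    refine (Finset.abs_sum_le_sum_abs _ _).trans ?_
    have : ∀ j ∈ (Finset.univ : Finset (Fin 3)),
      |Fm v i j x * pd i (pd j φ) x| ≤ 2 * S v x * M := by
      intro j _
      rw [abs_mul]
      exact mul_le_mul (h.Fm_abs hx i j) (hM i j) (abs_nonneg _) (by linarith)
    refine (Finset.sum_le_sum this).trans (le_of_eq ?_)
    simp
    ring
  refine (Finset.sum_le_sum this).trans (le_of_eq ?_)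
  simp
  ring

lemma GH.Fq_nonneg (h : GH K f v) {x : E3} (hx : x ∈ ball (0 : E3) 9) (φ : E3 → ℝ) :
    0 ≤ Fq v φ φ x := aF_nonneg (Hx_symm h.sm x) (h.pos x hx) (h.G_pos hx) _

lemma GH.Fq_cauchy (h : GH K f v) {x : E3} (hx : x ∈ ball (0 : E3) 9) (φ ψ : E3 → ℝ) {t : ℝ}
    (ht : 0 < t) : 2 * |Fq v φ ψ x| ≤ t * Fq v φ φ x + t⁻¹ * Fq v ψ ψ x :=
  aF_cauchy (Hx_symm h.sm x) (h.pos x hx) (h.G_pos hx) _ _ ht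

lemma GH.Fq_abs (h : GH K f v) {x : E3} (hx : x ∈ ball (0 : E3) 9) {φ : E3 → ℝ} {M : ℝ}
    (hM : ∀ i, |pd i φ x| ≤ M) : Fq v φ φ x ≤ 6 * M ^ 2 * S v x := by
  have h1 := aF_upper (Hx_symm h.sm x) (h.pos x hx) (h.G_pos hx) (dg φ x)
  have hp := h.pos x hx
  have h2 : nsq (dg φ x) ≤ 3 * M ^ 2 := by
    have : ∀ k ∈ (Finset.univ : Finset (Fin 3)), dg φ x k ^ 2 ≤ M ^ 2 := by
      intro k _
      have := hM k
      rw [sq_le_sq]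
      exact this.trans (le_abs_self _)
    refine (Finset.sum_le_sum this).trans (by simp)
  rw [Fq_eq]
  rw [← S_eq] at h1
  nlinarith

lemma dot_abs {a c : Fin 3 → ℝ} {A C : ℝ} (ha : ∀ i, |a i| ≤ A) (hc : ∀ i, |c i| ≤ C) :
    |∑ i, a i * c i| ≤ 3 * (A * C) := by
  refine (Finset.abs_sum_le_sum_abs _ _).trans ?_
  have : ∀ i ∈ (Finset.univ : Finset (Fin 3)), |a i * c i| ≤ A * C := by
    intro i _
    rw [abs_mul]
    exact mul_le_mul (ha i) (hc i) (abs_nonneg _) ((abs_nonneg _).trans (ha i))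
  exact (Finset.sum_le_sum this).trans (by simp)

lemma coord_le_sqrt (ξ : Fin 3 → ℝ) (i : Fin 3) : |ξ i| ≤ √(nsq ξ) := by
  apply Real.abs_le_sqrt
  exact Finset.single_le_sum (f := fun i => ξ i ^ 2) (fun i _ => sq_nonneg _) (Finset.mem_univ i)

end

/-- Integral bound for `Δu`. -/
lemma est1 {K : ℝ} : ∃ C, 0 ≤ C ∧ ∀ f v, GH K f v → ∫ x in ball (0 : E3) 7, S v x ≤ C := by
  obtain ⟨φ, M, c⟩ := exists_cut (r := 7) (by norm_num)
  refine ⟨|∫ x in ball (0 : E3) (7 + 1), 3 * (M * K)|, abs_nonneg _, fun f v h => le_trans ?_ (le_abs_self _)⟩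
  have hs := fun i => pd_smooth h.sm i
  refine master (p := fun x => ∑ i, (φ x * pd i (pd i v) x + pd i φ x * pd i v x))
    (q := S v) (w := fun _ => 3 * (M * K)) ?_ (S_smooth h.sm).continuous continuous_const (by norm_num) ?_ ?_ ?_
    (int_div c.sm c.cs hs)
  · exact continuous_finsetSum _ fun i _ => (c.sm.continuous.mul (pd_smooth (hs i) i).continuous).add
      ((pd_smooth c.sm i).continuous.mul (hs i).continuous)
  · intro x hx
    simp [c.z0 x hx, c.z1 x hx]
  · intro x hx
    have hx9 : x ∈ ball (0 : E3) 9 := ball_subset_ball (by norm_num) hx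
    have a := (abs_le.1 (dot_abs (c.b1 x) (h.pdv hx9))).1
    have e : φ x * S v x = ∑ i, φ x * pd i (pd i v) x := by simp only [S, Finset.mul_sum, hh]
    simp only [Finset.sum_add_distrib]
    rw [← e]
    have := mul_nonneg (c.nn x) (h.pos x hx9).le
    linarith
  · intro x hx
    have hx9 : x ∈ ball (0 : E3) 9 := ball_subset_ball (by norm_num) hx
    have a := (abs_le.1 (dot_abs (c.b1 x) (h.pdv hx9))).1
    have e : φ x * S v x = ∑ i, φ x * pd i (pd i v) x := by simp only [S, Finset.mul_sum, hh]
    simp only [Finset.sum_add_distrib]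
    rw [← e, c.one x hx]
    linarith

lemma Fq_sq {v φ b : E3 → ℝ} (hφ : ContDiff ℝ ∞ φ) (x : E3) :
    Fq v (fun x => φ x * φ x) b x = 2 * φ x * Fq v φ b x := by
  simp only [Fq, Finset.mul_sum]
  refine Finset.sum_congr rfl fun i _ => Finset.sum_congr rfl fun j _ => ?_
  rw [pd_mul hφ hφ]
  ring

lemma Fq_mul {v φ b ψ : E3 → ℝ} (hφ : ContDiff ℝ ∞ φ) (hb : ContDiff ℝ ∞ b) (x : E3) :
    Fq v (fun x => φ x * b x) ψ x = φ x * Fq v b ψ x + b x * Fq v φ ψ x := by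
  simp only [Fq, Finset.mul_sum, ← Finset.sum_add_distrib]
  refine Finset.sum_congr rfl fun i _ => Finset.sum_congr rfl fun j _ => ?_
  rw [pd_mul hφ hb]
  ring

lemma Fq_zero {v φ ψ : E3 → ℝ} {x : E3} (h : ∀ i, pd i φ x = 0) : Fq v φ ψ x = 0 := by
  simp [Fq, h]

lemma Lop_zero {v φ : E3 → ℝ} {x : E3} (h : ∀ i j, pd i (pd j φ) x = 0) : Lop v φ x = 0 := by
  simp [Lop, h]

/-- Integral bound for `F(Db,Db)`. -/
lemma est2 {K : ℝ} : ∃ C, 0 ≤ C ∧ ∀ f v b, BH K f v b → ∫ x in ball (0 : E3) 6, Fq v b b x ≤ C := by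
  obtain ⟨φ, M, c⟩ := exists_cut (r := 6) (by norm_num)
  obtain ⟨C1, hC1, e1⟩ := est1 (K := K)
  set A := 48 * (48 * (6 * M ^ 2) + 340 * K ^ 7) with hA
  refine ⟨|A| * C1, by positivity, fun f v b h => ?_⟩
  have hsm := h.gh.sm
  have sq : ContDiff ℝ ∞ (fun x => φ x * φ x) := c.sm.mul c.sm
  have Ac : 0 ≤ A := by have := h.gh.hK; have := c.Mp; positivity
  have pt : ∀ x ∈ ball (0 : E3) 8, φ x * φ x * Fq v b b x ≤
      48 * (φ x * φ x * Lop v b x + Fq v (fun x => φ x * φ x) b x) + A * S v x := by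
    intro x hx8
    have hx9 := mem89 hx8
    rw [Fq_sq c.sm]
    have j := h.jacobi hx8
    have n := c.nn x
    have l := c.le1 x
    have hp := h.gh.pos x hx9
    have ff := h.gh.Fq_abs hx9 (c.b1 x)
    have ca : - (2 * φ x * Fq v φ b x) ≤ 1 / 48 * (φ x * φ x * Fq v b b x) + 48 * Fq v φ φ x := by
      have h0 := aF_nonneg (Hx_symm hsm x) hp (h.gh.G_pos hx9)
        (fun i => 48 * dg φ x i + φ x * dg b x i)
      rw [aF_lin (Hx_symm hsm x), ← Fq_eq, ← Fq_eq, ← Fq_eq] at h0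
      linarith
    have jj := mul_le_mul_of_nonneg_left j (mul_nonneg n n)
    have k7 : 0 ≤ 340 * K ^ 7 * S v x := by have := h.gh.hK; positivity
    have l2 : φ x * φ x ≤ 1 := by nlinarith
    have k8 := mul_le_mul_of_nonneg_right l2 k7
    rw [hA]
    linarith
  have key : ∫ x in ball (0 : E3) 6, Fq v b b x ≤ ∫ x in ball (0 : E3) (6 + 1), A * S v x := by
    refine master (p := fun x => 48 * (φ x * φ x * Lop v b x + Fq v (fun x => φ x * φ x) b x))
      (w := fun x => A * S v x)
      ?_ (Fq_cont hsm h.bs h.bs) (continuous_const.mul (S_smooth hsm).continuous)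
      (by norm_num) ?_ ?_ ?_ ?_
    · exact continuous_const.mul ((sq.continuous.mul (Lop_cont hsm h.bs)).add (Fq_cont hsm sq h.bs))
    · intro x hx
      rw [Fq_sq c.sm]
      simp [c.z0 x hx]
    · intro x hx
      have hx8 : x ∈ ball (0 : E3) 8 := ball_subset_ball (by norm_num) hx
      have := pt x hx8
      have := h.gh.Fq_nonneg (mem89 hx8) b
      have : 0 ≤ φ x * φ x * Fq v b b x := mul_nonneg (mul_self_nonneg _) this
      linarith
    · intro x hx
      have := pt x (ball_subset_ball (by norm_num) hx)
      rw [c.one x hx] at *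
      linarith
    · rw [integral_const_mul, int_Lop hsm sq h.bs c.cs.mul_right, mul_zero]
  refine key.trans ?_
  rw [integral_const_mul, abs_of_nonneg Ac]
  refine mul_le_mul_of_nonneg_left ?_ Ac
  norm_num
  exact e1 f v h.gh

/-- `|Dv - p|²`. -/
def Q (v : E3 → ℝ) (p : Fin 3 → ℝ) (x : E3) : ℝ := ∑ k, (pd k v x - p k) * (pd k v x - p k)

section

variable {K : ℝ} {f : E3 × ℝ × E3 → ℝ} {v b : E3 → ℝ}

lemma Q_smooth (hv : ContDiff ℝ ∞ v) (p : Fin 3 → ℝ) : ContDiff ℝ ∞ (Q v p) :=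
  ContDiff.sum fun k _ => ((pd_smooth hv k).sub contDiff_const).mul ((pd_smooth hv k).sub contDiff_const)

lemma pd_subc (hv : ContDiff ℝ ∞ v) (c : ℝ) (i : Fin 3) :
    pd i (fun x => v x - c) = pd i v := by
  rw [pd_sub hv contDiff_const, pd_const]
  simp

lemma pd_Q (hv : ContDiff ℝ ∞ v) (p : Fin 3 → ℝ) (j : Fin 3) :
    pd j (Q v p) = fun x => 2 * ∑ k, (pd k v x - p k) * hh v j k x := by
  have s : ∀ k, ContDiff ℝ ∞ (fun x => pd k v x - p k) := fun k => (pd_smooth hv k).sub contDiff_const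
  unfold Q
  rw [pd_sum _ (fun k => (s k).mul (s k))]
  funext x
  rw [Finset.mul_sum]
  refine Finset.sum_congr rfl fun k _ => ?_
  rw [pd_mul (s k) (s k), pd_subc (pd_smooth hv k)]
  simp only [hh]
  ring

lemma pd_pd_Q (hv : ContDiff ℝ ∞ v) (p : Fin 3 → ℝ) (i j : Fin 3) (x : E3) :
    pd i (pd j (Q v p)) x = 2 * ∑ k, (hh v k i x * hh v k j x
      + (pd k v x - p k) * pd k (hh v i j) x) := by
  have s : ∀ k, ContDiff ℝ ∞ (fun x => pd k v x - p k) := fun k => (pd_smooth hv k).sub contDiff_const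
  have s2 : ∀ k, ContDiff ℝ ∞ (fun x => (pd k v x - p k) * hh v j k x) := fun k =>
    (s k).mul (hh_smooth hv j k)
  rw [pd_Q hv, pd_cmul (ContDiff.sum fun k _ => s2 k), pd_sum _ s2]
  simp only
  congr 1
  refine Finset.sum_congr rfl fun k _ => ?_
  rw [pd_mul (s k) (hh_smooth hv j k), pd_subc (pd_smooth hv k), hh_symm hv j k,
    pd_hh_symm hv k j i]
  simp only
  rw [show pd i (pd k v) x = hh v i k x from rfl, hh_symm hv i k]
  ring

lemma Lop_Q (hv : ContDiff ℝ ∞ v) (p : Fin 3 → ℝ) (x : E3) :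
    Lop v (Q v p) x = 6 * V v x - 4 * G v x * S v x + 2 * ∑ k, (pd k v x - p k) * pd k (G v) x := by
  have e := aV_identity (Hx_symm hv x)
  have e1 : Lop v (Q v p) x = 2 * ∑ k, aF (Hx v x) (Hx v x k) (Hx v x k)
      + 2 * ∑ k, (pd k v x - p k) * pd k (G v) x := by
    rw [← mul_add, ← Finset.sum_add_distrib]
    simp only [Lop, pd_pd_Q hv, pd_G hv, aF, Hx, ← S_eq, Finset.mul_sum, ← Finset.sum_add_distrib]
    rw [Finset.sum_comm' (t' := Finset.univ) (s' := fun _ => Finset.univ) (by simp)]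
    simp only [Fin.sum_univ_three, Fm]
    simp only [S, Fin.sum_univ_three]
    ring
  rw [e1]
  change 3 * V v x = 2 * G v x * S v x + _ at e
  linarith

end

section

variable {K : ℝ} {f : E3 × ℝ × E3 → ℝ} {v b : E3 → ℝ}

lemma GH.FQQ (h : GH K f v) {x : E3} (hx : x ∈ ball (0 : E3) 9) (p : Fin 3 → ℝ) :
    Fq v (Q v p) (Q v p) x ≤ 4 * V v x * Q v p x := by
  have e := aV_split (Hx_symm h.sm x) (fun _ => 0) (fun k => pd k v x - p k)
  have e1 : Fq v (Q v p) (Q v p) x = 4 * aF (Hx v x)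
      (fun i => aG (Hx v x) * 0 + ∑ k, Hx v x i k * (pd k v x - p k))
      (fun i => aG (Hx v x) * 0 + ∑ k, Hx v x i k * (pd k v x - p k)) := by
    simp only [Fq, pd_Q h.sm, aF, Finset.mul_sum, Hx, ← S_eq, mul_zero, zero_add]
    refine Finset.sum_congr rfl fun i _ => Finset.sum_congr rfl fun j _ => ?_
    simp only [Fin.sum_univ_three, Fm]
    simp only [S_eq]
    ring
  have e2 : nsq (fun k => pd k v x - p k) = Q v p x := by
    simp only [nsq, Q, sq]
  have e3 : nsq (fun _ => (0 : ℝ)) = 0 := by simp [nsq]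
  rw [e2, e3] at e
  have n := aF_nonneg (Hx_symm h.sm x) (h.pos x hx) (h.G_pos hx)
    (fun i => ∑ k, Hx v x i k * 0 - (pd i v x - p i))
  have g := h.G_pos hx
  have := mul_nonneg g.le n
  rw [e1]
  change V v x * _ = _ + G v x * _ at e
  linarith

lemma GH.Q0_le (h : GH K f v) {x : E3} (hx : x ∈ ball (0 : E3) 9) :
    0 ≤ Q v (fun _ => 0) x ∧ Q v (fun _ => 0) x ≤ K ^ 2 := by
  constructor
  · exact Finset.sum_nonneg fun k _ => mul_self_nonneg _
  · have e : Q v (fun _ => 0) x = ‖grad v x‖ ^ 2 := by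
      rw [norm_sq_grad]; simp [Q, nsq, dg, sq]
    rw [e]
    have := h.bd x hx
    have := abs_nonneg (v x)
    exact pow_le_pow_left₀ (norm_nonneg _) (by linarith) 2

lemma GH.LQ0 (h : GH K f v) {x : E3} (hx : x ∈ ball (0 : E3) 9) :
    6 * V v x - (4 * K + 6 * K ^ 4) * S v x ≤ Lop v (Q v (fun _ => 0)) x := by
  rw [Lop_Q h.sm]
  have a := (abs_le.1 (dot_abs (h.pdv hx) (h.pdG hx))).1
  have hp := h.pos x hx
  have gu := h.G_upper hx
  simp only [sub_zero]
  have := mul_le_mul_of_nonneg_right gu hp.le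
  linarith

end

lemma ball_int_mono {q : E3 → ℝ} (hq : Continuous q) {r R : ℝ} (hrR : r ≤ R)
    (h : ∀ x ∈ ball (0 : E3) R, 0 ≤ q x) :
    ∫ x in ball (0 : E3) r, q x ≤ ∫ x in ball (0 : E3) R, q x := by
  refine setIntegral_mono_set (cont_intOn hq R) ?_ ?_
  · exact (ae_restrict_iff' measurableSet_ball).2 (Filter.Eventually.of_forall h)
  · exact (ball_subset_ball hrR).eventuallyLE

/-- Integral bound for `b Δu`. -/
lemma est3 {K : ℝ} : ∃ C, 0 ≤ C ∧ ∀ f v b, BH K f v b →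
    ∫ x in ball (0 : E3) 5, b x * S v x ≤ C := by
  obtain ⟨φ, M, c⟩ := exists_cut (r := 5) (by norm_num)
  obtain ⟨C1, hC1, e1⟩ := est1 (K := K)
  obtain ⟨C2, hC2, e2⟩ := est2 (K := K)
  set A := 3 * K ^ 2 + 3 * M * K ^ 2 with hA
  refine ⟨|3 * K| * C2 + |A| * C1, by positivity, fun f v b h => ?_⟩
  have hsm := h.gh.sm
  have hK := h.gh.hK
  have Ac : 0 ≤ A := by have := c.Mp; positivity
  have hs := fun i => pd_smooth hsm i
  have Ys : ∀ i, ContDiff ℝ ∞ (fun x => b x * pd i v x) := fun i => h.bs.mul (hs i)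
  have pt : ∀ x ∈ ball (0 : E3) 8, φ x * (b x * S v x) ≤
      ∑ i, (φ x * pd i (fun x => b x * pd i v x) x + pd i φ x * (b x * pd i v x))
        + (3 * K * Fq v b b x + A * S v x) := by
    intro x hx8
    have hx9 := mem89 hx8
    have n := c.nn x
    have l := c.le1 x
    have hp := h.gh.pos x hx9
    have e : ∑ i, (φ x * pd i (fun x => b x * pd i v x) x + pd i φ x * (b x * pd i v x))
        = φ x * (b x * S v x) + φ x * ∑ i, pd i b x * pd i v x + b x * ∑ i, pd i φ x * pd i v x := by
      simp only [S, Finset.mul_sum, ← Finset.sum_add_distrib]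
      refine Finset.sum_congr rfl fun i _ => ?_
      rw [pd_mul h.bs (hs i)]
      simp only [hh]
      ring
    rw [e]
    have d1 := dot_abs (coord_le_sqrt (dg b x)) (h.gh.pdv hx9)
    have d2 := dot_abs (c.b1 x) (h.gh.pdv hx9)
    have sg := h.gh.sqrt_grad hx9 (dg b x) (t := 1) one_pos
    rw [← Fq_eq] at sg
    have b0 := h.b_nonneg hx8
    have b1 := h.b_le hx8
    have t1 : -(3 * (√(nsq (dg b x)) * K)) ≤ φ x * ∑ i, pd i b x * pd i v x := by
      refine (abs_le.1 ?_).1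
      rw [abs_mul, abs_of_nonneg n]
      exact (mul_le_of_le_one_left (abs_nonneg _) l).trans d1
    have t2 : -(b x * (3 * (M * K))) ≤ b x * ∑ i, pd i φ x * pd i v x := by
      refine (abs_le.1 ?_).1
      rw [abs_mul, abs_of_nonneg b0]
      exact mul_le_mul_of_nonneg_left d2 b0
    have t3 : b x * (3 * (M * K)) ≤ K * S v x * (3 * (M * K)) :=
      mul_le_mul_of_nonneg_right b1 (by have := c.Mp; positivity)
    have t4 : √(nsq (dg b x)) * K ≤ (1 * Fq v b b x + K * S v x / (4 * 1)) * K :=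
      mul_le_mul_of_nonneg_right sg (by linarith)
    have t5 : 0 ≤ K ^ 2 * S v x := by positivity
    rw [hA]
    linarith
  have key : ∫ x in ball (0 : E3) 5, b x * S v x ≤
      ∫ x in ball (0 : E3) (5 + 1), (3 * K * Fq v b b x + A * S v x) := by
    refine master (p := fun x => ∑ i, (φ x * pd i (fun x => b x * pd i v x) x
        + pd i φ x * (b x * pd i v x)))
      (q := fun x => b x * S v x) (w := fun x => 3 * K * Fq v b b x + A * S v x)
      ?_ (h.bs.continuous.mul (S_smooth hsm).continuous)
      ((continuous_const.mul (Fq_cont hsm h.bs h.bs)).add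
        (continuous_const.mul (S_smooth hsm).continuous))
      (by norm_num) ?_ ?_ ?_ (int_div c.sm c.cs Ys)
    · exact continuous_finsetSum _ fun i _ => (c.sm.continuous.mul (pd_smooth (Ys i) i).continuous).add
        ((pd_smooth c.sm i).continuous.mul (Ys i).continuous)
    · intro x hx
      simp [c.z0 x hx, c.z1 x hx]
    · intro x hx
      have hx8 : x ∈ ball (0 : E3) 8 := ball_subset_ball (by norm_num) hx
      have := pt x hx8
      have : 0 ≤ φ x * (b x * S v x) := mul_nonneg (c.nn x)
        (mul_nonneg (h.b_nonneg hx8) (h.gh.pos x (mem89 hx8)).le)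
      linarith
    · intro x hx
      have := pt x (ball_subset_ball (by norm_num) hx)
      rw [c.one x hx, one_mul] at this
      rwa [c.one x hx]
  refine key.trans ?_
  have cF := Fq_cont hsm h.bs h.bs
  have cS := (S_smooth hsm).continuous
  have i1 : IntegrableOn (fun x => 3 * K * Fq v b b x) (ball (0 : E3) (5 + 1)) :=
    cont_intOn (continuous_const.mul cF) _
  have i2 : IntegrableOn (fun x => A * S v x) (ball (0 : E3) (5 + 1)) :=
    cont_intOn (continuous_const.mul cS) _
  rw [integral_add i1 i2,
    integral_const_mul, integral_const_mul, abs_of_nonneg Ac, abs_of_nonneg (by positivity)]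
  norm_num
  refine add_le_add (mul_le_mul_of_nonneg_left (e2 f v b h) (by positivity))
    (mul_le_mul_of_nonneg_left ?_ Ac)
  exact (ball_int_mono cS (by norm_num) (fun x hx => (h.gh.pos x (ball_subset_ball (by norm_num) hx)).le)).trans
    (e1 f v h.gh)

/-- Integral bound for `V`. -/
lemma est4 {K : ℝ} : ∃ C, 0 ≤ C ∧ ∀ f v, GH K f v → ∫ x in ball (0 : E3) 6, V v x ≤ C := by
  obtain ⟨φ, M, c⟩ := exists_cut (r := 6) (by norm_num)
  obtain ⟨C1, hC1, e1⟩ := est1 (K := K)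
  set A := 4 * K + 6 * K ^ 4 + 18 * M * K ^ 2 with hA
  refine ⟨|A| * C1, by positivity, fun f v h => ?_⟩
  have hsm := h.sm
  have hK := h.hK
  have Ac : 0 ≤ A := by have := c.Mp; positivity
  have Qs := Q_smooth hsm (fun _ => 0)
  have cS := (S_smooth hsm).continuous
  have pt : ∀ x ∈ ball (0 : E3) 9, φ x * V v x ≤
      (φ x * Lop v (Q v (fun _ => 0)) x - Q v (fun _ => 0) x * Lop v φ x) + A * S v x := by
    intro x hx9
    have n := c.nn x
    have l := c.le1 x
    have hp := h.pos x hx9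
    have Vp := h.V_pos hx9
    have a := mul_le_mul_of_nonneg_left (h.LQ0 hx9) n
    obtain ⟨q0, q1⟩ := h.Q0_le hx9
    have t1 := h.Lop_abs hx9 (c.b2 x)
    have t2 : Q v (fun _ => 0) x * Lop v φ x ≤ K ^ 2 * (18 * M * S v x) := by
      refine (le_abs_self _).trans ?_
      rw [abs_mul, abs_of_nonneg q0]
      exact mul_le_mul q1 t1 (abs_nonneg _) (by positivity)
    have t3 : φ x * ((4 * K + 6 * K ^ 4) * S v x) ≤ (4 * K + 6 * K ^ 4) * S v x :=
      mul_le_of_le_one_left (by positivity) l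
    have t4 := mul_nonneg n Vp.le
    rw [hA]
    linarith
  have key : ∫ x in ball (0 : E3) 6, V v x ≤ ∫ x in ball (0 : E3) (6 + 1), A * S v x := by
    refine master (p := fun x => φ x * Lop v (Q v (fun _ => 0)) x - Q v (fun _ => 0) x * Lop v φ x)
      (w := fun x => A * S v x)
      ?_ (V_smooth hsm).continuous (continuous_const.mul cS)
      (by norm_num) ?_ ?_ ?_ (int_selfadj hsm c.sm Qs c.cs)
    · exact (c.sm.continuous.mul (Lop_cont hsm Qs)).sub (Qs.continuous.mul (Lop_cont hsm c.sm))
    · intro x hx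
      simp [c.z0 x hx, Lop_zero (c.z2 x hx)]
    · intro x hx
      have hx9 : x ∈ ball (0 : E3) 9 := ball_subset_ball (by norm_num) hx
      have := pt x hx9
      have : 0 ≤ φ x * V v x := mul_nonneg (c.nn x) (h.V_pos hx9).le
      linarith
    · intro x hx
      have := pt x (ball_subset_ball (by norm_num) hx)
      rw [c.one x hx, one_mul] at this
      rwa [c.one x hx]
  refine key.trans ?_
  rw [integral_const_mul, abs_of_nonneg Ac]
  refine mul_le_mul_of_nonneg_left ?_ Ac
  norm_num
  exact e1 f v h

/-- Integral bound for `b V`. -/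
lemma est5 {K : ℝ} : ∃ C, 0 ≤ C ∧ ∀ f v b, BH K f v b →
    ∫ x in ball (0 : E3) 4, b x * V v x ≤ C := by
  obtain ⟨φ, M, c⟩ := exists_cut (r := 4) (by norm_num)
  obtain ⟨C2, hC2, e2⟩ := est2 (K := K)
  obtain ⟨C3, hC3, e3⟩ := est3 (K := K)
  obtain ⟨C4, hC4, e4⟩ := est4 (K := K)
  set A := 4 * K + 6 * K ^ 4 + 24 * K ^ 2 * M ^ 2 with hA
  refine ⟨|A| * C3 + (1 / 2 * C2 + 2 * K ^ 2 * C4), by positivity, fun f v b h => ?_⟩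
  have hsm := h.gh.sm
  have hK := h.gh.hK
  have Ac : 0 ≤ A := by have := c.Mp; positivity
  have Qs := Q_smooth hsm (fun _ => 0)
  have cS := (S_smooth hsm).continuous
  have cF := Fq_cont hsm h.bs h.bs
  have cV := (V_smooth hsm).continuous
  have sq : ContDiff ℝ ∞ (fun x => φ x * φ x) := c.sm.mul c.sm
  have tes : ContDiff ℝ ∞ (fun x => φ x * φ x * b x) := sq.mul h.bs
  have eF : ∀ x, Fq v (fun x => φ x * φ x * b x) (Q v (fun _ => 0)) x =
      φ x * φ x * Fq v b (Q v (fun _ => 0)) x + b x * (2 * φ x * Fq v φ (Q v (fun _ => 0)) x) := by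
    intro x
    rw [Fq_mul sq h.bs, Fq_sq c.sm]
  have pt : ∀ x ∈ ball (0 : E3) 8, φ x * φ x * (b x * V v x) ≤
      (φ x * φ x * b x * Lop v (Q v (fun _ => 0)) x + Fq v (fun x => φ x * φ x * b x) (Q v (fun _ => 0)) x)
       + (A * (b x * S v x) + (1 / 2 * Fq v b b x + 2 * K ^ 2 * V v x)) := by
    intro x hx8
    have hx9 := mem89 hx8
    have n := c.nn x
    have l := c.le1 x
    have hp := h.gh.pos x hx9
    have Vp := h.gh.V_pos hx9
    have b0 := h.b_nonneg hx8
    have n2 := mul_nonneg n n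
    have l2 : φ x * φ x ≤ 1 := by nlinarith
    rw [eF]
    have a := mul_le_mul_of_nonneg_left (h.gh.LQ0 hx9) (mul_nonneg n2 b0)
    obtain ⟨q0, q1⟩ := h.gh.Q0_le hx9
    have FQ : Fq v (Q v (fun _ => 0)) (Q v (fun _ => 0)) x ≤ 4 * K ^ 2 * V v x := by
      refine (h.gh.FQQ hx9 _).trans ?_
      nlinarith
    have t3 : φ x * φ x * (b x * ((4 * K + 6 * K ^ 4) * S v x)) ≤ b x * ((4 * K + 6 * K ^ 4) * S v x) :=
      mul_le_of_le_one_left (by positivity) l2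
    have c1 := h.gh.Fq_cauchy hx9 b (Q v (fun _ => 0)) one_pos
    have t4 : -(1 / 2 * Fq v b b x + 2 * K ^ 2 * V v x) ≤ φ x * φ x * Fq v b (Q v (fun _ => 0)) x := by
      refine (abs_le.1 ?_).1
      rw [abs_mul, abs_of_nonneg n2]
      refine (mul_le_of_le_one_left (abs_nonneg _) l2).trans ?_
      rw [inv_one] at c1
      linarith
    have ff := h.gh.Fq_abs hx9 (c.b1 x)
    have t5 : -(24 * K ^ 2 * M ^ 2 * S v x + φ x * φ x * V v x) ≤
        2 * φ x * Fq v φ (Q v (fun _ => 0)) x := by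
      have h0 := aF_nonneg (Hx_symm hsm x) hp (h.gh.G_pos hx9)
        (fun i => (4 * K ^ 2) * dg φ x i + φ x * dg (Q v (fun _ => 0)) x i)
      rw [aF_lin (Hx_symm hsm x), ← Fq_eq, ← Fq_eq, ← Fq_eq] at h0
      have f1 := mul_le_mul_of_nonneg_left FQ n2
      have f2 := mul_le_mul_of_nonneg_left ff (sq_nonneg (4 * K ^ 2))
      have k0 : 0 < 4 * K ^ 2 := by positivity
      refine le_of_mul_le_mul_left ?_ k0
      linarith
    have t6 := mul_le_mul_of_nonneg_left t5 b0
    have t7 : 0 ≤ φ x * φ x * (b x * V v x) := by positivity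
    rw [hA]
    linarith
  have key : ∫ x in ball (0 : E3) 4, b x * V v x ≤ ∫ x in ball (0 : E3) (4 + 1),
      (A * (b x * S v x) + (1 / 2 * Fq v b b x + 2 * K ^ 2 * V v x)) := by
    refine master (p := fun x => φ x * φ x * b x * Lop v (Q v (fun _ => 0)) x
        + Fq v (fun x => φ x * φ x * b x) (Q v (fun _ => 0)) x)
      (q := fun x => b x * V v x)
      (w := fun x => A * (b x * S v x) + (1 / 2 * Fq v b b x + 2 * K ^ 2 * V v x))
      ?_ (h.bs.continuous.mul cV) ?_
      (by norm_num) ?_ ?_ ?_ (int_Lop hsm tes Qs c.cs.mul_right.mul_right)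
    · exact (tes.continuous.mul (Lop_cont hsm Qs)).add (Fq_cont hsm tes Qs)
    · exact (continuous_const.mul (h.bs.continuous.mul cS)).add
        ((continuous_const.mul cF).add (continuous_const.mul cV))
    · intro x hx
      simp only [eF]
      simp [c.z0 x hx]
    · intro x hx
      have hx8 : x ∈ ball (0 : E3) 8 := ball_subset_ball (by norm_num) hx
      have := pt x hx8
      have : 0 ≤ φ x * φ x * (b x * V v x) := mul_nonneg (mul_self_nonneg _)
        (mul_nonneg (h.b_nonneg hx8) (h.gh.V_pos (mem89 hx8)).le)
      linarith
    · intro x hx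
      have := pt x (ball_subset_ball (by norm_num) hx)
      rw [c.one x hx] at this
      rw [c.one x hx]
      linarith
  refine key.trans ?_
  have i1 : IntegrableOn (fun x => A * (b x * S v x)) (ball (0 : E3) (4 + 1)) :=
    cont_intOn (continuous_const.mul (h.bs.continuous.mul cS)) _
  have i2 : IntegrableOn (fun x => 1 / 2 * Fq v b b x) (ball (0 : E3) (4 + 1)) :=
    cont_intOn (continuous_const.mul cF) _
  have i3 : IntegrableOn (fun x => 2 * K ^ 2 * V v x) (ball (0 : E3) (4 + 1)) :=
    cont_intOn (continuous_const.mul cV) _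
  have i4 : IntegrableOn (fun x => 1 / 2 * Fq v b b x + 2 * K ^ 2 * V v x) (ball (0 : E3) (4 + 1)) :=
    i2.add i3
  rw [integral_add i1 i4, integral_add i2 i3, integral_const_mul, integral_const_mul,
    integral_const_mul, abs_of_nonneg Ac]
  have r1 : (4 + 1 : ℝ) = 5 := by norm_num
  rw [r1]
  refine add_le_add (mul_le_mul_of_nonneg_left (e3 f v b h) Ac) (add_le_add
    (mul_le_mul_of_nonneg_left ?_ (by norm_num)) (mul_le_mul_of_nonneg_left ?_ (by positivity)))
  · exact (ball_int_mono cF (by norm_num) (fun x hx => h.gh.Fq_nonneg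
      (ball_subset_ball (by norm_num) hx) b)).trans (e2 f v b h)
  · exact (ball_int_mono cV (by norm_num) (fun x hx => (h.gh.V_pos
      (ball_subset_ball (by norm_num) hx)).le)).trans (e4 f v h.gh)

/-- `|x - x0|²`. -/
def Nq (x0 x : E3) : ℝ := ∑ i, (x i - x0 i) * (x i - x0 i)

/-- The squared Lagrangian graph distance. -/
def sF (v : E3 → ℝ) (x0 x : E3) : ℝ := G v x0 * Nq x0 x + Q v (dg v x0) x

section

variable {K : ℝ} {f : E3 × ℝ × E3 → ℝ} {v b : E3 → ℝ}

lemma Nq_smooth (x0 : E3) : ContDiff ℝ ∞ (Nq x0) :=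
  ContDiff.sum fun i _ => ((coord_smooth i).sub contDiff_const).mul ((coord_smooth i).sub contDiff_const)

lemma Nq_eq (x0 x : E3) : Nq x0 x = ‖x - x0‖ ^ 2 := by
  rw [EuclideanSpace.norm_sq_eq]
  simp [Nq, sq]

lemma pd_Nq (x0 : E3) (j : Fin 3) : pd j (Nq x0) = fun x => 2 * (x j - x0 j) := by
  unfold Nq
  have s : ∀ k, ContDiff ℝ ∞ (fun x : E3 => x k - x0 k) := fun k => (coord_smooth k).sub contDiff_const
  rw [pd_sum _ (fun k => (s k).mul (s k))]
  funext x
  have : ∀ k, pd j (fun x : E3 => (x k - x0 k) * (x k - x0 k)) x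
      = if k = j then 2 * (x k - x0 k) else 0 := by
    intro k
    rw [pd_mul (s k) (s k), pd_subc (coord_smooth k), pd_coord]
    simp only
    split_ifs <;> ring
  simp only [this]
  simp

lemma pd_pd_Nq (x0 : E3) (i j : Fin 3) (x : E3) :
    pd i (pd j (Nq x0)) x = if j = i then 2 else 0 := by
  rw [pd_Nq, pd_cmul ((coord_smooth j).sub contDiff_const), pd_subc (coord_smooth j), pd_coord]
  simp

lemma Lop_Nq (v : E3 → ℝ) (x0 x : E3) : Lop v (Nq x0) x = 4 * S v x := by
  simp only [Lop, pd_pd_Nq, Fm, S, Fin.sum_univ_three]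
  simp
  ring

lemma sF_smooth (hv : ContDiff ℝ ∞ v) (x0 : E3) : ContDiff ℝ ∞ (sF v x0) :=
  (contDiff_const.mul (Nq_smooth x0)).add (Q_smooth hv _)

lemma pd_sF (hv : ContDiff ℝ ∞ v) (x0 : E3) (j : Fin 3) :
    pd j (sF v x0) = fun x => G v x0 * pd j (Nq x0) x + pd j (Q v (dg v x0)) x := by
  unfold sF
  rw [pd_add (contDiff_const.mul (Nq_smooth x0)) (Q_smooth hv _), pd_cmul (Nq_smooth x0)]

lemma Lop_sF (hv : ContDiff ℝ ∞ v) (x0 x : E3) :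
    Lop v (sF v x0) x = 6 * V v x + 4 * (G v x0 - G v x) * S v x
      + 2 * ∑ k, (pd k v x - pd k v x0) * pd k (G v) x := by
  have e : Lop v (sF v x0) x = G v x0 * Lop v (Nq x0) x + Lop v (Q v (dg v x0)) x := by
    simp only [Lop, Finset.mul_sum, ← Finset.sum_add_distrib]
    refine Finset.sum_congr rfl fun i _ => Finset.sum_congr rfl fun j _ => ?_
    rw [pd_sF hv, pd_add (contDiff_const.mul (pd_smooth (Nq_smooth x0) j)) (pd_smooth (Q_smooth hv _) j),
      pd_cmul (pd_smooth (Nq_smooth x0) j)]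
    ring
  rw [e, Lop_Nq, Lop_Q hv]
  simp only [dg]
  ring

lemma Q_nonneg (v : E3 → ℝ) (p : Fin 3 → ℝ) (x : E3) : 0 ≤ Q v p x :=
  Finset.sum_nonneg fun _ _ => mul_self_nonneg _

lemma Nq_nonneg (x0 x : E3) : 0 ≤ Nq x0 x := Finset.sum_nonneg fun _ _ => mul_self_nonneg _

lemma GH.sF_nonneg (h : GH K f v) {x0 : E3} (hx0 : x0 ∈ ball (0 : E3) 9) (x : E3) :
    0 ≤ sF v x0 x :=
  add_nonneg (mul_nonneg (h.G_pos hx0).le (Nq_nonneg _ _)) (Q_nonneg _ _ _)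

lemma GH.Q_le_sF (h : GH K f v) {x0 : E3} (hx0 : x0 ∈ ball (0 : E3) 9) (x : E3) :
    Q v (dg v x0) x ≤ sF v x0 x :=
  le_add_of_nonneg_left (mul_nonneg (h.G_pos hx0).le (Nq_nonneg _ _))

lemma GH.N_le_sF (h : GH K f v) {x0 : E3} (hx0 : x0 ∈ ball (0 : E3) 9) (x : E3) :
    Nq x0 x ≤ K * sF v x0 x := by
  have hK := h.hK
  have h1 := h.G_lower hx0
  have h2 : 1 / K * Nq x0 x ≤ sF v x0 x :=
    (mul_le_mul_of_nonneg_right h1 (Nq_nonneg _ _)).trans (le_add_of_nonneg_right (Q_nonneg _ _ _))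
  have h3 := mul_le_mul_of_nonneg_left h2 (by linarith : 0 ≤ K)
  have e : K * (1 / K * Nq x0 x) = Nq x0 x := by field_simp
  rwa [e] at h3

lemma GH.norm_le (h : GH K f v) {x0 : E3} (hx0 : x0 ∈ ball (0 : E3) 9) (x : E3) :
    ‖x - x0‖ ≤ K * √(sF v x0 x) := by
  have h1 := h.N_le_sF hx0 x
  have hK := h.hK
  have s0 := h.sF_nonneg hx0 x
  rw [Nq_eq] at h1
  have h2 : ‖x - x0‖ ^ 2 ≤ (K * √(sF v x0 x)) ^ 2 := by
    rw [mul_pow, Real.sq_sqrt s0]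
    nlinarith
  exact (le_abs_self _).trans (abs_le_of_sq_le_sq h2 (by positivity))

lemma fderiv_eq_inner (v : E3 → ℝ) (x w : E3) : fderiv ℝ v x w = ∑ i, w i * pd i v x := by
  have e : w = ∑ i, w i • EuclideanSpace.single i (1 : ℝ) := by
    ext j
    simp [Fin.sum_univ_three, Pi.single_apply]
    fin_cases j <;> simp
  conv_lhs => rw [e]
  rw [map_sum]
  simp [pd]

lemma GH.v_lip (h : GH K f v) {x0 x : E3} (hx0 : x0 ∈ ball (0 : E3) 9) (hx : x ∈ ball (0 : E3) 9) :
    |v x - v x0| ≤ K * ‖x - x0‖ := by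
  refine (convex_ball (0 : E3) 9).norm_image_sub_le_of_norm_fderiv_le (𝕜 := ℝ)
    (fun y _ => smooth_diff h.sm y) (fun y hy => ?_) hx0 hx
  have hK := h.hK
  refine ContinuousLinearMap.opNorm_le_bound _ (by linarith) fun w => ?_
  have b := h.bd y hy
  have e : fderiv ℝ v y w = inner ℝ (grad v y) w := by
    rw [fderiv_eq_inner]
    simp [PiLp.inner_apply, grad_apply]
  rw [e]
  refine (norm_inner_le_norm _ _).trans ?_
  have := abs_nonneg (v y)
  exact mul_le_mul_of_nonneg_right (by linarith) (norm_nonneg _)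

lemma GH.G_lip (h : GH K f v) {x0 x : E3} (hx0 : x0 ∈ ball (0 : E3) 9) (hx : x ∈ ball (0 : E3) 9) :
    |G v x - G v x0| ≤ K ^ 3 * √(sF v x0 x) := by
  have hK := h.hK
  have s0 := h.sF_nonneg hx0 x
  have r0 := Real.sqrt_nonneg (sF v x0 x)
  rw [h.eq x hx, h.eq x0 hx0]
  have l := (convex_univ).norm_image_sub_le_of_norm_fderiv_le (𝕜 := ℝ) (f := f) (C := K)
    (fun y _ => (h.fC.differentiable (by simp)) y) (fun y _ => h.f1 y)
    (Set.mem_univ (x0, v x0, grad v x0)) (Set.mem_univ (x, v x, grad v x))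
  refine l.trans ?_
  have n1 := h.norm_le hx0 x
  have n2 := h.v_lip hx0 hx
  have n3 : ‖grad v x - grad v x0‖ ≤ √(sF v x0 x) := by
    refine Real.le_sqrt_of_sq_le ?_
    refine le_trans (le_of_eq ?_) (h.Q_le_sF hx0 x)
    rw [EuclideanSpace.norm_sq_eq]
    simp [Q, grad_apply, dg, sq]
  have c1 : K * √(sF v x0 x) ≤ K ^ 2 * √(sF v x0 x) :=
    mul_le_mul_of_nonneg_right (by nlinarith) r0
  have c2 : √(sF v x0 x) ≤ K * √(sF v x0 x) := by nlinarith
  have : ‖((x, v x, grad v x) : E3 × ℝ × E3) - (x0, v x0, grad v x0)‖ ≤ K ^ 2 * √(sF v x0 x) := by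
    refine max_le (n1.trans c1) (max_le ?_ (n3.trans (c2.trans c1)))
    change |v x - v x0| ≤ _
    refine n2.trans ?_
    calc K * ‖x - x0‖ ≤ K * (K * √(sF v x0 x)) := mul_le_mul_of_nonneg_left n1 (by linarith)
      _ = _ := by ring
  calc _ ≤ K * (K ^ 2 * √(sF v x0 x)) := mul_le_mul_of_nonneg_left this (by linarith)
    _ = _ := by ring

lemma GH.Ls (h : GH K f v) {x0 x : E3} (hx0 : x0 ∈ ball (0 : E3) 9) (hx : x ∈ ball (0 : E3) 9) :
    |Lop v (sF v x0) x - 6 * V v x| ≤ 20 * K ^ 8 * √(sF v x0 x) * V v x := by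
  have hK := h.hK
  have r0 := Real.sqrt_nonneg (sF v x0 x)
  have hp := h.pos x hx
  have Vp := h.V_pos hx
  rw [Lop_sF h.sm]
  have g := h.G_lip hx0 hx
  have d : |∑ k, (pd k v x - pd k v x0) * pd k (G v) x| ≤ 3 * (√(sF v x0 x) * (K ^ 3 * S v x)) := by
    refine dot_abs (fun k => ?_) (h.pdG hx)
    refine Real.abs_le_sqrt ?_
    refine le_trans ?_ (h.Q_le_sF hx0 x)
    have := Finset.single_le_sum (f := fun k => (pd k v x - pd k v x0) * (pd k v x - pd k v x0))
      (fun i _ => mul_self_nonneg _) (Finset.mem_univ k)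
    rw [sq]
    exact this
  have sv := h.V_lower hx
  have t1 : |4 * (G v x0 - G v x) * S v x| ≤ 4 * (K ^ 3 * √(sF v x0 x)) * S v x := by
    rw [abs_mul, abs_mul, abs_of_pos hp, abs_sub_comm]
    norm_num
    exact mul_le_mul_of_nonneg_right (by linarith) hp.le
  have t2 : 6 * V v x + 4 * (G v x0 - G v x) * S v x
      + 2 * ∑ k, (pd k v x - pd k v x0) * pd k (G v) x - 6 * V v x
      = 4 * (G v x0 - G v x) * S v x + 2 * ∑ k, (pd k v x - pd k v x0) * pd k (G v) x := by ring
  rw [t2]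
  refine (abs_add_le _ _).trans ?_
  rw [abs_mul 2, abs_of_pos (by norm_num : (0:ℝ) < 2)]
  have t3 : K ^ 3 * √(sF v x0 x) * S v x ≤ K ^ 3 * √(sF v x0 x) * (2 * K * V v x) :=
    mul_le_mul_of_nonneg_left sv (by positivity)
  have t4 : K ^ 4 * (√(sF v x0 x) * V v x) ≤ K ^ 8 * (√(sF v x0 x) * V v x) :=
    mul_le_mul_of_nonneg_right (pow_le_pow_right₀ hK (by norm_num)) (by positivity)
  nlinarith

lemma GH.Fss (h : GH K f v) {x0 x : E3} (hx0 : x0 ∈ ball (0 : E3) 9) (hx : x ∈ ball (0 : E3) 9)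
    (hs : sF v x0 x ≤ 1) :
    Fq v (sF v x0) (sF v x0) x ≤ 4 * sF v x0 x * V v x * (1 + 20 * K ^ 8 * √(sF v x0 x)) := by
  have hK := h.hK
  have s0 := h.sF_nonneg hx0 x
  have r0 := Real.sqrt_nonneg (sF v x0 x)
  have hp := h.pos x hx
  have Vp := h.V_pos hx
  have hsy := Hx_symm h.sm x
  have g := h.G_lip hx0 hx
  have Gp := h.G_pos hx
  have sv := h.V_lower hx
  have N0 := Nq_nonneg x0 x
  have N1 := h.N_le_sF hx0 x
  set a : Fin 3 → ℝ := fun i => aG (Hx v x) * (x i - x0 i) + ∑ k, Hx v x i k * (pd k v x - pd k v x0) with ha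
  set y : Fin 3 → ℝ := fun i => x i - x0 i with hy
  set ρ := √(sF v x0 x) with hρ
  have hρs : ρ ^ 2 = sF v x0 x := Real.sq_sqrt s0
  have ρ1 : ρ ≤ 1 := Real.sqrt_le_one.2 hs
  have e := aV_split hsy y (fun k => pd k v x - pd k v x0)
  have e1 : dg (sF v x0) x = fun i => 2 * a i + (2 * (G v x0 - G v x)) * y i := by
    funext i
    simp only [dg, pd_sF h.sm, pd_Nq, pd_Q h.sm, ha, hy, Hx, G]
    have : ∀ k, (pd k v x - pd k v x0) * hh v i k x = hh v i k x * (pd k v x - pd k v x0) :=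
      fun k => mul_comm _ _
    simp only [this]
    ring
  have e2 : nsq y = Nq x0 x := by simp [nsq, Nq, hy, sq]
  have e3 : nsq (fun k => pd k v x - pd k v x0) = Q v (dg v x0) x := by simp [nsq, Q, dg, sq]
  have fa0 := aF_nonneg hsy hp Gp a
  have fy0 := aF_nonneg hsy hp Gp y
  have fa : aF (Hx v x) a a ≤ V v x * (G v x * Nq x0 x + Q v (dg v x0) x) := by
    rw [e2, e3] at e
    have n := aF_nonneg hsy hp Gp (fun i => ∑ k, Hx v x i k * y k - (pd i v x - pd i v x0))
    have := mul_nonneg Gp.le n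
    change V v x * (G v x * _ + _) = aF (Hx v x) a a + G v x * _ at e
    linarith
  have fy : aF (Hx v x) y y ≤ 4 * K ^ 2 * V v x * ρ ^ 2 := by
    have := aF_upper hsy hp Gp y
    rw [← S_eq, e2] at this
    refine this.trans ?_
    rw [hρs]
    calc 2 * S v x * Nq x0 x ≤ 2 * (2 * K * V v x) * (K * sF v x0 x) :=
          mul_le_mul (by linarith) N1 N0 (by positivity)
      _ = _ := by ring
  rw [Fq_eq, e1, aF_lin hsy]
  have gN : G v x * Nq x0 x + Q v (dg v x0) x ≤ ρ ^ 2 + K ^ 4 * ρ ^ 3 := by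
    have g1 : G v x ≤ G v x0 + K ^ 3 * ρ := by linarith [(abs_le.1 g).2]
    have g2 : (G v x - G v x0) * Nq x0 x ≤ (K ^ 3 * ρ) * (K * sF v x0 x) :=
      mul_le_mul (by linarith) N1 N0 (by positivity)
    have : sF v x0 x = G v x0 * Nq x0 x + Q v (dg v x0) x := rfl
    have e5 : K ^ 3 * ρ * (K * sF v x0 x) = K ^ 4 * ρ ^ 3 := by rw [← hρs]; ring
    rw [e5] at g2
    rw [hρs]
    linarith
  have fa' : aF (Hx v x) a a ≤ V v x * (ρ ^ 2 + K ^ 4 * ρ ^ 3) :=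
    fa.trans (mul_le_mul_of_nonneg_left gN Vp.le)
  -- handle the cross term
  have gsq : (G v x0 - G v x) ^ 2 ≤ K ^ 6 * ρ ^ 2 := by
    have : (G v x0 - G v x) ^ 2 = |G v x - G v x0| ^ 2 := by rw [sq_abs]; ring
    rw [this]
    calc _ ≤ (K ^ 3 * ρ) ^ 2 := pow_le_pow_left₀ (abs_nonneg _) g 2
      _ = _ := by ring
  have cy : (G v x0 - G v x) ^ 2 * aF (Hx v x) y y ≤ 4 * K ^ 8 * V v x * ρ ^ 4 := by
    calc _ ≤ K ^ 6 * ρ ^ 2 * (4 * K ^ 2 * V v x * ρ ^ 2) := mul_le_mul gsq fy fy0 (by positivity)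
      _ = _ := by ring
  have cr : 2 * (G v x0 - G v x) * aF (Hx v x) a y ≤ ρ * (V v x * (ρ ^ 2 + K ^ 4 * ρ ^ 3))
      + 4 * K ^ 8 * V v x * ρ ^ 3 := by
    rcases r0.eq_or_lt with h0 | h0
    · have z : G v x0 - G v x = 0 := by
        have : (G v x0 - G v x) ^ 2 ≤ 0 := by rw [← h0] at gsq; simpa using gsq
        exact pow_eq_zero_iff (by norm_num) |>.1 (le_antisymm this (sq_nonneg _))
      rw [z, ← h0]; simp
    · have n := aF_nonneg hsy hp Gp (fun i => ρ * a i + (-(G v x0 - G v x)) * y i)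
      rw [aF_lin hsy] at n
      have n2 : ρ * (2 * (G v x0 - G v x) * aF (Hx v x) a y) ≤ ρ * (ρ * aF (Hx v x) a a
          + 4 * K ^ 8 * V v x * ρ ^ 3) := by nlinarith
      have n3 := le_of_mul_le_mul_left n2 h0
      have := mul_le_mul_of_nonneg_left fa' r0
      linarith
  have p1 : ρ ^ 4 ≤ ρ ^ 3 := pow_le_pow_of_le_one r0 ρ1 (by norm_num)
  have k48 : K ^ 4 ≤ K ^ 8 := pow_le_pow_right₀ hK (by norm_num)
  have k18 : 1 ≤ K ^ 8 := one_le_pow₀ hK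
  rw [← hρs]
  have q3 : 0 ≤ ρ ^ 3 := by positivity
  have V3 : 0 ≤ V v x * ρ ^ 3 := by positivity
  have m1 : K ^ 4 * (V v x * ρ ^ 3) ≤ K ^ 8 * (V v x * ρ ^ 3) := mul_le_mul_of_nonneg_right k48 V3
  have m2 : V v x * ρ ^ 3 ≤ K ^ 8 * (V v x * ρ ^ 3) := by nlinarith
  have m3 : K ^ 4 * (V v x * ρ ^ 4) ≤ K ^ 4 * (V v x * ρ ^ 3) :=
    mul_le_mul_of_nonneg_left (mul_le_mul_of_nonneg_left p1 Vp.le) (by positivity)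
  have m4 : K ^ 8 * (V v x * ρ ^ 4) ≤ K ^ 8 * (V v x * ρ ^ 3) :=
    mul_le_mul_of_nonneg_left (mul_le_mul_of_nonneg_left p1 Vp.le) (by positivity)
  nlinarith

end

section

variable {K : ℝ} {f : E3 × ℝ × E3 → ℝ} {v b : E3 → ℝ}

lemma Lop_comp {s : E3 → ℝ} (hs : ContDiff ℝ ∞ s) {Ψ Ψ1 : ℝ → ℝ} {d2 : ℝ} {x : E3}
    (h1 : ∀ y, HasDerivAt Ψ (Ψ1 (s y)) (s y)) (h2 : HasDerivAt Ψ1 d2 (s x))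
    (hsm : ContDiff ℝ ∞ (fun y => Ψ1 (s y))) :
    Lop v (fun y => Ψ (s y)) x = Ψ1 (s x) * Lop v s x + d2 * Fq v s s x := by
  simp only [Lop, Fq, Finset.mul_sum, ← Finset.sum_add_distrib]
  refine Finset.sum_congr rfl fun i _ => Finset.sum_congr rfl fun j _ => ?_
  have e : pd j (fun y => Ψ (s y)) = fun y => Ψ1 (s y) * pd j s y := by
    funext y
    exact pd_chain hs j (h1 y)
  rw [e, pd_mul hsm (pd_smooth hs j)]
  simp only
  rw [pd_chain hs i h2]
  ring

lemma exists_eta {a : ℝ} (ha : 0 < a) : ∃ (η η1 η2 : ℝ → ℝ) (M : ℝ), 0 ≤ M ∧ ContDiff ℝ ∞ η ∧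
    ContDiff ℝ ∞ η1 ∧ (∀ t, HasDerivAt η (η1 t) t) ∧ (∀ t, HasDerivAt η1 (η2 t) t) ∧
    (∀ t, 0 ≤ η t ∧ η t ≤ 1) ∧ (∀ t < a, η t = 1 ∧ η1 t = 0 ∧ η2 t = 0) ∧
    (∀ t > 2 * a, η t = 0 ∧ η1 t = 0 ∧ η2 t = 0) ∧ (∀ t, |η1 t| ≤ M) ∧ (∀ t, |η2 t| ≤ M) := by
  set η : ℝ → ℝ := fun t => Real.smoothTransition (2 - t / a) with hη
  have c0 : ContDiff ℝ ∞ η := Real.smoothTransition.contDiff.comp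
    (contDiff_const.sub (contDiff_id.div_const a))
  have c1 : ContDiff ℝ ∞ (deriv η) := (contDiff_infty_iff_deriv.1 c0).2
  have c2 : ContDiff ℝ ∞ (deriv (deriv η)) := (contDiff_infty_iff_deriv.1 c1).2
  have A1 : ∀ t < a, η t = 1 := fun t ht => by
    apply Real.smoothTransition.one_of_one_le
    have := (div_le_one ha).2 ht.le
    linarith
  have A2 : ∀ t > 2 * a, η t = 0 := fun t ht => by
    apply Real.smoothTransition.zero_of_nonpos
    have := (le_div_iff₀ ha).2 (le_of_lt ht)
    linarith
  have B1 : ∀ t < a, deriv η t = 0 := fun t ht => by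
    have : η =ᶠ[nhds t] fun _ => (1 : ℝ) := by
      filter_upwards [Iio_mem_nhds ht] with y hy using A1 y hy
    rw [this.deriv_eq]; simp
  have B2 : ∀ t > 2 * a, deriv η t = 0 := fun t ht => by
    have : η =ᶠ[nhds t] fun _ => (0 : ℝ) := by
      filter_upwards [Ioi_mem_nhds ht] with y hy using A2 y hy
    rw [this.deriv_eq]; simp
  have C1 : ∀ t < a, deriv (deriv η) t = 0 := fun t ht => by
    have : deriv η =ᶠ[nhds t] fun _ => (0 : ℝ) := by
      filter_upwards [Iio_mem_nhds ht] with y hy using B1 y hy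
    rw [this.deriv_eq]; simp
  have C2 : ∀ t > 2 * a, deriv (deriv η) t = 0 := fun t ht => by
    have : deriv η =ᶠ[nhds t] fun _ => (0 : ℝ) := by
      filter_upwards [Ioi_mem_nhds ht] with y hy using B2 y hy
    rw [this.deriv_eq]; simp
  have bdd : ∀ g : ℝ → ℝ, Continuous g → (∀ t < a, g t = 0) → (∀ t > 2 * a, g t = 0) →
      ∃ M, 0 ≤ M ∧ ∀ t, |g t| ≤ M := by
    intro g hg g1 g2
    obtain ⟨M, hM⟩ := (isCompact_Icc (a := a) (b := 2 * a)).exists_bound_of_continuousOn hg.continuousOn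
    refine ⟨|M|, abs_nonneg _, fun t => ?_⟩
    by_cases h1 : t < a
    · rw [g1 t h1]; simp
    by_cases h2 : t > 2 * a
    · rw [g2 t h2]; simp
    · push Not at h1 h2
      exact (hM t ⟨h1, h2⟩).trans (le_abs_self M)
  obtain ⟨M1, p1, q1⟩ := bdd _ c1.continuous B1 B2
  obtain ⟨M2, p2, q2⟩ := bdd _ c2.continuous C1 C2
  refine ⟨η, deriv η, deriv (deriv η), M1 + M2, by positivity, c0, c1,
    fun t => (c0.differentiable (by simp) t).hasDerivAt,
    fun t => (c1.differentiable (by simp) t).hasDerivAt,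
    fun t => ⟨Real.smoothTransition.nonneg _, Real.smoothTransition.le_one _⟩,
    fun t ht => ⟨A1 t ht, B1 t ht, C1 t ht⟩, fun t ht => ⟨A2 t ht, B2 t ht, C2 t ht⟩,
    fun t => (q1 t).trans (by linarith), fun t => (q2 t).trans (by linarith)⟩

/-- `(t + τ²)^(-1/4)` -/
def Pf (T t : ℝ) : ℝ := (t + T) ^ (-(1 / 4) : ℝ)

lemma Pf_pos {T t : ℝ} (h : 0 < t + T) : 0 < Pf T t := Real.rpow_pos_of_pos h _

lemma Pf_four {T t : ℝ} (h : 0 < t + T) : Pf T t ^ 4 * (t + T) = 1 := by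
  have : Pf T t ^ 4 = (t + T)⁻¹ := by
    rw [Pf, ← Real.rpow_natCast, ← Real.rpow_mul h.le]
    norm_num
    exact Real.rpow_neg_one _
  rw [this, inv_mul_cancel₀ h.ne']

lemma Pf_deriv {T t : ℝ} (h : 0 < t + T) :
    HasDerivAt (Pf T) (-(1 / 4) * Pf T t ^ 5) t := by
  have h1 : HasDerivAt (fun t => t + T) 1 t := (hasDerivAt_id t).add_const T
  have h2 := h1.rpow_const (p := (-(1 / 4) : ℝ)) (Or.inl h.ne')
  have e : Pf T t ^ 5 = (t + T) ^ (-(1 / 4) - 1 : ℝ) := by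
    rw [Pf, ← Real.rpow_natCast, ← Real.rpow_mul h.le]
    norm_num
  rw [e]
  rw [one_mul] at h2
  exact h2

lemma gamma_alg {P s T ρ c q : ℝ} (hP : 1 ≤ P) (hq : q = s + T) (hPq : P ^ 4 * q = 1) (hs : 0 ≤ s)
    (hT : 0 ≤ T) (hρ : 0 ≤ ρ) (hρs : ρ ^ 2 = s) (hc : 0 ≤ c) (hcρ : 12 * (c * ρ) ≤ 1) :
    (-(1 / 2) * P ^ 6 - (28 * c) / 4 * P ^ 5) * (6 - c * ρ) +
      (3 / 4 * P ^ 10 + 5 * (28 * c) / 16 * P ^ 9) * (4 * s * (1 + c * ρ)) ≤ -(3 * T * P ^ 10) := by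
  have P0 : 0 < P := by linarith
  have sP : P ^ 4 * s = 1 - P ^ 4 * T := by rw [hq] at hPq; linarith
  have TP : 0 ≤ P ^ 4 * T := by positivity
  have sP' : P ^ 4 * s ≤ 1 := by linarith
  have ρP : ρ * P ^ 2 ≤ 1 := by
    have : (ρ * P ^ 2) ^ 2 ≤ 1 ^ 2 := by
      calc _ = P ^ 4 * s := by rw [← hρs]; ring
        _ ≤ _ := by simpa using sP'
    exact (abs_le_of_sq_le_sq this zero_le_one |> abs_le.1).2
  have cρ : 0 ≤ c * ρ := by positivity
  have k1 : 3 / 4 * P ^ 10 * (4 * s * (1 + c * ρ)) = 3 * P ^ 6 - 3 * T * P ^ 10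
      + 3 * (c * ρ) * P ^ 6 * (P ^ 4 * s) := by
    linear_combination (3 * P ^ 6) * sP
  have k2 : 3 * (c * ρ) * P ^ 6 * (P ^ 4 * s) ≤ 3 * (c * ρ) * P ^ 6 * 1 :=
    mul_le_mul_of_nonneg_left sP' (by positivity)
  have k3 : 7 / 2 * c * P ^ 4 * (ρ * P ^ 2) ≤ 7 / 2 * c * P ^ 4 * 1 :=
    mul_le_mul_of_nonneg_left ρP (by positivity)
  have k4 : 7 / 2 * c * P ^ 4 * 1 ≤ 7 / 2 * c * P ^ 4 * P :=
    mul_le_mul_of_nonneg_left hP (by positivity)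
  have k5 : 35 * c * P ^ 5 * (1 + c * ρ) * (P ^ 4 * s) ≤ 35 * c * P ^ 5 * (1 + c * ρ) * 1 :=
    mul_le_mul_of_nonneg_left sP' (by positivity)
  have k6 : 7 / 2 * c * P ^ 5 * (12 * (c * ρ)) ≤ 7 / 2 * c * P ^ 5 * 1 :=
    mul_le_mul_of_nonneg_left hcρ (by positivity)
  nlinarith

end

/-- the basic radius -/
def r1 (K : ℝ) : ℝ := 1 / (1000 * K ^ 8)

section

variable {K : ℝ} {f : E3 × ℝ × E3 → ℝ} {v b : E3 → ℝ}

lemma r1_pos (hK : 1 ≤ K) : 0 < r1 K := by unfold r1; positivity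

lemma r1_mul (hK : 1 ≤ K) : r1 K * K ^ 8 = 1 / 1000 := by
  unfold r1; field_simp

lemma r1_le (hK : 1 ≤ K) : r1 K ≤ 1 / 1000 := by
  have := r1_mul hK
  have h1 : 1 ≤ K ^ 8 := one_le_pow₀ hK
  have := r1_pos hK
  nlinarith

lemma r1_mulK (hK : 1 ≤ K) : r1 K * K ≤ 1 / 1000 := by
  have e := r1_mul hK
  have h1 : K ≤ K ^ 8 := le_self_pow₀ hK (by norm_num)
  have := r1_pos hK
  nlinarith

lemma GH.small (h : GH K f v) {x0 x : E3} (hx0 : x0 ∈ ball (0 : E3) (1 / 2))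
    (hs : sF v x0 x ≤ 2 * r1 K ^ 2) :
    12 * (20 * K ^ 8 * √(sF v x0 x)) ≤ 1 ∧ ‖x - x0‖ ≤ 1 / 2 ∧ x ∈ ball (0 : E3) 4 := by
  have hK := h.hK
  have rp := r1_pos hK
  have hx9 : x0 ∈ ball (0 : E3) 9 := ball_subset_ball (by norm_num) hx0
  have s0 := h.sF_nonneg hx9 x
  have hr : √(sF v x0 x) ≤ 2 * r1 K := by
    apply Real.sqrt_le_iff.2 ⟨by positivity, ?_⟩
    nlinarith
  have n := h.norm_le hx9 x
  have e := r1_mul hK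
  have e2 := r1_mulK hK
  have n2 : ‖x - x0‖ ≤ 1 / 2 := by
    have : K * √(sF v x0 x) ≤ K * (2 * r1 K) := mul_le_mul_of_nonneg_left hr (by linarith)
    linarith
  refine ⟨?_, n2, ?_⟩
  · have : K ^ 8 * √(sF v x0 x) ≤ K ^ 8 * (2 * r1 K) := mul_le_mul_of_nonneg_left hr (by positivity)
    linarith
  · rw [mem_ball_zero_iff] at hx0 ⊢
    have : ‖x‖ ≤ ‖x - x0‖ + ‖x0‖ := by simpa using norm_add_le (x - x0) x0
    linarith

set_option maxHeartbeats 1600000 in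
lemma test_fun (hK : 1 ≤ K) : ∃ C, 0 ≤ C ∧ ∀ (f : E3 × ℝ × E3 → ℝ) (v : E3 → ℝ), GH K f v →
    ∀ x0 ∈ ball (0 : E3) (1 / 2), ∀ τ, 0 < τ → τ ≤ r1 K → ∃ ψ : E3 → ℝ, ContDiff ℝ ∞ ψ ∧
      HasCompactSupport ψ ∧ (∀ x, 0 ≤ ψ x) ∧
      (∀ x, 2 * r1 K ^ 2 < sF v x0 x → ψ x = 0 ∧ Lop v ψ x = 0) ∧
      (∀ x, sF v x0 x ≤ 2 * r1 K ^ 2 → Lop v ψ x ≤ C * V v x) ∧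
      (∀ x, sF v x0 x < τ ^ 2 → Lop v ψ x ≤ -(1 / 2 * (1 / τ ^ 3) * V v x)) := by
  have rp := r1_pos hK
  set a := r1 K ^ 2 with hadef
  have ha : 0 < a := by positivity
  obtain ⟨η, η1, η2, M, M0, ηs, cdη1, hη1, hη2, η01, ηA, ηB, bM1, bM2⟩ := exists_eta ha
  set c := 20 * K ^ 8 with hc
  have c0 : 0 ≤ c := by positivity
  set P0 := Pf 0 a with hP0
  have P0p : 0 < P0 := Pf_pos (by simpa using ha)
  set g0 := P0 ^ 2 + 28 * c * P0 with hg0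
  set g1 := 1 / 2 * P0 ^ 6 + 28 * c / 4 * P0 ^ 5 with hg1
  set g2 := 3 / 4 * P0 ^ 10 + 5 * (28 * c) / 16 * P0 ^ 9 with hg2
  have g0p : 0 ≤ g0 := by positivity
  have g1p : 0 ≤ g1 := by positivity
  have g2p : 0 ≤ g2 := by positivity
  refine ⟨(M * g0 + g1) * 7 + (M * g0 + 2 * M * g1 + g2) * 8, by positivity, ?_⟩
  intro f v h x0 hx0 τ τ0 τ1
  have hx9 : x0 ∈ ball (0 : E3) 9 := ball_subset_ball (by norm_num) hx0
  set s := sF v x0 with hsdef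
  have s0 : ∀ x, 0 ≤ s x := h.sF_nonneg hx9
  have ssm : ContDiff ℝ ∞ s := sF_smooth h.sm x0
  set T := τ ^ 2 with hT
  have T0 : 0 < T := by positivity
  have q0 : ∀ x, 0 < s x + T := fun x => by linarith [s0 x]
  set P := Pf T with hP
  have Psm : ContDiff ℝ ∞ (fun x => P (s x)) :=
    (ssm.add contDiff_const).rpow_const_of_ne (fun x => (q0 x).ne')
  have Pd : ∀ x, HasDerivAt P (-(1 / 4) * P (s x) ^ 5) (s x) := fun x => Pf_deriv (q0 x)
  have Pp : ∀ x, 0 < P (s x) := fun x => Pf_pos (q0 x)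
  set Γ : ℝ → ℝ := fun t => P t ^ 2 + 28 * c * P t with hΓ
  set Γ1 : ℝ → ℝ := fun t => -(1 / 2) * P t ^ 6 - 28 * c / 4 * P t ^ 5 with hΓ1
  set Γ2 : ℝ → ℝ := fun t => 3 / 4 * P t ^ 10 + 5 * (28 * c) / 16 * P t ^ 9 with hΓ2
  have dΓ : ∀ x, HasDerivAt Γ (Γ1 (s x)) (s x) := fun x => by
    have := ((Pd x).pow 2).add ((Pd x).const_mul (28 * c))
    refine this.congr_deriv ?_
    simp only [hΓ1]; push_cast; ring
  have dΓ1 : ∀ x, HasDerivAt Γ1 (Γ2 (s x)) (s x) := fun x => by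
    have := (((Pd x).pow 6).const_mul (-(1 / 2))).sub (((Pd x).pow 5).const_mul (28 * c / 4))
    refine this.congr_deriv ?_
    simp only [hΓ2]; push_cast; ring
  have Γsm : ContDiff ℝ ∞ (fun x => Γ (s x)) := (Psm.pow 2).add (contDiff_const.mul Psm)
  have smΓ1 : ContDiff ℝ ∞ (fun x => Γ1 (s x)) :=
    (contDiff_const.mul (Psm.pow 6)).sub (contDiff_const.mul (Psm.pow 5))
  set Ψ : ℝ → ℝ := fun t => η t * Γ t with hΨ
  set Ψ1 : ℝ → ℝ := fun t => η1 t * Γ t + η t * Γ1 t with hΨ1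
  set Ψ2 : ℝ → ℝ := fun t => (η2 t * Γ t + η1 t * Γ1 t) + (η1 t * Γ1 t + η t * Γ2 t) with hΨ2
  have dΨ : ∀ x, HasDerivAt Ψ (Ψ1 (s x)) (s x) := fun x => (hη1 (s x)).mul (dΓ x)
  have dΨ1 : ∀ x, HasDerivAt Ψ1 (Ψ2 (s x)) (s x) := fun x =>
    ((hη2 (s x)).mul (dΓ x)).add ((hη1 (s x)).mul (dΓ1 x))
  have smη1 : ContDiff ℝ ∞ (fun x => η1 (s x)) := cdη1.comp ssm
  have ηsm : ContDiff ℝ ∞ (fun x => η (s x)) := ηs.comp ssm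
  have smΨ1 : ContDiff ℝ ∞ (fun x => Ψ1 (s x)) := (smη1.mul Γsm).add (ηsm.mul smΓ1)
  have LΨ : ∀ x, Lop v (fun y => Ψ (s y)) x = Ψ1 (s x) * Lop v s x + Ψ2 (s x) * Fq v s s x :=
    fun x => Lop_comp ssm dΨ (dΨ1 x) smΨ1
  have Γ0 : ∀ x, 0 ≤ Γ (s x) := fun x => by have := Pp x; positivity
  -- inner region
  have inner : ∀ x, s x < a → Lop v (fun y => Ψ (s y)) x ≤ -(3 * T * P (s x) ^ 10) * V v x := by
    intro x hx
    obtain ⟨e0, e1, e2⟩ := ηA _ hx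
    obtain ⟨sm1, sm2, sm3⟩ := h.small hx0 (x := x) (by show s x ≤ 2 * a; linarith)
    have hx9' : x ∈ ball (0 : E3) 9 := ball_subset_ball (by norm_num) sm3
    have Vp := h.V_pos hx9'
    rw [LΨ]
    have E1 : Ψ1 (s x) = Γ1 (s x) := by simp only [hΨ1, e0, e1]; ring
    have E2 : Ψ2 (s x) = Γ2 (s x) := by simp only [hΨ2, e0, e1, e2]; ring
    rw [E1, E2]
    have r11 := r1_le hK
    have a1 : a ≤ 1 / 1000 := by rw [hadef]; nlinarith
    have T1 : T ≤ a := pow_le_pow_left₀ τ0.le τ1 2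
    have ls := h.Ls hx9 hx9'
    have fss := h.Fss hx9 hx9' (by show s x ≤ 1; linarith)
    have P4 : P (s x) ^ 4 * (s x + T) = 1 := Pf_four (q0 x)
    have P1 : 1 ≤ P (s x) := by
      by_contra hn
      push Not at hn
      have : P (s x) ^ 4 ≤ 1 := pow_le_one₀ (Pp x).le hn.le
      have : P (s x) ^ 4 * (s x + T) ≤ 1 * (s x + T) := mul_le_mul_of_nonneg_right this (q0 x).le
      linarith
    have al := gamma_alg (P := P (s x)) (s := s x) (T := T) (ρ := √(s x)) (c := c) P1 rfl P4
      (s0 x) T0.le (Real.sqrt_nonneg _) (Real.sq_sqrt (s0 x)) c0 sm1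
    have hneg : Γ1 (s x) ≤ 0 := by
      have := Pp x
      have h1 : 0 ≤ 1 / 2 * P (s x) ^ 6 + 28 * c / 4 * P (s x) ^ 5 := by positivity
      simp only [hΓ1]; linarith
    have hpos : 0 ≤ Γ2 (s x) := by have := Pp x; positivity
    have t1 : Γ1 (s x) * Lop v s x ≤ Γ1 (s x) * ((6 - c * √(s x)) * V v x) := by
      apply mul_le_mul_of_nonpos_left _ hneg
      have := (abs_le.1 ls).1
      linarith
    have t2 : Γ2 (s x) * Fq v s s x ≤ Γ2 (s x) * (4 * s x * (1 + c * √(s x)) * V v x) := by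
      apply mul_le_mul_of_nonneg_left _ hpos
      linarith
    have t3 := mul_le_mul_of_nonneg_right al Vp.le
    simp only [hΓ1, hΓ2] at t1 t2 ⊢
    linarith
  refine ⟨fun x => Ψ (s x), ηsm.mul Γsm, ?_, fun x => mul_nonneg (η01 _).1 (Γ0 x), ?_, ?_, ?_⟩
  · refine HasCompactSupport.of_support_subset_isCompact (isCompact_closedBall x0 (1 / 2)) ?_
    intro x hx
    by_contra hn
    apply hx
    have : 2 * a < s x := by
      by_contra hn2
      push Not at hn2
      have := (h.small hx0 hn2).2.1
      apply hn
      rw [mem_closedBall, dist_eq_norm]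
      exact this
    simp [hΨ, (ηB _ this).1]
  · intro x hx
    obtain ⟨e0, e1, e2⟩ := ηB _ hx
    refine ⟨by simp [hΨ, e0], ?_⟩
    rw [LΨ]
    simp [hΨ1, hΨ2, e0, e1, e2]
  · intro x hx
    obtain ⟨sm1, sm2, sm3⟩ := h.small hx0 hx
    have hx9' : x ∈ ball (0 : E3) 9 := ball_subset_ball (by norm_num) sm3
    have Vp := h.V_pos hx9'
    by_cases hsa : s x < a
    · have := inner x hsa
      have p10 : 0 ≤ 3 * T * P (s x) ^ 10 * V v x := by have := Pp x; positivity
      have cc : 0 ≤ ((M * g0 + g1) * 7 + (M * g0 + 2 * M * g1 + g2) * 8) * V v x := by positivity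
      linarith
    · push Not at hsa
      have r11 := r1_le hK
      have a1 : a ≤ 1 / 1000 := by rw [hadef]; nlinarith
      have s1 : s x ≤ 1 := by linarith
      have ls := h.Ls hx9 hx9'
      have fss := h.Fss hx9 hx9' s1
      have fn := h.Fq_nonneg hx9' s
      have ρ0 := Real.sqrt_nonneg (s x)
      have cρ : c * √(s x) ≤ 1 := by linarith [sm1]
      have cρ0 : 0 ≤ c * √(s x) := by positivity
      have PP : P (s x) ≤ P0 := by
        have : P0 = a ^ (-(1 / 4) : ℝ) := by simp [hP0, Pf]
        rw [this]
        exact Real.rpow_le_rpow_of_nonpos ha (by linarith) (by norm_num)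
      have pw : ∀ n : ℕ, P (s x) ^ n ≤ P0 ^ n := fun n => pow_le_pow_left₀ (Pp x).le PP n
      have pn : ∀ n : ℕ, 0 ≤ P (s x) ^ n := fun n => pow_nonneg (Pp x).le n
      have bΓ : |Γ (s x)| ≤ g0 := by
        rw [abs_of_nonneg (Γ0 x)]
        have := mul_le_mul_of_nonneg_left PP (show 0 ≤ 28 * c by positivity)
        have := pw 2
        simp only [hΓ, hg0]; linarith
      have bΓ1 : |Γ1 (s x)| ≤ g1 := by
        have k1 := mul_le_mul_of_nonneg_left (pw 5) (show 0 ≤ 28 * c / 4 by positivity)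
        have k2 := pw 6
        have k3 := mul_nonneg (show 0 ≤ 28 * c / 4 by positivity) (pn 5)
        have k4 := pn 6
        rw [abs_le]
        simp only [hΓ1, hg1]; constructor <;> linarith
      have bΓ2 : |Γ2 (s x)| ≤ g2 := by
        have k1 := mul_le_mul_of_nonneg_left (pw 9) (show 0 ≤ 5 * (28 * c) / 16 by positivity)
        have k2 := pw 10
        have k3 := mul_nonneg (show 0 ≤ 5 * (28 * c) / 16 by positivity) (pn 9)
        have k4 := pn 10
        rw [abs_le]
        simp only [hΓ2, hg2]; constructor <;> linarith
      have bη : |η (s x)| ≤ 1 := by rw [abs_of_nonneg (η01 _).1]; exact (η01 _).2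
      have bm : ∀ {p q A B : ℝ}, |p| ≤ A → |q| ≤ B → |p * q| ≤ A * B := fun {p q A B} hp hq => by
        rw [abs_mul]
        exact mul_le_mul hp hq (abs_nonneg _) ((abs_nonneg _).trans hp)
      have B1 : |Ψ1 (s x)| ≤ M * g0 + g1 := by
        refine (abs_add_le _ _).trans ?_
        have := bm (bM1 (s x)) bΓ
        have := bm bη bΓ1
        linarith
      have B2 : |Ψ2 (s x)| ≤ M * g0 + 2 * M * g1 + g2 := by
        refine (abs_add_le _ _).trans ?_
        have t1 := abs_add_le (η2 (s x) * Γ (s x)) (η1 (s x) * Γ1 (s x))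
        have t2 := abs_add_le (η1 (s x) * Γ1 (s x)) (η (s x) * Γ2 (s x))
        have := bm (bM2 (s x)) bΓ
        have := bm (bM1 (s x)) bΓ1
        have := bm bη bΓ2
        linarith
      have L1 : |Lop v s x| ≤ 7 * V v x := by
        have t := abs_sub_abs_le_abs_sub (Lop v s x) (6 * V v x)
        rw [abs_of_nonneg (show 0 ≤ 6 * V v x by positivity)] at t
        have := mul_le_mul_of_nonneg_right cρ Vp.le
        linarith
      have L2 : |Fq v s s x| ≤ 8 * V v x := by
        rw [abs_of_nonneg fn]
        refine fss.trans ?_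
        have : 4 * s x * V v x * (1 + c * √(s x)) ≤ 4 * 1 * V v x * 2 := by
          have := s0 x
          gcongr
          linarith
        linarith
      rw [LΨ]
      have := (abs_le.1 (bm B1 L1)).2
      have := (abs_le.1 (bm B2 L2)).2
      linarith
  · intro x hx
    have T1 : T ≤ a := pow_le_pow_left₀ τ0.le τ1 2
    have hx2 : s x < T := hx
    obtain ⟨sm1, sm2, sm3⟩ := h.small hx0 (x := x) (by show s x ≤ 2 * a; linarith)
    have hx9' : x ∈ ball (0 : E3) 9 := ball_subset_ball (by norm_num) sm3
    have Vp := h.V_pos hx9'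
    have I := inner x (by linarith)
    refine I.trans ?_
    have P4 : P (s x) ^ 4 * (s x + T) = 1 := Pf_four (q0 x)
    -- P ^ 4 ≥ 1 / (2T), so P^20 ≥ 1/(32 τ^10), P^10 ≥ 1/(6 τ^5)
    have p4 : 1 ≤ P (s x) ^ 4 * (2 * T) := by
      rw [← P4]
      exact mul_le_mul_of_nonneg_left (by linarith) (by have := Pp x; positivity)
    have p5 : 1 ≤ 6 * (P (s x) ^ 10 * τ ^ 5) := by
      have u1 : 1 ≤ (P (s x) ^ 4 * (2 * T)) ^ 5 := one_le_pow₀ p4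
      have u2 : (P (s x) ^ 4 * (2 * T)) ^ 5 = 32 * (P (s x) ^ 10 * τ ^ 5) ^ 2 := by
        rw [hT]; ring
      have u3 : 0 < P (s x) ^ 10 * τ ^ 5 := by have := Pp x; positivity
      rw [u2] at u1
      generalize P (s x) ^ 10 * τ ^ 5 = z at u1 u3 ⊢
      nlinarith
    have p6 : 1 / 2 * (1 / τ ^ 3) ≤ 3 * T * P (s x) ^ 10 := by
      have : 1 / 2 * (1 / τ ^ 3) = 1 / (2 * τ ^ 3) := by field_simp
      rw [this, div_le_iff₀ (by positivity), hT]
      have e9 : 3 * τ ^ 2 * P (s x) ^ 10 * (2 * τ ^ 3) = 6 * (P (s x) ^ 10 * τ ^ 5) := by ring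
      rw [e9]
      exact p5
    have := mul_le_mul_of_nonneg_right p6 Vp.le
    linarith

end

section

variable {K : ℝ} {f : E3 × ℝ × E3 → ℝ} {v b : E3 → ℝ}

lemma Lop_add_smul {φ ψ : E3 → ℝ} (hφ : ContDiff ℝ ∞ φ) (hψ : ContDiff ℝ ∞ ψ) (A : ℝ) (x : E3) :
    Lop v (fun y => φ y + A * ψ y) x = Lop v φ x + A * Lop v ψ x := by
  simp only [Lop, Finset.mul_sum, ← Finset.sum_add_distrib]
  refine Finset.sum_congr rfl fun i _ => Finset.sum_congr rfl fun j _ => ?_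
  rw [pd_add hφ (contDiff_const.mul hψ), pd_cmul hψ,
    pd_add (pd_smooth hφ j) (contDiff_const.mul (pd_smooth hψ j)), pd_cmul (pd_smooth hψ j)]
  ring

lemma BH.sub (h : BH K f v b) {x0 x : E3} (hx0 : x0 ∈ ball (0 : E3) (1 / 2))
    (hs : sF v x0 x ≤ 2 * r1 K ^ 2) :
    0 ≤ Lop v (fun y => b y + 136 * K ^ 8 * sF v x0 y) x := by
  have hK := h.gh.hK
  have hx9 : x0 ∈ ball (0 : E3) 9 := ball_subset_ball (by norm_num) hx0
  obtain ⟨m1, _, m3⟩ := h.gh.small hx0 hs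
  have hx8 : x ∈ ball (0 : E3) 8 := ball_subset_ball (by norm_num) m3
  have J := h.jacobi hx8
  have fn := h.gh.Fq_nonneg (mem89 hx8) b
  have sv := h.gh.V_lower (mem89 hx8)
  have Vp := h.gh.V_pos (mem89 hx8)
  have ls := (abs_le.1 (h.gh.Ls hx9 (mem89 hx8))).1
  rw [Lop_add_smul h.bs (sF_smooth h.gh.sm x0)]
  have l5 : 5 * V v x ≤ Lop v (sF v x0) x := by
    have : 20 * K ^ 8 * √(sF v x0 x) * V v x ≤ 1 * V v x :=
      mul_le_mul_of_nonneg_right (by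
        have : 0 ≤ 20 * K ^ 8 * √(sF v x0 x) := by positivity
        linarith) Vp.le
    linarith
  have t1 := mul_le_mul_of_nonneg_left l5 (show 0 ≤ 136 * K ^ 8 by positivity)
  have t2 := mul_le_mul_of_nonneg_left sv (show 0 ≤ 340 * K ^ 7 by positivity)
  have : 340 * K ^ 7 * (2 * K * V v x) = 136 * K ^ 8 * (5 * V v x) := by ring
  linarith

/-- The mean value type inequality. -/
lemma mean_value (hK : 1 ≤ K) : ∃ C, 0 ≤ C ∧ ∀ (f : E3 × ℝ × E3 → ℝ) (v b : E3 → ℝ), BH K f v b →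
    ∀ x0 ∈ ball (0 : E3) (1 / 2), ∀ τ, 0 < τ → τ ≤ r1 K →
      ∫ x in {x | sF v x0 x < τ ^ 2}, b x * V v x ≤ C * τ ^ 3 := by
  obtain ⟨C1, C10, H1⟩ := test_fun hK
  obtain ⟨C4, C40, H4⟩ := est4 (K := K)
  obtain ⟨C5, C50, H5⟩ := est5 (K := K)
  set A := 136 * K ^ 8 with hA
  have A0 : 0 ≤ A := by positivity
  refine ⟨2 * (C1 * (C5 + A * C4)), by positivity, ?_⟩
  intro f v b h x0 hx0 τ τ0 τ1
  have hx9 : x0 ∈ ball (0 : E3) 9 := ball_subset_ball (by norm_num) hx0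
  obtain ⟨ψ, ψs, ψc, ψ0, pz, pC, pS⟩ := H1 f v h.gh x0 hx0 τ τ0 τ1
  have ssm := sF_smooth h.gh.sm x0
  set bt : E3 → ℝ := fun y => b y + A * sF v x0 y with hbt
  have btsm : ContDiff ℝ ∞ bt := h.bs.add (contDiff_const.mul ssm)
  have sa := int_selfadj h.gh.sm ψs btsm ψc
  have cV : Continuous (V v) := (V_smooth h.gh.sm).continuous
  have cbV : Continuous (fun x => b x * V v x) := h.bs.continuous.mul cV
  have ia : Integrable (fun x => ψ x * Lop v bt x - bt x * Lop v ψ x) := by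
    have i1 : Integrable (fun x => ψ x * Lop v bt x) :=
      cs_integrable (ψs.continuous.mul (Lop_cont h.gh.sm btsm)) ψc.mul_right
    have i2 : Integrable (fun x => bt x * Lop v ψ x) :=
      cs_integrable (btsm.continuous.mul (Lop_cont h.gh.sm ψs)) (Lop_hcs ψc).mul_left
    exact i1.sub i2
  set D := {x | sF v x0 x < τ ^ 2} with hD
  have mD : MeasurableSet D := (isOpen_lt ssm.continuous continuous_const).measurableSet
  have ττ : τ ^ 2 ≤ r1 K ^ 2 := pow_le_pow_left₀ τ0.le τ1 2
  have rr : 0 < r1 K ^ 2 := pow_pos (r1_pos hK) 2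
  have D4 : D ⊆ ball (0 : E3) 4 := fun x hx => (h.gh.small hx0 (by
    have : sF v x0 x < τ ^ 2 := hx
    linarith)).2.2
  have iD : IntegrableOn (fun x => b x * V v x) D := (cont_intOn cbV 4).mono_set D4
  have iB : IntegrableOn (fun x => b x * V v x) (ball (0 : E3) 4) := cont_intOn cbV 4
  have iV : IntegrableOn (V v) (ball (0 : E3) 4) := cont_intOn cV 4
  set m1 : E3 → ℝ := D.indicator (fun x => 1 / 2 * (1 / τ ^ 3) * (b x * V v x)) with hm1
  set m2 : E3 → ℝ := (ball (0 : E3) 4).indicator (fun x => C1 * (b x * V v x + A * V v x)) with hm2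
  have im1 : Integrable m1 := (integrable_indicator_iff mD).2 (iD.const_mul _)
  have im2 : Integrable m2 := (integrable_indicator_iff measurableSet_ball).2
    ((iB.add (iV.const_mul A)).const_mul _)
  have key : ∀ x, m1 x - m2 x ≤ ψ x * Lop v bt x - bt x * Lop v ψ x := by
    intro x
    by_cases hs : sF v x0 x ≤ 2 * r1 K ^ 2
    · obtain ⟨_, _, x4⟩ := h.gh.small hx0 hs
      have hx8 : x ∈ ball (0 : E3) 8 := ball_subset_ball (by norm_num) x4
      have Vp := h.gh.V_pos (mem89 hx8)
      have b0 := h.b_nonneg hx8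
      have s0 := h.gh.sF_nonneg hx9 x
      have e2 : m2 x = C1 * (b x * V v x + A * V v x) := Set.indicator_of_mem x4 _
      have t1 : 0 ≤ ψ x * Lop v bt x := mul_nonneg (ψ0 x) (h.sub hx0 hs)
      have r11 := r1_le hK
      have s1 : sF v x0 x ≤ 1 := by have := r1_pos hK; nlinarith
      have bt0 : b x ≤ bt x := by
        have : 0 ≤ A * sF v x0 x := by positivity
        simp only [hbt]; linarith
      have bt1 : bt x ≤ b x + A := by
        have : A * sF v x0 x ≤ A * 1 := mul_le_mul_of_nonneg_left s1 A0
        simp only [hbt]; linarith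
      have m20 : 0 ≤ C1 * (b x * V v x + A * V v x) := by positivity
      by_cases hxD : x ∈ D
      · have e1 : m1 x = 1 / 2 * (1 / τ ^ 3) * (b x * V v x) := Set.indicator_of_mem hxD _
        have p := pS x hxD
        have q1 := mul_le_mul_of_nonneg_left p (b0.trans bt0)
        have q2 := mul_le_mul_of_nonneg_right bt0 (show 0 ≤ 1 / 2 * (1 / τ ^ 3) * V v x by positivity)
        rw [e1, e2]
        linarith
      · have e1 : m1 x = 0 := Set.indicator_of_notMem hxD _
        have p := pC x hs
        have q1 := mul_le_mul_of_nonneg_left p (b0.trans bt0)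
        have q2 := mul_le_mul_of_nonneg_right bt1 (show 0 ≤ C1 * V v x by positivity)
        rw [e1, e2]
        linarith
    · push Not at hs
      obtain ⟨z1, z2⟩ := pz x hs
      rw [z1, z2]
      have e1 : m1 x = 0 := Set.indicator_of_notMem (by
        intro hx
        have : sF v x0 x < τ ^ 2 := hx
        linarith) _
      have e2 : 0 ≤ m2 x := Set.indicator_nonneg (fun y hy => by
        have hx8 : y ∈ ball (0 : E3) 8 := ball_subset_ball (by norm_num) hy
        have Vp := h.gh.V_pos (mem89 hx8)
        have b0 := h.b_nonneg hx8
        positivity) x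
      rw [e1]; linarith
  have I := integral_mono (im1.sub im2) ia key
  rw [sa] at I
  have I2 : ∫ x, (m1 - m2) x = (∫ x, m1 x) - ∫ x, m2 x := integral_sub im1 im2
  rw [I2, hm1, hm2, integral_indicator mD, integral_indicator measurableSet_ball,
    integral_const_mul, integral_const_mul] at I
  have I3 : ∫ x in ball (0 : E3) 4, (b x * V v x + A * V v x) =
      (∫ x in ball (0 : E3) 4, b x * V v x) + A * ∫ x in ball (0 : E3) 4, V v x := by
    rw [← integral_const_mul]
    exact integral_add iB (iV.const_mul A)
  rw [I3] at I
  have a5 := H5 f v b h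
  have a4 : ∫ x in ball (0 : E3) 4, V v x ≤ C4 := (ball_int_mono cV (by norm_num) (fun x hx =>
    (h.gh.V_pos (ball_subset_ball (by norm_num) hx)).le)).trans (H4 f v h.gh)
  have a6 : (∫ x in ball (0 : E3) 4, b x * V v x) + A * ∫ x in ball (0 : E3) 4, V v x ≤ C5 + A * C4 :=
    add_le_add a5 (mul_le_mul_of_nonneg_left a4 A0)
  have a7 := mul_le_mul_of_nonneg_left a6 C10
  set X := ∫ x in D, b x * V v x
  have a8 : 1 / 2 * (1 / τ ^ 3) * X ≤ C1 * (C5 + A * C4) := by linarith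
  have t3 : 0 < τ ^ 3 := by positivity
  have a9 := mul_le_mul_of_nonneg_right a8 (show 0 ≤ 2 * τ ^ 3 by positivity)
  have : 1 / 2 * (1 / τ ^ 3) * X * (2 * τ ^ 3) = X := by field_simp
  linarith

end

section

variable {K : ℝ} {f : E3 × ℝ × E3 → ℝ} {v b : E3 → ℝ}

lemma exists_B {H : Fin 3 → Fin 3 → ℝ} (hs : ∀ i j, H i j = H j i) (hg : 0 < aG H) (hV : 0 < aV H) :
    ∃ B : E3 →ₗ[ℝ] E3, |LinearMap.det B| = aV H ∧
      ∀ y : E3, ‖B y‖ ^ 2 = aG H * ‖y‖ ^ 2 + ∑ k, (∑ i, H k i * y i) ^ 2 := by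
  obtain ⟨O, l, hO, hO', hH⟩ := exists_diag hs
  set M : Matrix (Fin 3) (Fin 3) ℝ := Matrix.of fun a i => √(aG H + l a ^ 2) * O i a with hM
  have hsq : ∀ a, √(aG H + l a ^ 2) * √(aG H + l a ^ 2) = aG H + l a ^ 2 := fun a =>
    Real.mul_self_sqrt (by positivity)
  have hHH : ∀ i j, ∑ k, H i k * H k j = ∑ a, l a ^ 2 * (O i a * O j a) := by
    intro i j
    have e : ∀ k, H i k * H k j = ∑ a, ∑ b, l a * l b * (O i a * O j b) * (O k a * O k b) := by
      intro k
      rw [hH i k, hH k j, Finset.sum_mul_sum]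
      refine Finset.sum_congr rfl fun a _ => Finset.sum_congr rfl fun b _ => by ring
    simp only [e]
    rw [Finset.sum_comm]
    refine Finset.sum_congr rfl fun a _ => ?_
    rw [Finset.sum_comm]
    simp only [← Finset.mul_sum, hO', mul_ite, mul_one, mul_zero, Finset.sum_ite_eq, Finset.mem_univ, if_true]
    ring
  have hMM : ∀ i j, ∑ a, M a i * M a j = (if i = j then aG H else 0) + ∑ k, H i k * H k j := by
    intro i j
    have e : ∀ a, M a i * M a j = aG H * (O i a * O j a) + l a ^ 2 * (O i a * O j a) := by
      intro a
      simp only [hM, Matrix.of_apply]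
      linear_combination (O i a * O j a) * hsq a
    simp only [e]
    rw [Finset.sum_add_distrib, ← Finset.mul_sum, hO, hHH]
    simp
  have hdet : M.det ^ 2 = aV H ^ 2 := by
    rw [← aV_det hs]
    have : (Matrix.of fun i j => (if i = j then aG H else 0) + ∑ k, H i k * H k j)
        = M.transpose * M := by
      ext i j
      rw [Matrix.mul_apply]
      simp only [Matrix.of_apply, Matrix.transpose_apply]
      exact (hMM i j).symm
    rw [this, Matrix.det_mul, Matrix.det_transpose]
    ring
  refine ⟨Matrix.toEuclideanLin M, ?_, ?_⟩
  · rw [Matrix.toEuclideanLin_eq_toLin, LinearMap.det_toLin]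
    have := sq_eq_sq_iff_abs_eq_abs _ _ |>.1 hdet
    rw [this, abs_of_pos hV]
  · intro y
    rw [EuclideanSpace.norm_sq_eq, EuclideanSpace.norm_sq_eq]
    simp only [Real.norm_eq_abs, sq_abs, Matrix.ofLp_toEuclideanLin_apply, Matrix.mulVec, dotProduct]
    have h1 : ∀ a, (∑ i, M a i * y i) ^ 2 = ∑ i, ∑ j, (y i * y j) * (M a i * M a j) := by
      intro a
      rw [sq, Finset.sum_mul_sum]
      refine Finset.sum_congr rfl fun i _ => Finset.sum_congr rfl fun j _ => by ring
    have h2 : ∀ k, (∑ i, H k i * y i) ^ 2 = ∑ i, ∑ j, (y i * y j) * (H i k * H k j) := by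
      intro a
      rw [sq, Finset.sum_mul_sum]
      refine Finset.sum_congr rfl fun i _ => Finset.sum_congr rfl fun j _ => ?_
      rw [hs a i]; ring
    simp only [h1, h2]
    rw [Finset.sum_comm, Finset.sum_comm (s := Finset.univ (α := Fin 3))
      (f := fun k i => ∑ j, (y i * y j) * (H i k * H k j)), Finset.mul_sum, ← Finset.sum_add_distrib]
    refine Finset.sum_congr rfl fun i _ => ?_
    rw [Finset.sum_comm, Finset.sum_comm (s := Finset.univ (α := Fin 3))
      (f := fun k j => (y i * y j) * (H i k * H k j))]
    simp only [← Finset.mul_sum, hMM, mul_add, Finset.sum_add_distrib]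
    simp
    ring

lemma GH.near (h : GH K f v) {x0 : E3} (hx0 : x0 ∈ ball (0 : E3) 9) :
    ∀ᶠ x in nhds x0, sF v x0 x ≤ 3 / 2 * (G v x0 * ‖x - x0‖ ^ 2
      + ∑ k, (∑ i, Hx v x0 k i * (x - x0) i) ^ 2) := by
  have Gp := h.G_pos hx0
  set ε := √(G v x0 / 18) with hε
  have εp : 0 < ε := Real.sqrt_pos.2 (by positivity)
  have ε2 : ε ^ 2 = G v x0 / 18 := Real.sq_sqrt (by positivity)
  have ev : ∀ k, ∀ᶠ x in nhds x0, |pd k v x - pd k v x0 - ∑ i, Hx v x0 k i * (x - x0) i|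
      ≤ ε * ‖x - x0‖ := by
    intro k
    have hd := (smooth_diff (pd_smooth h.sm k) x0).hasFDerivAt.isLittleO
    filter_upwards [hd.def εp] with x hx
    rw [fderiv_eq_inner] at hx
    rw [Real.norm_eq_abs] at hx
    convert hx using 3
    refine Finset.sum_congr rfl fun i _ => ?_
    rw [mul_comm]
    congr 1
    exact congrFun (hh_symm h.sm k i) x0
  filter_upwards [ev 0, ev 1, ev 2] with x k0 k1 k2
  have key : ∀ a e : ℝ, |e - a| ≤ ε * ‖x - x0‖ → e * e ≤ 3 / 2 * a ^ 2 + 3 * (G v x0 / 18 * ‖x - x0‖ ^ 2) := by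
    intro a e hae
    have : (e - a) ^ 2 ≤ (ε * ‖x - x0‖) ^ 2 := by
      rw [← sq_abs (e - a)]
      exact pow_le_pow_left₀ (abs_nonneg _) hae 2
    rw [mul_pow, ε2] at this
    nlinarith [sq_nonneg (2 * e - 3 * a), sq_nonneg (e - 3/2 * a), sq_nonneg (a - 2 * (e - a))]
  have q0 := key _ _ k0
  have q1 := key _ _ k1
  have q2 := key _ _ k2
  rw [sF, Nq_eq, Q]
  simp only [dg]
  rw [Fin.sum_univ_three, Fin.sum_univ_three (f := fun k => (∑ i, Hx v x0 k i * (x - x0) i) ^ 2)]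
  linarith

lemma b_bound (hK : 1 ≤ K) : ∃ C, ∀ (f : E3 × ℝ × E3 → ℝ) (v b : E3 → ℝ), BH K f v b →
    ∀ x0 ∈ ball (0 : E3) (1 / 2), b x0 ≤ C := by
  obtain ⟨C, C0, H⟩ := mean_value hK
  set om := (volume (ball (0 : E3) 1)).toReal with hom
  have omp : 0 < om := ENNReal.toReal_pos (measure_ball_pos _ _ one_pos).ne' measure_ball_lt_top.ne
  refine ⟨16 * C / om, ?_⟩
  intro f v b h x0 hx0
  have hx9 : x0 ∈ ball (0 : E3) 9 := ball_subset_ball (by norm_num) hx0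
  by_cases hb : b x0 ≤ 0
  · exact hb.trans (by positivity)
  push Not at hb
  have Gp := h.gh.G_pos hx9
  have Vp := h.gh.V_pos hx9
  obtain ⟨B, hB, hBy⟩ := exists_B (Hx_symm h.gh.sm x0) Gp Vp
  change |LinearMap.det B| = V v x0 at hB
  have cV : Continuous (V v) := (V_smooth h.gh.sm).continuous
  have cbV : Continuous (fun x => b x * V v x) := h.bs.continuous.mul cV
  have bV0 : 0 < b x0 * V v x0 := mul_pos hb Vp
  have e1 : ∀ᶠ x in nhds x0, b x0 * V v x0 / 2 < b x * V v x :=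
    cbV.continuousAt.eventually (lt_mem_nhds (by linarith))
  obtain ⟨δ, δ0, hδ⟩ := Metric.eventually_nhds_iff_ball.1 (e1.and (h.gh.near hx9))
  set τ := min (r1 K) (δ * √(G v x0)) with hτ
  have sG : 0 < √(G v x0) := Real.sqrt_pos.2 Gp
  have τ0 : 0 < τ := lt_min (r1_pos hK) (by positivity)
  have τ1 : τ ≤ r1 K := min_le_left _ _
  have τ2 : τ ≤ δ * √(G v x0) := min_le_right _ _
  have M := H f v b h x0 hx0 τ τ0 τ1
  set D := {x | sF v x0 x < τ ^ 2} with hD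
  set U : Set E3 := (fun x => x + -x0) ⁻¹' (B ⁻¹' ball 0 (τ / 2)) with hU
  have Umem : ∀ x ∈ U, x ∈ ball x0 δ ∧ x ∈ D := by
    intro x hx
    have h1 : ‖B (x - x0)‖ < τ / 2 := by simpa [hU, ← sub_eq_add_neg] using hx
    have h2 : ‖B (x - x0)‖ ^ 2 < τ ^ 2 / 4 := by
      have := pow_lt_pow_left₀ h1 (norm_nonneg _) (two_ne_zero)
      linarith [this, show (τ / 2) ^ 2 = τ ^ 2 / 4 by ring]
    have h3 := hBy (x - x0)
    have h4 : 0 ≤ ∑ k, (∑ i, Hx v x0 k i * (x - x0) i) ^ 2 := Finset.sum_nonneg fun _ _ => sq_nonneg _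
    change _ = G v x0 * _ + _ at h3
    have h5 : x ∈ ball x0 δ := by
      rw [mem_ball, dist_eq_norm]
      by_contra hn
      push Not at hn
      have a1 : δ ^ 2 ≤ ‖x - x0‖ ^ 2 := pow_le_pow_left₀ δ0.le hn 2
      have a2 : τ ^ 2 ≤ δ ^ 2 * G v x0 := by
        calc τ ^ 2 ≤ (δ * √(G v x0)) ^ 2 := pow_le_pow_left₀ τ0.le τ2 2
          _ = _ := by rw [mul_pow, Real.sq_sqrt Gp.le]
      have a3 := mul_le_mul_of_nonneg_left a1 Gp.le
      have : 0 < τ ^ 2 := by positivity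
      linarith
    refine ⟨h5, ?_⟩
    have h6 := (hδ x h5).2
    rw [← h3] at h6
    show sF v x0 x < τ ^ 2
    have : 0 < τ ^ 2 := by positivity
    linarith
  have mU : MeasurableSet U :=
    (B.continuous_of_finiteDimensional.comp (continuous_id.add continuous_const)).measurable
      measurableSet_ball
  have vU : volume U = ENNReal.ofReal ((τ / 2) ^ 3 / V v x0) * volume (ball (0 : E3) 1) := by
    have d0 : LinearMap.det B ≠ 0 := by
      intro h0; rw [h0, abs_zero] at hB; linarith
    rw [hU, measure_preimage_add_right, Measure.addHaar_preimage_linearMap _ d0,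
      Measure.addHaar_ball _ _ (by positivity), ← mul_assoc, ← ENNReal.ofReal_mul (abs_nonneg _),
      abs_inv, hB]
    simp only [finrank_euclideanSpace, Fintype.card_fin]
    congr 2
    field_simp
  have vU2 : volume.real U = (τ / 2) ^ 3 / V v x0 * om := by
    rw [Measure.real, vU, ENNReal.toReal_mul, ENNReal.toReal_ofReal (by positivity)]
  have ττ : τ ^ 2 ≤ r1 K ^ 2 := pow_le_pow_left₀ τ0.le τ1 2
  have rr : 0 < r1 K ^ 2 := pow_pos (r1_pos hK) 2
  have D4 : D ⊆ ball (0 : E3) 4 := fun x hx => (h.gh.small hx0 (by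
    have : sF v x0 x < τ ^ 2 := hx
    linarith)).2.2
  have mD : MeasurableSet D :=
    (isOpen_lt (sF_smooth h.gh.sm x0).continuous continuous_const).measurableSet
  have iD : IntegrableOn (fun x => b x * V v x) D := (cont_intOn cbV 4).mono_set D4
  have UD : U ⊆ D := fun x hx => (Umem x hx).2
  have i1 : ∫ x in U, b x * V v x ≤ ∫ x in D, b x * V v x := by
    refine setIntegral_mono_set iD ?_ UD.eventuallyLE
    refine (ae_restrict_iff' mD).2 (Filter.Eventually.of_forall fun x hx => ?_)
    have hx8 : x ∈ ball (0 : E3) 8 := ball_subset_ball (by norm_num) (D4 hx)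
    exact mul_nonneg (h.b_nonneg hx8) (h.gh.V_pos (mem89 hx8)).le
  have i2 : b x0 * V v x0 / 2 * volume.real U ≤ ∫ x in U, b x * V v x := by
    refine setIntegral_ge_of_const_le_real mU ?_ (fun x hx => (hδ x (Umem x hx).1).1.le) (iD.mono_set UD)
    rw [vU]
    exact ENNReal.mul_ne_top ENNReal.ofReal_ne_top measure_ball_lt_top.ne
  rw [vU2] at i2
  have e : b x0 * V v x0 / 2 * ((τ / 2) ^ 3 / V v x0 * om) = b x0 * om / 16 * τ ^ 3 := by
    field_simp
    ring
  rw [e] at i2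
  have i3 : b x0 * om / 16 ≤ C := le_of_mul_le_mul_right (i2.trans (i1.trans M)) (by positivity)
  rw [le_div_iff₀ omp]
  linarith

end

lemma extend_smooth {g : E3 → ℝ} {r R : ℝ} (hr : 0 < r) (hrR : r < R)
    (hg : ContDiffOn ℝ ∞ g (ball (0 : E3) R)) :
    ∃ w : E3 → ℝ, ContDiff ℝ ∞ w ∧ ∀ x ∈ ball (0 : E3) r, w x = g x := by
  let χ : ContDiffBump (0 : E3) := ⟨r, (r + R) / 2, hr, by linarith⟩
  refine ⟨fun x => χ x * g x, ?_, ?_⟩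
  · rw [contDiff_iff_contDiffAt]
    intro x
    by_cases hx : x ∈ ball (0 : E3) R
    · exact χ.contDiff.contDiffAt.mul (hg.contDiffAt (isOpen_ball.mem_nhds hx))
    · have : (fun x => χ x * g x) =ᶠ[nhds x] fun _ => (0 : ℝ) := by
        have hx' : x ∈ (closedBall (0 : E3) ((r + R) / 2))ᶜ := by
          intro h
          apply hx
          rw [mem_closedBall] at h
          rw [mem_ball]
          linarith
        filter_upwards [isClosed_closedBall.isOpen_compl.mem_nhds hx'] with y hy
        have : χ y = 0 := by
          apply χ.zero_of_le_dist
          by_contra hn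
          push Not at hn
          apply hy
          rw [mem_closedBall]
          exact hn.le
        rw [this, zero_mul]
      exact contDiffAt_const.congr_of_eventuallyEq this
  · intro x hx
    have : χ x = 1 := χ.one_of_mem_closedBall (ball_subset_closedBall hx)
    simp only [this, one_mul]

lemma main_bound {K : ℝ} (hK : 1 ≤ K) : ∃ C, 0 < C ∧ ∀ (f : E3 × ℝ × E3 → ℝ) (u : E3 → ℝ),
    Hyp K f u → ∀ x ∈ ball (0 : E3) (1 / 2), √(∑ i, ∑ j, (hess u x i j) ^ 2) ≤ C := by
  obtain ⟨C, hC⟩ := b_bound hK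
  refine ⟨Real.exp C, Real.exp_pos _, ?_⟩
  rintro f u ⟨fC, flow, fb, us, ueq, upos, ubd⟩ x0 hx0
  obtain ⟨v, vs, vu⟩ := extend_smooth (r := 9) (by norm_num) (by norm_num : (9 : ℝ) < 10) us
  have p1 : ∀ i, ∀ x ∈ ball (0 : E3) 9, pd i v x = pd i u x := fun i => pd_congr isOpen_ball vu i
  have p2 : ∀ i j, ∀ x ∈ ball (0 : E3) 9, pd i (pd j v) x = pd i (pd j u) x := fun i j =>
    pd_congr isOpen_ball (p1 j) i
  have hgrad : ∀ x ∈ ball (0 : E3) 9, grad v x = grad u x := by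
    intro x hx
    unfold grad
    congr 1
    funext i
    exact p1 i x hx
  have h910 : ∀ x ∈ ball (0 : E3) 9, x ∈ ball (0 : E3) 10 := fun x hx =>
    ball_subset_ball (by norm_num) hx
  have gh : GH K f v := by
    refine ⟨hK, fC, flow, fb, vs, ?_, ?_, ?_⟩
    · intro x hx
      rw [vu x hx, hgrad x hx, ← ueq x (h910 x hx)]
      simp only [G, aG, Hx, hh, sigma2, hess, p2 _ _ x hx, Matrix.trace, Matrix.diag, Matrix.mul_apply,
        Matrix.of_apply]
    · intro x hx
      have := upos x (h910 x hx)
      simp only [lap, hess, Matrix.of_apply] at this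
      simp only [S, hh, p2 _ _ x hx]
      exact this
    · intro x hx
      rw [vu x hx, hgrad x hx]
      exact ubd x (h910 x hx)
  have bon : ContDiffOn ℝ ∞ (fun x => Real.log (K * S v x)) (ball (0 : E3) 9) := by
    refine ContDiffOn.log (contDiff_const.mul (S_smooth vs)).contDiffOn ?_
    intro x hx
    have := gh.pos x hx
    positivity
  obtain ⟨b, bs, be⟩ := extend_smooth (r := 8) (by norm_num) (by norm_num : (8 : ℝ) < 9) bon
  have bh : BH K f v b := ⟨gh, bs, be⟩
  have hb := hC f v b bh x0 hx0
  have hx8 : x0 ∈ ball (0 : E3) 8 := ball_subset_ball (by norm_num) hx0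
  have hx9 := mem89 hx8
  have Sp := gh.pos x0 hx9
  have Gp := gh.G_pos hx9
  rw [be x0 hx8] at hb
  have hS : K * S v x0 ≤ Real.exp C := (Real.log_le_iff_le_exp (by positivity)).1 hb
  have hS2 : S v x0 ≤ Real.exp C := by nlinarith
  have e : ∑ i, ∑ j, (hess u x0 i j) ^ 2 = S v x0 ^ 2 - 2 * G v x0 := by
    have := frob_eq (Hx_symm vs x0)
    rw [S_eq, G, ← this]
    simp only [hess, Matrix.of_apply, Hx, hh, p2 _ _ x0 hx9]
  rw [e]
  apply Real.sqrt_le_iff.2 ⟨(Real.exp_pos _).le, ?_⟩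
  have := pow_le_pow_left₀ Sp.le hS2 2
  linarith

/-- Interior Hessian estimate: `sup_{B_{1/2}} |D²u| ≤ C` with `C = C(K)`,
where `|D²u|` is the Frobenius norm of the Hessian. -/
theorem stmt_0 :
    ∀ K : ℝ, 1 ≤ K → ∃ C : ℝ, 0 < C ∧
      ∀ (f : E3 × ℝ × E3 → ℝ) (u : E3 → ℝ), Hyp K f u →
        ∀ x ∈ ball (0 : E3) (1 / 2),
          Real.sqrt (∑ i, ∑ j, (hess u x i j) ^ 2) ≤ C := by
  intro K hK
  exact main_bound hK
end
end

section
/- Let n ≥ 2. There exists a constant c₁ > 0 depending only on n such that: for every λ ∈ ℝⁿ with λ₁ ≥ λ₂ ≥ ⋯ ≥ λₙ, σ₁(λ) > 0 and σ₂(λ) > 0, one has (σ₁(λ) − λ₁)·λ₁ ≥ c₁·σ₂(λ). -/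
/-- `σ₁² = |λ|² + 2 σ₂`. -/
lemma sq_sum_aux (n : ℕ) (lam : Fin n → ℝ) :
    (∑ i, lam i) ^ 2 = ∑ i, lam i ^ 2 +
      2 * ∑ i, ∑ j, (if i < j then lam i * lam j else 0) := by
  have h1 : (∑ i, lam i) ^ 2 = ∑ i, ∑ j, ((if i = j then lam i * lam j else 0) +
      (if i < j then lam i * lam j else 0) + (if j < i then lam j * lam i else 0)) := by
    rw [sq, Finset.sum_mul_sum]
    refine Finset.sum_congr rfl fun i _ => Finset.sum_congr rfl fun j _ => ?_
    rcases lt_trichotomy i j with h | h | h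
    · simp [h, h.ne, h.not_gt]
    · simp [h]
    · simp [h, h.ne', h.not_gt, mul_comm]
  have h2 : ∑ i, ∑ j, (if j < i then lam j * lam i else 0) =
      ∑ i, ∑ j, (if i < j then lam i * lam j else 0) := Finset.sum_comm
  rw [h1]
  simp only [Finset.sum_add_distrib]
  rw [h2]
  simp [sq]
  ring

/-- Lemma 2, first part: for ordered `λ ∈ Γ₂` in `ℝⁿ` one has
`σ₂^{11}(λ) λ₁ = (σ₁(λ) − λ₁) λ₁ ≥ c₁ σ₂(λ)` with `c₁ = c₁(n) > 0`. -/
theorem stmt_1 (n : ℕ) (hn : 2 ≤ n) :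
    ∃ c₁ : ℝ, 0 < c₁ ∧
      ∀ lam : Fin n → ℝ,
        (∀ i j : Fin n, i ≤ j → lam j ≤ lam i) →
        0 < ∑ i, lam i →
        0 < ∑ i, ∑ j, (if i < j then lam i * lam j else 0) →
        ((∑ i, lam i) - lam ⟨0, by omega⟩) * lam ⟨0, by omega⟩ ≥
          c₁ * ∑ i, ∑ j, (if i < j then lam i * lam j else 0) := by
  refine ⟨2 / (n + 1), by positivity, fun lam hmono hS hs => ?_⟩
  have key := sq_sum_aux n lam
  have hle : ∑ i, lam i ≤ n * lam ⟨0, by omega⟩ := by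
    have := Finset.sum_le_card_nsmul Finset.univ lam (lam ⟨0, by omega⟩)
      (fun i _ => hmono _ _ (Fin.mk_le_of_le_val (Nat.zero_le _)))
    simpa using this
  have hsq : lam ⟨0, by omega⟩ ^ 2 ≤ ∑ i, lam i ^ 2 :=
    Finset.single_le_sum (f := fun i => lam i ^ 2) (fun i _ => sq_nonneg _) (Finset.mem_univ _)
  generalize (∑ i, ∑ j, (if i < j then lam i * lam j else 0)) = s at *
  generalize (∑ i, lam i) = S at *
  generalize lam ⟨0, _⟩ = a at *
  have hT : 0 < S - a := by
    have : a < S := lt_of_pow_lt_pow_left₀ 2 hS.le (by linarith)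
    linarith
  have hn' : (0 : ℝ) < n + 1 := by positivity
  rw [ge_iff_le, div_mul_eq_mul_div, div_le_iff₀ hn']
  nlinarith [mul_le_mul_of_nonneg_left hle hT.le]
end

section
/- Let n ≥ 2. There exists a constant c₂ > 0 depending only on n such that: for every λ ∈ ℝⁿ with λ₁ ≥ λ₂ ≥ ⋯ ≥ λₙ, σ₁(λ) > 0 and σ₂(λ) > 0, and every index j with 2 ≤ j ≤ n, one has σ₁(λ) − λⱼ ≥ c₂·σ₁(λ). -/
/-- Lemma 2, second part: for ordered `λ ∈ Γ₂` in `ℝⁿ` and any index `j ≥ 2` one has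
`σ₂^{jj}(λ) = σ₁(λ) − λⱼ ≥ c₂ σ₁(λ)` with `c₂ = c₂(n) > 0`. -/
theorem stmt_2 (n : ℕ) (hn : 2 ≤ n) :
    ∃ c₂ : ℝ, 0 < c₂ ∧
      ∀ lam : Fin n → ℝ,
        (∀ i j : Fin n, i ≤ j → lam j ≤ lam i) →
        0 < ∑ i, lam i →
        0 < ∑ i, ∑ j, (if i < j then lam i * lam j else 0) →
        ∀ j : Fin n, 0 < (j : ℕ) →
          (∑ i, lam i) - lam j ≥ c₂ * ∑ i, lam i := by
  refine ⟨1/4, by norm_num, ?_⟩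
  intro lam hord h1 h2 j hj
  have key : (∑ i, lam i) ^ 2 = ∑ i, lam i ^ 2
      + 2 * ∑ i, ∑ j, (if i < j then lam i * lam j else 0) := by
    have hsw : ∑ i, ∑ j, (if j < i then lam i * lam j else 0)
        = ∑ i, ∑ j, (if i < j then lam i * lam j else 0) := by
      rw [Finset.sum_comm]
      simp only [mul_comm]
    have hd : ∑ i, lam i ^ 2 = ∑ i, ∑ j, (if i = j then lam i * lam j else 0) := by
      simp [pow_two]
    rw [two_mul]
    nth_rewrite 1 [← hsw]
    rw [hd, pow_two, Finset.sum_mul_sum, ← Finset.sum_add_distrib, ← Finset.sum_add_distrib]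
    refine Finset.sum_congr rfl fun a _ => ?_
    rw [← Finset.sum_add_distrib, ← Finset.sum_add_distrib]
    refine Finset.sum_congr rfl fun b _ => ?_
    rcases lt_trichotomy a b with h | h | h
    · simp [h, h.ne, h.not_gt]
    · simp [h]
    · simp [h, h.ne', h.not_gt]
  let z : Fin n := ⟨0, by omega⟩
  have hzj : z ≠ j := by
    intro h
    rw [← h] at hj
    exact absurd hj (lt_irrefl 0)
  have hle : lam j ≤ lam z := hord z j (Fin.mk_le_of_le_val (Nat.zero_le _))
  have hpair : lam z ^ 2 + lam j ^ 2 ≤ ∑ i, lam i ^ 2 := by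
    rw [← Finset.sum_pair (f := fun i => lam i ^ 2) hzj]
    exact Finset.sum_le_sum_of_subset_of_nonneg (Finset.subset_univ _)
      fun i _ _ => sq_nonneg _
  by_contra hc
  have hc' : 3/4 * ∑ i, lam i < lam j := by linarith [not_le.mp hc]
  nlinarith
end
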